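/- Suppose that either t = 1, n ≥ 2k+5 and k ≥ 35, or 2 ≤ t ≤ k/4 − 2 and n ≥ 2k+14t. Then every non-trivial intersecting family F of k-element subsets of [n] satisfies δ_t(F) ≤ C(n−t−1, k−t−1) − C(n−t−k−1, k−t−1). -/

import Mathlib

open Finset

def IntersectingFam (F : Finset (Finset ℕ)) : Prop :=
  ∀ A ∈ F, ∀ B ∈ F, (A ∩ B).Nonempty

def CrossIntersecting (𝒜 ℬ : Finset (Finset ℕ)) : Prop :=
  ∀ A ∈ 𝒜, ∀ B ∈ ℬ, (A ∩ B).Nonempty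

/-- The degree of an element `i`: the number of sets of `F` containing `i`. -/
def famDeg (F : Finset (Finset ℕ)) (i : ℕ) : ℕ := (F.filter (fun A => i ∈ A)).card

/-- The maximal degree `Δ(F)` over the ground set `[n]`. -/
def maxDeg (n : ℕ) (F : Finset (Finset ℕ)) : ℕ := (Finset.Icc 1 n).sup (famDeg F)

/-- The diversity `γ(F) = |F| − Δ(F)`. -/
def diversity (n : ℕ) (F : Finset (Finset ℕ)) : ℕ := F.card - maxDeg n F

/-- The degree of a subset `S`: the number of sets of `F` containing `S`. -/
def tDeg (F : Finset (Finset ℕ)) (S : Finset ℕ) : ℕ := (F.filter (fun A => S ⊆ A)).card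

/-- Lexicographic order: `A ⪯ B` iff `A ⊇ B` or `min (A \ B) < min (B \ A)`. -/
def lexLE (A B : Finset ℕ) : Prop := B ⊆ A ∨ (A \ B).min < (B \ A).min

instance : DecidableRel lexLE := fun A B => by unfold lexLE; exact inferInstance

def lexLT (A B : Finset ℕ) : Prop := lexLE A B ∧ A ≠ B

/-- Lex family with characteristic set `X` on ground set `[2,n]`:
`L(X,a) = {A ⊆ [2,n] : |A| = a, A ⪯ X ∩ [2,n]}`. -/
def lexFam (n a : ℕ) (X : Finset ℕ) : Finset (Finset ℕ) :=
  ((Finset.Icc 2 n).powersetCard a).filter (fun A => lexLE A (X ∩ Finset.Icc 2 n))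

/-- Lex family with characteristic set `X` on ground set `[n]`:
`L(X,c) = {A ⊆ [n] : |A| = c, A ⪯ X}`. -/
def lexFam1 (n c : ℕ) (X : Finset ℕ) : Finset (Finset ℕ) :=
  ((Finset.Icc 1 n).powersetCard c).filter (fun A => lexLE A X)

/-- Resistant pairs for uniformity `k` on ground set `[n]`. -/
def ResistantPair (n k : ℕ) (S T : Finset ℕ) : Prop :=
  (S = ({1, 4} : Finset ℕ) ∧ T = ({2, 3, 4} : Finset ℕ)) ∨
  (1 ∈ S ∧ S ⊆ Finset.Icc 1 n ∧ T ⊆ Finset.Icc 2 n ∧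
    ∃ j : ℕ, T.max = (j : WithTop ℕ) ∧ S ∩ T = {j} ∧ S ∪ T = Finset.Icc 1 j ∧
      S.card ≤ k ∧ T.card ≤ k ∧
      ∀ i : ℕ, 4 ≤ i → i ≤ j → (Finset.Icc 1 i ∩ S).card < (Finset.Icc 1 i \ S).card)

/-- `(a,b)`-resistant pairs on ground set `[n]`. -/
def ABResistantPair (n a b : ℕ) (S T : Finset ℕ) : Prop :=
  (T = Finset.Icc 1 (b - a + 2) ∧ S = ({1, b - a + 2} : Finset ℕ)) ∨
  (S ⊆ Finset.Icc 1 n ∧ T ⊆ Finset.Icc 1 n ∧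
    ∃ j : ℕ, T.max = (j : WithTop ℕ) ∧ S ∩ T = {j} ∧ S ∪ T = Finset.Icc 1 j ∧
      S.card ≤ a ∧ T.card ≤ b ∧
      ∀ i : ℕ, b - a + 2 ≤ i → i ≤ j →
        ((Finset.Icc 1 i ∩ S).card : ℤ) - (a : ℤ) < ((Finset.Icc 1 i \ S).card : ℤ) - (b : ℤ))

/-- Resistant numbers: `γ` is resistant if in its `(n−k−1)`-cascade form
`γ = Σ_{i=1}^s C(n−b_i, n−k−i)` (with `1 ≤ b_1 < … < b_s`) one has `|S_γ| ≤ k`,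
`s ≤ k−1` and `b_i > 2i+2` for each `i`; in addition `C(n−4,k−3)` is resistant. -/
def IsResistantNum (n k γ : ℕ) : Prop :=
  γ = Nat.choose (n - 4) (k - 3) ∨
  ∃ (s : ℕ) (b : ℕ → ℕ), 1 ≤ s ∧ 1 ≤ b 1 ∧
    (∀ i j, 1 ≤ i → i < j → j ≤ s → b i < b j) ∧
    γ = ∑ i ∈ Finset.Icc 1 s, Nat.choose (n - b i) (n - k - i) ∧
    s ≤ k - 1 ∧
    (insert (b s) (Finset.Icc 2 (b s) \ (Finset.Icc 1 s).image b)).card ≤ k ∧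
    (∀ i, 1 ≤ i → i ≤ s → b i > 2 * i + 2)

/-- The family `J_i`. -/
def Jfam (n k i : ℕ) : Finset (Finset ℕ) :=
  {Finset.Icc 2 (k+1), Finset.Icc (i+1) (k+i)} ∪
    ((Finset.Icc 1 n).powersetCard k).filter
      (fun F => 1 ∈ F ∧ (F ∩ Finset.Icc 2 (k+1)).Nonempty ∧ (F ∩ Finset.Icc (i+1) (k+i)).Nonempty)

/-- Two families are isomorphic if one is obtained from the other by a permutation
of the ground set `[n]`. -/
def IsomorphicFam (n : ℕ) (F G : Finset (Finset ℕ)) : Prop :=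
  ∃ σ : Equiv.Perm ℕ, (Finset.Icc 1 n).image σ = Finset.Icc 1 n ∧
    F.image (fun A => A.image σ) = G

/-- `F` is isomorphic to a subfamily of `G`. -/
def IsoSubfamily (n : ℕ) (F G : Finset (Finset ℕ)) : Prop :=
  ∃ σ : Equiv.Perm ℕ, (Finset.Icc 1 n).image σ = Finset.Icc 1 n ∧
    F.image (fun A => A.image σ) ⊆ G

/-- `L` is an initial segment of the lex order on `k`-subsets of `[2,n]`. -/
def IsInitialSeg (n k : ℕ) (L : Finset (Finset ℕ)) : Prop :=
  L ⊆ (Finset.Icc 2 n).powersetCard k ∧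
  ∀ A ∈ L, ∀ B ∈ (Finset.Icc 2 n).powersetCard k, lexLE B A → B ∈ L

/-- The maximal intersecting family `F_l` whose sets avoiding `1` are exactly `L`. -/
def maxFam (n k : ℕ) (L : Finset (Finset ℕ)) : Finset (Finset ℕ) :=
  L ∪ ((Finset.Icc 1 n).powersetCard k).filter
    (fun A => 1 ∈ A ∧ ∀ B ∈ L, (A ∩ B).Nonempty)

/-- The sets `T` allowed in the recursive definition of a `T_l`-neutral pair:
`T_l` is allowed, and whenever `T'` is allowed so is `T' ∪ {2|T'|}`. -/
inductive NeutralSet (T0 : Finset ℕ) : Finset ℕ → Prop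
  | base : NeutralSet T0 T0
  | step (T' : Finset ℕ) : NeutralSet T0 T' → NeutralSet T0 (insert (2 * T'.card) T')

/-- The family `A_0(n,k,s)`. -/
def A0fam (n k s : ℕ) : Finset (Finset ℕ) :=
  ((Finset.Icc 1 n).powersetCard k).filter (fun A => (A ∩ Finset.Icc 1 s).Nonempty)

section

/-- The binomial coefficient `x (x - 1) ⋯ (x - r + 1) / r!` with a real upper argument. -/
noncomputable def rchoose (x : ℝ) : ℕ → ℝ
  | 0 => 1
  | r + 1 => rchoose x r * (x - r) / (r + 1)

lemma rchoose_zero (x : ℝ) : rchoose x 0 = 1 := rfl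

lemma rchoose_succ (x : ℝ) (r : ℕ) :
    rchoose x (r + 1) = rchoose x r * (x - r) / (r + 1) := rfl

lemma rchoose_natCast (n r : ℕ) : rchoose n r = n.choose r := by
  induction r with
  | zero => simp [rchoose]
  | succ r ih =>
    rw [rchoose_succ, ih, div_eq_iff (by positivity)]
    have h := Nat.choose_succ_right_eq n r
    rcases le_or_gt r n with hr | hr
    · rw [← Nat.cast_sub hr]
      exact_mod_cast h.symm
    · simp [Nat.choose_eq_zero_of_lt hr, Nat.choose_eq_zero_of_lt (hr.trans (Nat.lt_succ_self r))]

lemma rchoose_nonneg {x : ℝ} {r : ℕ} (h : (r : ℝ) ≤ x + 1) : 0 ≤ rchoose x r := by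
  induction r with
  | zero => simp [rchoose]
  | succ r ih =>
    push_cast at h
    rw [rchoose_succ]
    have := ih (by linarith)
    have : (0 : ℝ) ≤ x - r := by linarith
    positivity

lemma rchoose_pos {x : ℝ} {r : ℕ} (h : (r : ℝ) < x + 1) : 0 < rchoose x r := by
  induction r with
  | zero => simp [rchoose]
  | succ r ih =>
    push_cast at h
    rw [rchoose_succ]
    have := ih (by linarith)
    have : (0 : ℝ) < x - r := by linarith
    positivity

lemma rchoose_mono {x y : ℝ} {r : ℕ} (h : (r : ℝ) ≤ x + 1) (hxy : x ≤ y) :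
    rchoose x r ≤ rchoose y r := by
  induction r with
  | zero => simp [rchoose]
  | succ r ih =>
    push_cast at h
    rw [rchoose_succ, rchoose_succ]
    have h1 := ih (by linarith)
    have h2 : 0 ≤ rchoose x r := rchoose_nonneg (by linarith)
    have : (0 : ℝ) ≤ x - r := by linarith
    gcongr
    linarith

lemma rchoose_strictMono {x y : ℝ} {r : ℕ} (hr : 1 ≤ r) (h : (r : ℝ) ≤ x + 1) (hxy : x < y) :
    rchoose x r < rchoose y r := by
  obtain ⟨r, rfl⟩ := Nat.exists_eq_succ_of_ne_zero (Nat.one_le_iff_ne_zero.mp hr)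
  push_cast at h
  rw [Nat.succ_eq_add_one, rchoose_succ, rchoose_succ]
  have h1 : rchoose x r ≤ rchoose y r := rchoose_mono (by linarith) hxy.le
  have h2 : 0 < rchoose y r := rchoose_pos (by linarith)
  have : (0 : ℝ) ≤ x - r := by linarith
  apply div_lt_div_of_pos_right _ (by positivity)
  nlinarith

lemma continuous_rchoose (r : ℕ) : Continuous fun x => rchoose x r := by
  induction r with
  | zero => simpa [rchoose] using continuous_const
  | succ r ih =>
    simp only [rchoose_succ]
    fun_prop

lemma rchoose_absorb (x : ℝ) (r : ℕ) :
    rchoose x (r + 1) = x / (r + 1) * rchoose (x - 1) r := by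
  induction r with
  | zero => simp [rchoose]
  | succ r ih =>
    rw [rchoose_succ, ih, rchoose_succ (x - 1)]
    push_cast
    have : (r : ℝ) + 1 ≠ 0 := by positivity
    have : (r : ℝ) + 1 + 1 ≠ 0 := by positivity
    field_simp
    ring

lemma rchoose_pascal (x : ℝ) (r : ℕ) :
    rchoose (x - 1) (r + 1) + rchoose (x - 1) r = rchoose x (r + 1) := by
  rw [rchoose_absorb x, rchoose_succ]
  have : (r : ℝ) + 1 ≠ 0 := by positivity
  field_simp
  ring

lemma rchoose_self (r : ℕ) : rchoose r r = 1 := by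
  simp [rchoose_natCast]

lemma exists_rchoose_eq {x c : ℝ} {r : ℕ} (hr : (r : ℝ) ≤ x) (h1 : 1 ≤ c)
    (hc : c ≤ rchoose x r) : ∃ y, (r : ℝ) ≤ y ∧ y ≤ x ∧ rchoose y r = c := by
  have := intermediate_value_Icc hr (continuous_rchoose r).continuousOn
  obtain ⟨y, hy, hyc⟩ := this ⟨by rw [rchoose_self]; exact h1, hc⟩
  exact ⟨y, hy.1, hy.2, hyc⟩

open scoped FinsetFamily

variable {α : Type*} [DecidableEq α]

lemma sum_card_memberSubfamily {H : Finset (Finset α)} {m : ℕ} {V : Finset α}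
    (hm : ∀ A ∈ H, A.card = m) (hV : ∀ A ∈ H, A ⊆ V) :
    ∑ v ∈ V, (H.memberSubfamily v).card = m * H.card := by
  have h : ∀ v, (H.memberSubfamily v).card = (H.filter (fun A => v ∈ A)).card := by
    intro v
    rw [memberSubfamily, card_image_of_injOn]
    intro A hA B hB h
    simp only [coe_filter, Set.mem_ofPred_eq] at hA hB
    exact (insert_erase hA.2).symm.trans ((congrArg (insert v) h).trans (insert_erase hB.2))
  simp_rw [h, card_filter]
  rw [sum_comm, mul_comm, ← smul_eq_mul, ← sum_const]
  refine sum_congr rfl fun A hA => ?_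
  rw [← card_filter, ← hm A hA]
  congr 1
  ext v
  simp only [mem_filter]
  exact ⟨fun h => h.2, fun h => ⟨hV A hA h, h⟩⟩

lemma memberSubfamily_subset_nonMemberSubfamily_shadow (H : Finset (Finset α)) (v : α) :
    H.memberSubfamily v ⊆ (∂ H).nonMemberSubfamily v := by
  intro A hA
  rw [mem_memberSubfamily] at hA
  rw [mem_nonMemberSubfamily, mem_shadow_iff_insert_mem]
  exact ⟨⟨v, hA.2, hA.1⟩, hA.2⟩

lemma shadow_memberSubfamily_subset (H : Finset (Finset α)) (v : α) :
    ∂ (H.memberSubfamily v) ⊆ (∂ H).memberSubfamily v := by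
  intro A hA
  rw [mem_shadow_iff_insert_mem] at hA
  obtain ⟨w, hw, h⟩ := hA
  rw [mem_memberSubfamily] at h
  rw [mem_memberSubfamily, mem_shadow_iff_insert_mem]
  refine ⟨⟨w, ?_, ?_⟩, ?_⟩
  · rw [mem_insert, not_or]
    refine ⟨?_, hw⟩
    rintro rfl
    exact h.2 (mem_insert_self _ _)
  · rw [insert_comm]; exact h.1
  · exact fun hv => h.2 (mem_insert_of_mem hv)

/-- Lovász's form of the Kruskal–Katona theorem. -/
theorem card_le_rchoose_of_card_shadow_le (r : ℕ) :
    ∀ {x : ℝ} {H : Finset (Finset α)}, 1 ≤ r → (∀ A ∈ H, A.card = r + 1) → (r : ℝ) ≤ x →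
      ((∂ H).card : ℝ) ≤ rchoose x r → (H.card : ℝ) ≤ rchoose x (r + 1) := by
  induction r with
  | zero => intro x H h; omega
  | succ r ih =>
    intro x H _ hH hx hcard
    push_cast at hx
    set V : Finset α := H.biUnion id with hVdef
    have hV : ∀ A ∈ H, A ⊆ V := fun A hA => subset_biUnion_of_mem id hA
    have hV' : ∀ A ∈ ∂ H, A ⊆ V := by
      intro A hA
      obtain ⟨w, hw, h⟩ := mem_shadow_iff_insert_mem.mp hA
      exact (subset_insert _ _).trans (hV _ h)
    have hH' : ∀ A ∈ ∂ H, A.card = r + 1 := by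
      intro A hA
      obtain ⟨w, hw, h⟩ := mem_shadow_iff_insert_mem.mp hA
      have := hH _ h
      rw [card_insert_of_notMem hw] at this
      omega
    have hpos : (0 : ℝ) < r + 1 := by positivity
    have key : ∀ v ∈ V, ((H.memberSubfamily v).card : ℝ) * (r + 1) ≤
        (x - (r + 1)) * ((∂ H).memberSubfamily v).card := by
      intro v hv
      have ha : ((H.memberSubfamily v).card : ℝ) + ((∂ H).memberSubfamily v).card
          ≤ (∂ H).card := by
        have h1 := card_le_card (memberSubfamily_subset_nonMemberSubfamily_shadow H v)
        have h2 := card_memberSubfamily_add_card_nonMemberSubfamily v (∂ H)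
        exact_mod_cast (show _ ≤ _ by omega)
      have hb : ((∂ (H.memberSubfamily v)).card : ℝ) ≤ ((∂ H).memberSubfamily v).card := by
        exact_mod_cast card_le_card (shadow_memberSubfamily_subset H v)
      have hsize : ∀ A ∈ H.memberSubfamily v, A.card = r + 1 := by
        intro A hA
        rw [mem_memberSubfamily] at hA
        have := hH _ hA.1
        rw [card_insert_of_notMem hA.2] at this
        omega
      by_cases hd : rchoose (x - 1) r ≤ ((∂ H).memberSubfamily v).card
      · have h1 := rchoose_pascal x r
        have h2 : rchoose (x - 1) (r + 1) * (r + 1) = rchoose (x - 1) r * (x - 1 - r) := by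
          rw [rchoose_succ]; field_simp
        have h3 : ((H.memberSubfamily v).card : ℝ) ≤ rchoose (x - 1) (r + 1) := by linarith
        nlinarith
      · push Not at hd
        have hd1 : (1 : ℝ) ≤ ((∂ H).memberSubfamily v).card := by
          simp only [hVdef, mem_biUnion, id] at hv
          obtain ⟨A, hA, hvA⟩ := hv
          have hcA := hH A hA
          obtain ⟨w, hwA, hwv⟩ : ∃ w ∈ A, w ≠ v := by
            apply exists_mem_ne
            omega
          have : ((∂ H).memberSubfamily v).Nonempty := by
            refine ⟨(A.erase w).erase v, ?_⟩
            rw [mem_memberSubfamily]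
            refine ⟨?_, notMem_erase _ _⟩
            rw [insert_erase (mem_erase.mpr ⟨hwv.symm, hvA⟩)]
            exact erase_mem_shadow hA hwA
          exact_mod_cast this.card_pos
        have hr1 : 1 ≤ r := by
          by_contra h
          have : r = 0 := by omega
          subst this
          rw [rchoose_zero] at hd
          linarith
        obtain ⟨y, hy1, hy2, hy3⟩ := exists_rchoose_eq (x := x - 1) (r := r) (by linarith) hd1 hd.le
        have h := ih (x := y) (H := H.memberSubfamily v) hr1 hsize hy1 (by rw [hy3]; exact hb)
        rw [rchoose_succ, hy3, le_div_iff₀ hpos] at h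
        refine h.trans ?_
        rw [mul_comm]
        exact mul_le_mul_of_nonneg_right (by linarith) (Nat.cast_nonneg _)
    have hsum := sum_le_sum key
    rw [← sum_mul, ← mul_sum, ← Nat.cast_sum, ← Nat.cast_sum, sum_card_memberSubfamily hH hV,
      sum_card_memberSubfamily hH' hV'] at hsum
    rw [rchoose_succ, le_div_iff₀ (by positivity)]
    push_cast at hsum ⊢
    have h4 : (H.card : ℝ) * (r + 1 + 1) ≤ (x - (r + 1)) * (∂ H).card := by
      have : ((H.card : ℝ) * (r + 1 + 1)) * (r + 1) ≤ ((x - (r + 1)) * (∂ H).card) * (r + 1) := by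
        linarith
      exact le_of_mul_le_mul_right this hpos
    have : (x - (r + 1)) * (∂ H).card ≤ (x - (r + 1)) * rchoose x (r + 1) := by
      gcongr
    linarith

theorem rchoose_le_card_shadow {x : ℝ} {m : ℕ} {H : Finset (Finset α)}
    (hH : ∀ A ∈ H, A.card = m + 1) (hx : (m : ℝ) + 1 ≤ x) (hcard : rchoose x (m + 1) ≤ H.card) :
    rchoose x m ≤ (∂ H).card := by
  have hHne : H.Nonempty := by
    rw [← card_pos]
    have : 0 < rchoose x (m + 1) := rchoose_pos (by push_cast; linarith)
    exact_mod_cast this.trans_le hcard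
  have hS : 1 ≤ (∂ H).card := by
    obtain ⟨A, hA⟩ := hHne
    have := hH A hA
    obtain ⟨a, ha⟩ : A.Nonempty := by rw [← card_pos]; omega
    exact card_pos.mpr ⟨_, erase_mem_shadow hA ha⟩
  rcases Nat.eq_zero_or_pos m with rfl | hm
  · rw [rchoose_zero]; exact_mod_cast hS
  by_contra hlt
  push Not at hlt
  obtain ⟨y, hy1, hy2, hy3⟩ := exists_rchoose_eq (x := x) (r := m) (c := (∂ H).card)
    (by linarith) (by exact_mod_cast hS) hlt.le
  have h := card_le_rchoose_of_card_shadow_le (x := y) m hm hH hy1 hy3.ge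
  have hyx : y < x := by
    rcases hy2.lt_or_eq with h | rfl
    · exact h
    · rw [hy3] at hlt; exact absurd hlt (lt_irrefl _)
  have := rchoose_strictMono (r := m + 1) (by omega) (by push_cast; linarith) hyx
  linarith

theorem rchoose_le_card_iterate_shadow {x : ℝ} (i : ℕ) :
    ∀ {m : ℕ} {H : Finset (Finset α)}, (∀ A ∈ H, A.card = m + i) → (m : ℝ) + i ≤ x →
      rchoose x (m + i) ≤ H.card → rchoose x m ≤ (∂^[i] H).card := by
  induction i with
  | zero => intro m H _ _ h; simpa using h
  | succ i ih =>
    intro m H hH hx hcard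
    rw [Function.iterate_succ_apply]
    push_cast at hx
    refine ih (m := m) ?_ (by linarith) ?_
    · intro A hA
      obtain ⟨w, hw, h⟩ := mem_shadow_iff_insert_mem.mp hA
      have := hH _ h
      rw [card_insert_of_notMem hw] at this
      omega
    · exact rchoose_le_card_shadow (m := m + i) hH (by push_cast; linarith) hcard

end

open scoped FinsetFamily

lemma card_image_sdiff {X : Finset ℕ} {𝒜 : Finset (Finset ℕ)} (h : ∀ A ∈ 𝒜, A ⊆ X) :
    (𝒜.image (X \ ·)).card = 𝒜.card := by
  refine card_image_of_injOn fun A hA B hB hAB => ?_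
  have h1 := Finset.sdiff_sdiff_eq_self (h A hA)
  have h2 := Finset.sdiff_sdiff_eq_self (h B hB)
  rw [← h1, ← h2, hAB]

/-- The lower bound for the upper shadow of a uniform family, in terms of complements. -/
lemma exists_large_compl_shadow {X : Finset ℕ} {a b : ℕ} {𝒜 : Finset (Finset ℕ)} {y : ℝ}
    (h𝒜 : 𝒜 ⊆ X.powersetCard a) (hab : a + b ≤ X.card) (hy : (X.card : ℝ) - a ≤ y)
    (hcard : rchoose y (X.card - a) ≤ 𝒜.card) :
    ∃ 𝒟 : Finset (Finset ℕ), 𝒟 ⊆ X.powersetCard b ∧ rchoose y b ≤ 𝒟.card ∧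
      ∀ D ∈ 𝒟, ∃ A ∈ 𝒜, A ∩ D = ∅ := by
  have hsub : ∀ A ∈ 𝒜, A ⊆ X := fun A hA => (mem_powersetCard.mp (h𝒜 hA)).1
  have hN : X.card - a = b + (X.card - a - b) := by omega
  have hsize : ∀ B ∈ 𝒜.image (X \ ·), B.card = b + (X.card - a - b) := by
    intro B hB
    obtain ⟨A, hA, rfl⟩ := mem_image.mp hB
    have := mem_powersetCard.mp (h𝒜 hA)
    rw [card_sdiff_of_subset this.1, this.2, ← hN]
  refine ⟨∂^[X.card - a - b] (𝒜.image (X \ ·)), ?_, ?_, ?_⟩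
  · intro D hD
    rw [mem_shadow_iterate_iff_exists_sdiff] at hD
    obtain ⟨B, hB, hDB, hc⟩ := hD
    have h1 := hsize B hB
    have h2 := card_sdiff_add_card_eq_card hDB
    obtain ⟨A, hA, rfl⟩ := mem_image.mp hB
    exact mem_powersetCard.mpr ⟨hDB.trans sdiff_subset, by omega⟩
  · refine rchoose_le_card_iterate_shadow _ hsize ?_ ?_
    · have : ((X.card - a - b : ℕ) : ℝ) = X.card - a - b := by
        rw [Nat.cast_sub (by omega), Nat.cast_sub (by omega)]
      rw [this]; linarith
    · rwa [card_image_sdiff hsub, ← hN]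
  · intro D hD
    rw [mem_shadow_iterate_iff_exists_sdiff] at hD
    obtain ⟨B, hB, hDB, hc⟩ := hD
    obtain ⟨A, hA, rfl⟩ := mem_image.mp hB
    refine ⟨A, hA, ?_⟩
    rw [← disjoint_iff_inter_eq_empty]
    exact disjoint_of_subset_right hDB disjoint_sdiff

theorem CrossIntersecting.card_add_rchoose_le {X : Finset ℕ} {a b : ℕ}
    {𝒜 ℬ : Finset (Finset ℕ)} {y : ℝ} (hcr : CrossIntersecting 𝒜 ℬ)
    (h𝒜 : 𝒜 ⊆ X.powersetCard a) (hℬ : ℬ ⊆ X.powersetCard b) (hab : a + b ≤ X.card)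
    (hy : (X.card : ℝ) - a ≤ y) (hcard : rchoose y (X.card - a) ≤ 𝒜.card) :
    (ℬ.card : ℝ) + rchoose y b ≤ X.card.choose b := by
  obtain ⟨𝒟, hD1, hD2, hD3⟩ := exists_large_compl_shadow h𝒜 hab hy hcard
  have hdisj : Disjoint ℬ 𝒟 := by
    rw [disjoint_left]
    intro B hB hD
    obtain ⟨A, hA, h⟩ := hD3 B hD
    have := hcr A hA B hB
    rw [h] at this
    exact not_nonempty_empty this
  have h := card_le_card (union_subset hℬ hD1)
  rw [card_union_of_disjoint hdisj, card_powersetCard] at h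
  have h' : (ℬ.card : ℝ) + 𝒟.card ≤ X.card.choose b := by exact_mod_cast h
  linarith

theorem rchoose_le_card_of_superset {X : Finset ℕ} {a b : ℕ}
    {𝒜 𝒢 : Finset (Finset ℕ)} {y : ℝ}
    (h𝒜 : 𝒜 ⊆ X.powersetCard a) (h𝒢 : ∀ A ∈ 𝒜, ∀ B ∈ X.powersetCard b, A ⊆ B → B ∈ 𝒢)
    (hab : a ≤ b) (hb : b ≤ X.card)
    (hy : (X.card : ℝ) - a ≤ y) (hcard : rchoose y (X.card - a) ≤ 𝒜.card) :
    rchoose y (X.card - b) ≤ 𝒢.card := by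
  obtain ⟨𝒟, hD1, hD2, hD3⟩ := exists_large_compl_shadow (b := X.card - b) h𝒜 (by omega) hy hcard
  have hsub : ∀ A ∈ 𝒟, A ⊆ X := fun A hA => (mem_powersetCard.mp (hD1 hA)).1
  have h : 𝒟.image (X \ ·) ⊆ 𝒢 := by
    intro B hB
    obtain ⟨D, hD, rfl⟩ := mem_image.mp hB
    obtain ⟨A, hA, h⟩ := hD3 D hD
    have hA' := mem_powersetCard.mp (h𝒜 hA)
    have hD' := mem_powersetCard.mp (hD1 hD)
    refine h𝒢 A hA _ (mem_powersetCard.mpr ⟨sdiff_subset, ?_⟩) ?_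
    · rw [card_sdiff_of_subset hD'.1, hD'.2]; omega
    · exact subset_sdiff.mpr ⟨hA'.1, disjoint_iff_inter_eq_empty.mpr h⟩
  have h2 := card_le_card h
  rw [card_image_sdiff hsub] at h2
  exact hD2.trans (by exact_mod_cast h2)

theorem IntersectingFam.card_le_choose {X : Finset ℕ} {j : ℕ} {F : Finset (Finset ℕ)}
    (hF : F ⊆ X.powersetCard j) (hint : IntersectingFam F) (hj : 1 ≤ j) (hX : 2 * j ≤ X.card) :
    F.card ≤ (X.card - 1).choose (j - 1) := by
  by_contra! hlt
  have hc : rchoose ((X.card - 1 : ℕ) : ℝ) (X.card - j) ≤ F.card := by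
    rw [rchoose_natCast]
    have : (X.card - 1).choose (X.card - j) = (X.card - 1).choose (j - 1) := by
      rw [← Nat.choose_symm (by omega)]
      congr 1
      omega
    rw [this]
    exact_mod_cast hlt.le
  have hj' : (1 : ℝ) ≤ j := by exact_mod_cast hj
  have h := CrossIntersecting.card_add_rchoose_le (𝒜 := F) (ℬ := F) hint hF hF (by omega)
    (by rw [Nat.cast_sub (by omega)]; push_cast; linarith) hc
  rw [rchoose_natCast] at h
  have h' : F.card + (X.card - 1).choose j ≤ X.card.choose j := by exact_mod_cast h
  obtain ⟨j, rfl⟩ := Nat.exists_eq_succ_of_ne_zero (Nat.one_le_iff_ne_zero.mp hj)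
  obtain ⟨N, hN⟩ := Nat.exists_eq_succ_of_ne_zero (show X.card ≠ 0 by omega)
  rw [hN, Nat.succ_eq_add_one, Nat.succ_eq_add_one, Nat.choose_succ_succ] at h'
  rw [hN] at hlt
  simp only [Nat.succ_eq_add_one, Nat.add_sub_cancel] at hlt h'
  omega

lemma card_filter_mem_eq (F : Finset (Finset ℕ)) (x : ℕ) :
    (F.filter (fun A => x ∈ A)).card = (F.memberSubfamily x).card := by
  rw [memberSubfamily, card_image_of_injOn]
  intro A hA B hB h
  simp only [coe_filter, Set.mem_ofPred_eq] at hA hB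
  exact (insert_erase hA.2).symm.trans ((congrArg (insert x) h).trans (insert_erase hB.2))

lemma memberSubfamily_subset_powersetCard {X : Finset ℕ} {k x : ℕ} {F : Finset (Finset ℕ)}
    (hF : F ⊆ X.powersetCard k) : F.memberSubfamily x ⊆ (X.erase x).powersetCard (k - 1) := by
  intro A hA
  rw [mem_memberSubfamily] at hA
  have h := mem_powersetCard.mp (hF hA.1)
  rw [card_insert_of_notMem hA.2] at h
  refine mem_powersetCard.mpr ⟨fun a ha => mem_erase.mpr ⟨?_, h.1 (mem_insert_of_mem ha)⟩, by omega⟩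
  rintro rfl
  exact hA.2 ha

lemma filter_notMem_subset_powersetCard {X : Finset ℕ} {k x : ℕ} {F : Finset (Finset ℕ)}
    (hF : F ⊆ X.powersetCard k) :
    F.filter (fun A => x ∉ A) ⊆ (X.erase x).powersetCard k := by
  intro A hA
  rw [mem_filter] at hA
  have h := mem_powersetCard.mp (hF hA.1)
  exact mem_powersetCard.mpr ⟨subset_erase.mpr ⟨h.1, hA.2⟩, h.2⟩

/-- The degree of `x` is small when many members avoid `x`. -/
theorem IntersectingFam.card_filter_mem_add_rchoose_le {X : Finset ℕ} {k x : ℕ}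
    {F : Finset (Finset ℕ)} {y : ℝ} (hF : F ⊆ X.powersetCard k) (hint : IntersectingFam F)
    (hx : x ∈ X) (hk : 1 ≤ k) (hX : 2 * k ≤ X.card) (hy : (X.card : ℝ) - 1 - k ≤ y)
    (hcard : rchoose y (X.card - 1 - k) ≤ (F.filter (fun A => x ∉ A)).card) :
    ((F.filter (fun A => x ∈ A)).card : ℝ) + rchoose y (k - 1) ≤
      (X.card - 1).choose (k - 1) := by
  rw [card_filter_mem_eq]
  have hc := card_erase_of_mem hx
  have h := CrossIntersecting.card_add_rchoose_le (X := X.erase x) (a := k) (b := k - 1)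
    (𝒜 := F.filter (fun A => x ∉ A)) (ℬ := F.memberSubfamily x) (y := y) ?_
    (filter_notMem_subset_powersetCard hF) (memberSubfamily_subset_powersetCard hF) (by omega)
    (by rw [hc, Nat.cast_sub (by omega)]; push_cast; linarith) (by rwa [hc])
  · rwa [hc] at h
  · intro A hA B hB
    rw [mem_filter] at hA
    rw [mem_memberSubfamily] at hB
    obtain ⟨z, hz⟩ := hint A hA.1 _ hB.1
    rw [mem_inter, mem_insert] at hz
    obtain ⟨hz1, hz2 | hz2⟩ := hz
    · subst hz2; exact absurd hz1 hA.2
    · exact ⟨z, mem_inter.mpr ⟨hz1, hz2⟩⟩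

lemma sum_tDeg (F : Finset (Finset ℕ)) (X : Finset ℕ) (t : ℕ) :
    ∑ S ∈ X.powersetCard t, tDeg F S = ∑ A ∈ F, (A ∩ X).card.choose t := by
  simp_rw [tDeg, card_filter]
  rw [sum_comm]
  refine sum_congr rfl fun A _ => ?_
  rw [← card_filter, ← card_powersetCard]
  congr 1
  ext S
  simp only [mem_filter, mem_powersetCard, subset_inter_iff]
  tauto

lemma card_filter_mem_add_card_filter_notMem (F : Finset (Finset ℕ)) (x : ℕ) :
    (F.filter (fun A => x ∈ A)).card + (F.filter (fun A => x ∉ A)).card = F.card :=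
  card_filter_add_card_filter_not _

lemma choose_mul_le_of_lt_tDeg {X : Finset ℕ} {k t T : ℕ} {F : Finset (Finset ℕ)}
    (hF : F ⊆ X.powersetCard k) (h : ∀ S ∈ X.powersetCard t, T < tDeg F S) :
    X.card.choose t * (T + 1) ≤ F.card * k.choose t := by
  have h1 : ∑ S ∈ X.powersetCard t, (T + 1) ≤ ∑ S ∈ X.powersetCard t, tDeg F S :=
    sum_le_sum fun S hS => h S hS
  rw [sum_const, card_powersetCard, smul_eq_mul, sum_tDeg] at h1
  refine h1.trans (le_of_eq ?_)
  rw [← smul_eq_mul, ← sum_const]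
  refine sum_congr rfl fun A hA => ?_
  have := mem_powersetCard.mp (hF hA)
  rw [inter_eq_left.mpr this.1, this.2]

lemma choose_mul_le_of_lt_tDeg_erase {X : Finset ℕ} {k t T x : ℕ} {F : Finset (Finset ℕ)}
    (hF : F ⊆ X.powersetCard k) (hx : x ∈ X) (h : ∀ S ∈ X.powersetCard t, T < tDeg F S) :
    (X.card - 1).choose t * (T + 1) ≤ (F.filter (fun A => x ∈ A)).card * (k - 1).choose t +
      (F.filter (fun A => x ∉ A)).card * k.choose t := by
  have h1 : ∑ S ∈ (X.erase x).powersetCard t, (T + 1) ≤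
      ∑ S ∈ (X.erase x).powersetCard t, tDeg F S :=
    sum_le_sum fun S hS => h S (powersetCard_mono (erase_subset _ _) hS)
  rw [sum_const, card_powersetCard, smul_eq_mul, sum_tDeg, card_erase_of_mem hx] at h1
  refine h1.trans (le_of_eq ?_)
  rw [← sum_filter_add_sum_filter_not F (fun A => x ∈ A)]
  congr 1
  · rw [← smul_eq_mul, ← sum_const]
    refine sum_congr rfl fun A hA => ?_
    rw [mem_filter] at hA
    have := mem_powersetCard.mp (hF hA.1)
    rw [inter_erase, inter_eq_left.mpr this.1, card_erase_of_mem hA.2, this.2]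
  · rw [← smul_eq_mul, ← sum_const]
    refine sum_congr rfl fun A hA => ?_
    rw [mem_filter] at hA
    have := mem_powersetCard.mp (hF hA.1)
    rw [inter_erase, inter_eq_left.mpr this.1, erase_eq_of_notMem hA.2, this.2]

/-- The inner product of two set functions on the `r`-th layer of the cube over `X`. -/
def layerInner (X : Finset ℕ) (r : ℕ) (f g : Finset ℕ → ℝ) : ℝ :=
  ∑ A ∈ X.powersetCard r, f A * g A

/-- The up operator of the Boolean lattice. -/
def upOp (f : Finset ℕ → ℝ) (B : Finset ℕ) : ℝ := ∑ a ∈ B, f (B.erase a)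

/-- The down operator of the Boolean lattice over `X`. -/
def downOp (X : Finset ℕ) (f : Finset ℕ → ℝ) (A : Finset ℕ) : ℝ :=
  ∑ x ∈ X \ A, f (insert x A)

/-- The indicator function of the sets containing `i`. -/
def memInd (i : ℕ) (A : Finset ℕ) : ℝ := if i ∈ A then 1 else 0

lemma layerInner_comm (X : Finset ℕ) (r : ℕ) (f g : Finset ℕ → ℝ) :
    layerInner X r f g = layerInner X r g f :=
  sum_congr rfl fun _ _ => mul_comm _ _

lemma layerInner_congr {X : Finset ℕ} {r : ℕ} {f f' g g' : Finset ℕ → ℝ}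
    (hf : ∀ A ∈ X.powersetCard r, f A = f' A) (hg : ∀ A ∈ X.powersetCard r, g A = g' A) :
    layerInner X r f g = layerInner X r f' g' :=
  sum_congr rfl fun A hA => by rw [hf A hA, hg A hA]

lemma layerInner_self_nonneg (X : Finset ℕ) (r : ℕ) (f : Finset ℕ → ℝ) :
    0 ≤ layerInner X r f f := sum_nonneg fun _ _ => mul_self_nonneg _

lemma layerInner_sq_le (X : Finset ℕ) (r : ℕ) (f g : Finset ℕ → ℝ) :
    layerInner X r f g ^ 2 ≤ layerInner X r f f * layerInner X r g g := by
  have := sum_mul_sq_le_sq_mul_sq (X.powersetCard r) f g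
  simpa only [layerInner, ← sq] using this

lemma layerInner_upOp (X : Finset ℕ) (r : ℕ) (f g : Finset ℕ → ℝ) :
    layerInner X (r + 1) (upOp f) g = layerInner X r f (downOp X g) := by
  simp only [layerInner, upOp, downOp, sum_mul, mul_sum]
  rw [sum_sigma', sum_sigma']
  refine sum_bij' (fun p _ => ⟨p.1.erase p.2, p.2⟩) (fun p _ => ⟨insert p.2 p.1, p.2⟩) ?_ ?_ ?_ ?_ ?_
  · rintro ⟨B, a⟩ h
    simp only [mem_sigma, mem_powersetCard] at h
    simp only [mem_sigma, mem_powersetCard, mem_sdiff]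
    exact ⟨⟨(erase_subset _ _).trans h.1.1, by rw [card_erase_of_mem h.2]; omega⟩,
      h.1.1 h.2, notMem_erase _ _⟩
  · rintro ⟨A, x⟩ h
    simp only [mem_sigma, mem_powersetCard, mem_sdiff] at h
    simp only [mem_sigma, mem_powersetCard]
    exact ⟨⟨insert_subset h.2.1 h.1.1, by rw [card_insert_of_notMem h.2.2, h.1.2]⟩,
      mem_insert_self _ _⟩
  · rintro ⟨B, a⟩ h
    simp only [mem_sigma, mem_powersetCard] at h
    simp [insert_erase h.2]
  · rintro ⟨A, x⟩ h
    simp only [mem_sigma, mem_powersetCard, mem_sdiff] at h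
    simp [erase_insert h.2.2]
  · rintro ⟨B, a⟩ h
    simp only [mem_sigma, mem_powersetCard] at h
    simp [insert_erase h.2]

lemma downOp_upOp {X A : Finset ℕ} (hA : A ⊆ X) (f : Finset ℕ → ℝ) :
    downOp X (upOp f) A = upOp (downOp X f) A + ((X.card : ℝ) - 2 * A.card) * f A := by
  have h1 : downOp X (upOp f) A =
      ∑ x ∈ X \ A, (f A + ∑ a ∈ A, f (insert x (A.erase a))) := by
    refine sum_congr rfl fun x hx => ?_
    rw [mem_sdiff] at hx
    rw [upOp, sum_insert hx.2, erase_insert hx.2]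
    congr 1
    refine sum_congr rfl fun a ha => ?_
    rw [erase_insert_of_ne]
    rintro rfl
    exact hx.2 ha
  have h2 : upOp (downOp X f) A =
      ∑ a ∈ A, (f A + ∑ x ∈ X \ A, f (insert x (A.erase a))) := by
    refine sum_congr rfl fun a ha => ?_
    rw [downOp, sdiff_erase (hA ha), sum_insert (by simp [ha]), insert_erase ha]
  have h3 : (((X \ A).card : ℕ) : ℝ) = X.card - A.card := by
    rw [card_sdiff_of_subset hA, Nat.cast_sub (card_le_card hA)]
  rw [h1, h2, sum_add_distrib, sum_add_distrib, sum_const, sum_const, sum_comm, nsmul_eq_mul,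
    nsmul_eq_mul, h3]
  ring

lemma upOp_memInd {B : Finset ℕ} {r : ℕ} (hB : B.card = r + 1) (i : ℕ) :
    upOp (memInd i) B = r * memInd i B := by
  simp only [upOp, memInd, mem_erase]
  by_cases hi : i ∈ B
  · simp only [hi, and_true, if_true, sum_ite, sum_const_zero, add_zero, sum_const, nsmul_eq_mul]
    have : B.filter (fun a => i ≠ a) = B.erase i := by
      ext a; simp only [mem_filter, mem_erase]; tauto
    rw [this, card_erase_of_mem hi, hB]
    simp
  · simp [hi]

lemma downOp_memInd {X A : Finset ℕ} (hA : A ⊆ X) {i : ℕ} (hi : i ∈ X) :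
    downOp X (memInd i) A = 1 + ((X.card : ℝ) - A.card - 1) * memInd i A := by
  have h3 : (((X \ A).card : ℕ) : ℝ) = X.card - A.card := by
    rw [card_sdiff_of_subset hA, Nat.cast_sub (card_le_card hA)]
  simp only [downOp, memInd, mem_insert]
  by_cases hiA : i ∈ A
  · simp only [hiA, or_true, if_true, sum_const, nsmul_eq_mul, h3]
    ring
  · simp [hiA, hi]

/-- A set function orthogonal to constants and linear functions is contracted by the up
operator as on the second isotypic component. -/
lemma layerInner_upOp_self_le {X : Finset ℕ} (r : ℕ) :
    ∀ h : Finset ℕ → ℝ, r + 2 ≤ X.card →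
      (∀ i ∈ X, layerInner X (r + 1) h (memInd i) = 0) →
      layerInner X (r + 2) (upOp h) (upOp h) ≤
        r * ((X.card : ℝ) - r - 3) * layerInner X (r + 1) h h := by
  induction r with
  | zero =>
    intro h hr hz
    have h0 : ∀ A ∈ X.powersetCard 1, h A = 0 := by
      intro A hA
      obtain ⟨hAX, hA1⟩ := mem_powersetCard.mp hA
      obtain ⟨i, rfl⟩ := card_eq_one.mp hA1
      have hi : i ∈ X := hAX (mem_singleton_self i)
      have := hz i hi
      rw [layerInner, sum_eq_single {i}] at this
      · simpa [memInd] using this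
      · intro B hB hBi
        obtain ⟨hBX, hB1⟩ := mem_powersetCard.mp hB
        obtain ⟨b, rfl⟩ := card_eq_one.mp hB1
        have : i ≠ b := by rintro rfl; exact hBi rfl
        simp [memInd, this]
      · intro hn; exact absurd hA hn
    rw [layerInner_upOp X 1, layerInner_congr (f' := fun _ => 0) h0 (fun _ _ => rfl)]
    simp [layerInner]
  | succ r ih =>
    intro h hr hz
    have hDz : ∀ i ∈ X, layerInner X (r + 1) (downOp X h) (memInd i) = 0 := by
      intro i hi
      rw [layerInner_comm, ← layerInner_upOp, layerInner_congr
        (f' := fun B => ((r + 1 : ℕ) : ℝ) * memInd i B)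
        (fun B hB => upOp_memInd (mem_powersetCard.mp hB).2 i) (fun _ _ => rfl)]
      have := hz i hi
      rw [layerInner_comm, layerInner] at this
      rw [layerInner]
      simp only [mul_assoc]
      rw [← mul_sum, this, mul_zero]
    have hI := ih (downOp X h) (by omega) hDz
    have hadj : layerInner X (r + 2) h (upOp (downOp X h)) =
        layerInner X (r + 1) (downOp X h) (downOp X h) := by
      rw [layerInner_comm, layerInner_upOp]
    have hcs := layerInner_sq_le X (r + 2) h (upOp (downOp X h))
    have hexp : layerInner X (r + 3) (upOp h) (upOp h) =
        layerInner X (r + 1) (downOp X h) (downOp X h) +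
          ((X.card : ℝ) - 2 * (r + 2)) * layerInner X (r + 2) h h := by
      rw [layerInner_upOp, ← hadj, layerInner, layerInner, layerInner, mul_sum, ← sum_add_distrib]
      refine sum_congr rfl fun A hA => ?_
      obtain ⟨hAX, hA1⟩ := mem_powersetCard.mp hA
      rw [downOp_upOp hAX, hA1]
      push_cast
      ring
    rw [hadj] at hcs
    set d := layerInner X (r + 1) (downOp X h) (downOp X h)
    set N := layerInner X (r + 2) h h
    have hd : 0 ≤ d := layerInner_self_nonneg _ _ _
    have hN : 0 ≤ N := layerInner_self_nonneg _ _ _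
    have hc : ((r : ℝ) + 3) ≤ X.card := by exact_mod_cast hr
    have hmu : 0 ≤ (r : ℝ) * ((X.card : ℝ) - r - 3) := by
      have : (0 : ℝ) ≤ (X.card : ℝ) - r - 3 := by linarith
      positivity
    have hfin : d ≤ r * ((X.card : ℝ) - r - 3) * N := by
      rcases hd.eq_or_lt with h0 | h0
      · rw [← h0]; positivity
      · have : d * d ≤ (r * ((X.card : ℝ) - r - 3) * N) * d := by nlinarith
        exact le_of_mul_le_mul_right this h0
    show layerInner X (r + 3) (upOp h) (upOp h) ≤ _
    rw [hexp]
    push_cast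
    show _ ≤ ((r : ℝ) + 1) * ((X.card : ℝ) - (r + 1) - 3) * N
    nlinarith

lemma sum_powersetCard_memInd {X : Finset ℕ} {i : ℕ} (hi : i ∈ X) (r : ℕ) :
    ∑ A ∈ X.powersetCard (r + 1), memInd i A = (X.card - 1).choose r := by
  simp only [memInd]
  rw [sum_boole, card_filter_mem_eq]
  congr 1
  rw [← card_erase_of_mem hi, ← card_powersetCard]
  congr 1
  refine (memberSubfamily_subset_powersetCard (k := r + 1) subset_rfl).antisymm fun A hA => ?_
  have hA' := mem_powersetCard.mp hA
  have hiA : i ∉ A := fun h => notMem_erase i X (hA'.1 h)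
  rw [mem_memberSubfamily, mem_powersetCard, card_insert_of_notMem hiA, hA'.2]
  exact ⟨⟨insert_subset hi (hA'.1.trans (erase_subset _ _)), rfl⟩, hiA⟩

lemma layerInner_memInd_memInd {X : Finset ℕ} {i j : ℕ} (hi : i ∈ X) (hj : j ∈ X) (hij : i ≠ j)
    (r : ℕ) : layerInner X (r + 1) (memInd i) (memInd j) =
      (X.card - 1).choose r - (X.card - 2).choose r := by
  have h : layerInner X (r + 1) (memInd i) (memInd j) +
      ∑ A ∈ (X.erase j).powersetCard (r + 1), memInd i A =
      ∑ A ∈ X.powersetCard (r + 1), memInd i A := by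
    rw [← sum_filter_add_sum_filter_not (X.powersetCard (r + 1)) (fun A => j ∈ A)]
    congr 1
    · rw [layerInner, sum_filter]
      refine sum_congr rfl fun A _ => ?_
      simp [memInd]
    · refine sum_congr ?_ fun _ _ => rfl
      ext A
      simp only [mem_powersetCard, mem_filter, subset_erase]
      tauto
  rw [sum_powersetCard_memInd hi, sum_powersetCard_memInd (mem_erase.mpr ⟨hij, hi⟩),
    card_erase_of_mem hj] at h
  have : X.card - 1 - 1 = X.card - 2 := by omega
  rw [this] at h
  linarith

/-- The linear set function with coefficients `β`. -/
def linFun (β : ℕ → ℝ) (A : Finset ℕ) : ℝ := ∑ i ∈ A, β i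

lemma linFun_eq {X A : Finset ℕ} (hA : A ⊆ X) (β : ℕ → ℝ) :
    linFun β A = ∑ i ∈ X, β i * memInd i A := by
  simp only [memInd, mul_ite, mul_one, mul_zero]
  rw [sum_ite_mem, inter_eq_right.mpr hA, linFun]

lemma layerInner_linFun (X : Finset ℕ) (r : ℕ) (β : ℕ → ℝ) (f : Finset ℕ → ℝ) :
    layerInner X r (linFun β) f = ∑ i ∈ X, β i * layerInner X r f (memInd i) := by
  simp only [layerInner, mul_sum]
  rw [sum_comm]
  refine sum_congr rfl fun A hA => ?_
  rw [linFun_eq (mem_powersetCard.mp hA).1, sum_mul]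
  exact sum_congr rfl fun i _ => by ring

lemma upOp_linFun {B : Finset ℕ} {r : ℕ} (hB : B.card = r + 1) (β : ℕ → ℝ) :
    upOp (linFun β) B = r * linFun β B := by
  have : ∀ a ∈ B, linFun β (B.erase a) = linFun β B - β a := by
    intro a ha
    rw [linFun, linFun, ← sum_erase_add _ _ ha]; ring
  rw [upOp, sum_congr rfl this, sum_sub_distrib, sum_const, hB, nsmul_eq_mul]
  push_cast
  rw [← linFun]
  ring

lemma layerInner_memInd_self {X : Finset ℕ} {i : ℕ} (hi : i ∈ X) (r : ℕ) :
    layerInner X (r + 1) (memInd i) (memInd i) = (X.card - 1).choose r := by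
  rw [← sum_powersetCard_memInd hi]
  refine sum_congr rfl fun A _ => ?_
  simp [memInd]

lemma layerInner_linFun_memInd {X : Finset ℕ} {β : ℕ → ℝ} (hβ : ∑ i ∈ X, β i = 0) {i : ℕ}
    (hi : i ∈ X) (r : ℕ) :
    layerInner X (r + 1) (linFun β) (memInd i) = β i * (X.card - 2).choose r := by
  rw [layerInner_linFun, ← sum_erase_add _ _ hi, layerInner_memInd_self hi]
  have : ∑ x ∈ X.erase i, β x * layerInner X (r + 1) (memInd i) (memInd x) =
      ∑ x ∈ X.erase i, β x * (((X.card - 1).choose r : ℝ) - (X.card - 2).choose r) := by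
    refine sum_congr rfl fun x hx => ?_
    rw [mem_erase] at hx
    rw [layerInner_memInd_memInd hi hx.2 hx.1.symm]
  rw [this, ← sum_mul]
  have := sum_erase_add X β hi
  have h2 : ∑ x ∈ X.erase i, β x = - β i := by linarith
  rw [h2]
  ring

lemma layerInner_linFun_self {X : Finset ℕ} {β : ℕ → ℝ} (hβ : ∑ i ∈ X, β i = 0) (r : ℕ) :
    layerInner X (r + 1) (linFun β) (linFun β) = (X.card - 2).choose r * ∑ i ∈ X, β i ^ 2 := by
  rw [layerInner_linFun, mul_sum]
  refine sum_congr rfl fun i hi => ?_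
  rw [layerInner_linFun_memInd hβ hi]
  ring

lemma layerInner_linFun_one {X : Finset ℕ} {β : ℕ → ℝ} (hβ : ∑ i ∈ X, β i = 0) (r : ℕ) :
    layerInner X (r + 1) (linFun β) (fun _ => 1) = 0 := by
  rw [layerInner_linFun]
  have : ∀ i ∈ X, β i * layerInner X (r + 1) (fun _ => 1) (memInd i) =
      β i * (X.card - 1).choose r := by
    intro i hi
    rw [← sum_powersetCard_memInd hi]
    simp [layerInner]
  rw [sum_congr rfl this, ← sum_mul, hβ, zero_mul]

/-- The members of the upper shadow of `F` on the `r`-th layer over `X`. -/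
def upFam (X : Finset ℕ) (F : Finset (Finset ℕ)) (r : ℕ) : Finset (Finset ℕ) :=
  (X.powersetCard r).filter (fun B => ∃ A ∈ F, A ⊆ B)

lemma mem_upFam {X : Finset ℕ} {F : Finset (Finset ℕ)} {r : ℕ} {B : Finset ℕ} :
    B ∈ upFam X F r ↔ (B ⊆ X ∧ B.card = r) ∧ ∃ A ∈ F, A ⊆ B := by
  rw [upFam, mem_filter, mem_powersetCard]

lemma upFam_subset (X : Finset ℕ) (F : Finset (Finset ℕ)) (r : ℕ) :
    upFam X F r ⊆ X.powersetCard r := filter_subset _ _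

lemma sum_card_filter_mem {X : Finset ℕ} {F : Finset (Finset ℕ)} {j : ℕ}
    (hF : F ⊆ X.powersetCard j) :
    ∑ i ∈ X, (F.filter (fun A => i ∈ A)).card = j * F.card := by
  simp_rw [card_filter_mem_eq]
  exact sum_card_memberSubfamily (fun A hA => (mem_powersetCard.mp (hF hA)).2)
    fun A hA => (mem_powersetCard.mp (hF hA)).1

lemma layerInner_upOp_one {X : Finset ℕ} {r : ℕ} (h : Finset ℕ → ℝ)
    (h1 : layerInner X r h (fun _ => 1) = 0) :
    layerInner X (r + 1) (upOp h) (fun _ => 1) = 0 := by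
  rw [layerInner_upOp, layerInner_congr (g' := fun _ => ((X.card : ℝ) - r) * 1) (fun _ _ => rfl)]
  · simp only [layerInner, mul_one] at h1 ⊢
    rw [← sum_mul, h1, zero_mul]
  · intro A hA
    obtain ⟨hAX, hA1⟩ := mem_powersetCard.mp hA
    rw [downOp, sum_const, card_sdiff_of_subset hAX, nsmul_eq_mul, hA1,
      Nat.cast_sub (hA1 ▸ card_le_card hAX)]

lemma layerInner_upOp_memInd {X : Finset ℕ} {r : ℕ} (h : Finset ℕ → ℝ)
    (h1 : layerInner X r h (fun _ => 1) = 0) {i : ℕ} (hi : i ∈ X)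
    (h2 : layerInner X r h (memInd i) = 0) :
    layerInner X (r + 1) (upOp h) (memInd i) = 0 := by
  rw [layerInner_upOp, layerInner_congr
    (g' := fun A => 1 + ((X.card : ℝ) - r - 1) * memInd i A) (fun _ _ => rfl)]
  · simp only [layerInner, mul_one] at h1 h2 ⊢
    simp only [mul_add, mul_one, sum_add_distrib, h1, zero_add, mul_left_comm (h _)]
    rw [← mul_sum, h2, mul_zero]
  · intro A hA
    obtain ⟨hAX, hA1⟩ := mem_powersetCard.mp hA
    rw [downOp_memInd hAX hi, hA1]

/-- Spectral lower bound for the size of the upper shadow in terms of the degrees. -/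
theorem sq_card_le_card_upFam_mul {X : Finset ℕ} {r : ℕ} {F : Finset (Finset ℕ)}
    (hF : F ⊆ X.powersetCard (r + 1)) (hr : r + 3 ≤ X.card) :
    (((X.card : ℝ) - r - 1) * F.card) ^ 2 ≤ (upFam X F (r + 2)).card *
      (r * ((X.card : ℝ) - r - 3) * F.card
        + 2 * (X.card - 1) * (F.card : ℝ) ^ 2 / X.card.choose (r + 1)
        + (X.card - 2) * (∑ i ∈ X, (((F.filter (fun A => i ∈ A)).card : ℝ)
            - (r + 1) * F.card / X.card) ^ 2) / (X.card - 2).choose r) := by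
  set n : ℕ := X.card with hn
  set S : ℝ := (F.card : ℝ) with hS
  set d : ℕ → ℝ := fun i => ((F.filter (fun A => i ∈ A)).card : ℝ) with hd
  set f : Finset ℕ → ℝ := fun A => if A ∈ F then 1 else 0 with hf
  set α : ℝ := S / n.choose (r + 1) with hα
  set β : ℕ → ℝ := fun i => (d i - (r + 1) * S / n) / (n - 2).choose r with hβ
  set h : Finset ℕ → ℝ := fun A => f A - (α + linFun β A) with hh
  have hnpos : (0 : ℝ) < n := by exact_mod_cast (show 0 < n by omega)
  have hC0 : (0 : ℝ) < n.choose (r + 1) := by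
    exact_mod_cast Nat.choose_pos (show r + 1 ≤ n by omega)
  have hC2 : (0 : ℝ) < (n - 2).choose r := by
    exact_mod_cast Nat.choose_pos (show r ≤ n - 2 by omega)
  have hd_sum : ∑ i ∈ X, d i = (r + 1) * S := by
    rw [hd, ← Nat.cast_sum, sum_card_filter_mem hF]
    push_cast
    rfl
  have hβ0 : ∑ i ∈ X, β i = 0 := by
    rw [hβ, ← sum_div, sum_sub_distrib, hd_sum, sum_const, nsmul_eq_mul, ← hn]
    field_simp
    simp
  have hfF : ∀ g : Finset ℕ → ℝ, layerInner X (r + 1) f g = ∑ A ∈ F, g A := by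
    intro g
    simp only [layerInner, hf, ite_mul, one_mul, zero_mul]
    rw [sum_ite_mem, inter_eq_right.mpr hF]
  have hf1 : layerInner X (r + 1) f (fun _ => 1) = S := by
    rw [hfF]; simp [hS]
  have hfe : ∀ i, layerInner X (r + 1) f (memInd i) = d i := by
    intro i
    rw [hfF]; simp [memInd, hd]
  have habs : (n.choose (r + 1) : ℝ) * (r + 1) = n * (n - 1).choose r := by
    have := Nat.add_one_mul_choose_eq (n - 1) r
    rw [show n - 1 + 1 = n by omega] at this
    exact_mod_cast this.symm
  have hsub : ∀ g, layerInner X (r + 1) h g =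
      layerInner X (r + 1) f g - α * layerInner X (r + 1) g (fun _ => 1) -
        layerInner X (r + 1) (linFun β) g := by
    intro g
    simp only [layerInner, hh, mul_sum]
    rw [← sum_sub_distrib, ← sum_sub_distrib]
    exact sum_congr rfl fun A _ => by ring
  have hone : ∀ r, layerInner X r (fun _ => 1) (fun _ => 1) = n.choose r := by
    intro r
    simp [layerInner, hn]
  have h1 : layerInner X (r + 1) h (fun _ => 1) = 0 := by
    rw [hsub, hf1, hone, layerInner_linFun_one hβ0, hα]
    field_simp
    ring
  have he : ∀ i ∈ X, layerInner X (r + 1) h (memInd i) = 0 := by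
    intro i hi
    rw [hsub, hfe, layerInner_linFun_memInd hβ0 hi]
    have : layerInner X (r + 1) (memInd i) (fun _ => 1) = (n - 1).choose r := by
      rw [hn, ← sum_powersetCard_memInd hi]; simp [layerInner]
    rw [this, hα, hβ]
    have h3 : S / n.choose (r + 1) * (n - 1).choose r = (r + 1) * S / n := by
      rw [div_mul_eq_mul_div, div_eq_div_iff hC0.ne' hnpos.ne']
      linear_combination (-S) * habs
    rw [h3, ← hn]
    field_simp
    ring
  set W : ℝ := (∑ i ∈ X, (d i - (r + 1) * S / n) ^ 2) / (n - 2).choose r with hW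
  have hβsq : (n - 2).choose r * ∑ i ∈ X, β i ^ 2 = W := by
    rw [hW, hβ]
    simp only [div_pow]
    rw [← sum_div]
    have (s c : ℝ) (hc : c ≠ 0) : c * (s / c ^ 2) = s / c := by field_simp
    exact this _ _ hC2.ne'
  have hβd : ∑ i ∈ X, β i * d i = W := by
    have : ∑ i ∈ X, β i * d i = ∑ i ∈ X, β i * (d i - (r + 1) * S / n) := by
      simp only [mul_sub]
      rw [sum_sub_distrib, ← sum_mul, hβ0, zero_mul, sub_zero]
    rw [this, hW, sum_div]
    exact sum_congr rfl fun i _ => by rw [hβ]; ring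
  have hlin : layerInner X (r + 1) (linFun β) h = 0 := by
    rw [layerInner_linFun]
    exact sum_eq_zero fun i hi => by rw [he i hi, mul_zero]
  have hhh : layerInner X (r + 1) h h = S - α * S - W := by
    rw [hsub h, h1, hlin, layerInner_comm, hsub f, hfF, hf1, layerInner_linFun]
    simp only [hfe, hβd]
    have : ∑ A ∈ F, f A = S := by
      rw [hS, hf, sum_boole, filter_true_of_mem (fun _ h => h)]
    rw [this]; ring
  have hspec := layerInner_upOp_self_le r h (by omega) he
  rw [hhh] at hspec
  have hu1 := layerInner_upOp_one h h1
  have hue : layerInner X (r + 2) (linFun β) (upOp h) = 0 := by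
    rw [layerInner_linFun]
    exact sum_eq_zero fun i hi => by rw [layerInner_upOp_memInd h h1 hi (he i hi), mul_zero]
  have hUf : ∀ B ∈ X.powersetCard (r + 2),
      upOp f B = (r + 2) * α + (r + 1) * linFun β B + upOp h B := by
    intro B hB
    have hBc := (mem_powersetCard.mp hB).2
    have h4 := upOp_linFun (r := r + 1) hBc β
    push_cast at h4
    rw [← h4]
    simp only [upOp, hh]
    rw [sum_sub_distrib, sum_add_distrib, sum_const, hBc, nsmul_eq_mul]
    push_cast
    ring
  have hnorm : layerInner X (r + 2) (upOp f) (upOp f) =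
      ((r + 2) * α) ^ 2 * n.choose (r + 2) + (r + 1) ^ 2 * ((n - 2).choose (r + 1) *
        ∑ i ∈ X, β i ^ 2) + layerInner X (r + 2) (upOp h) (upOp h) := by
    rw [layerInner_congr hUf hUf, hn, ← layerInner_linFun_self hβ0, ← hn, ← hone]
    have hl1 := layerInner_linFun_one hβ0 (r + 1)
    have e1 : ((r : ℝ) + 2) * α * (2 * (r + 1)) * layerInner X (r + 2) (linFun β) (fun _ => 1) = 0 := by
      rw [hl1, mul_zero]
    have e2 : ((r : ℝ) + 2) * α * 2 * layerInner X (r + 2) (upOp h) (fun _ => 1) = 0 := by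
      rw [hu1, mul_zero]
    have e3 : (2 * ((r : ℝ) + 1)) * layerInner X (r + 2) (linFun β) (upOp h) = 0 := by
      rw [hue, mul_zero]
    have e4 : layerInner X (r + 2) (fun B => (r + 2) * α + (r + 1) * linFun β B + upOp h B)
        (fun B => (r + 2) * α + (r + 1) * linFun β B + upOp h B) =
        ((r + 2) * α) ^ 2 * layerInner X (r + 2) (fun _ => 1) (fun _ => 1) +
        (r + 1) ^ 2 * layerInner X (r + 2) (linFun β) (linFun β) +
        layerInner X (r + 2) (upOp h) (upOp h) +
        ((r + 2) * α * (2 * (r + 1)) * layerInner X (r + 2) (linFun β) (fun _ => 1) +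
        (r + 2) * α * 2 * layerInner X (r + 2) (upOp h) (fun _ => 1) +
        2 * (r + 1) * layerInner X (r + 2) (linFun β) (upOp h)) := by
      simp only [layerInner, mul_sum, ← sum_add_distrib]
      exact sum_congr rfl fun A _ => by ring
    rw [e4, e1, e2, e3]
    ring
  have hch1 : (n.choose (r + 2) : ℝ) * (r + 2) = n.choose (r + 1) * (n - r - 1) := by
    have := Nat.choose_succ_right_eq n (r + 1)
    have h2 : (((n - (r + 1) : ℕ)) : ℝ) = n - r - 1 := by
      rw [Nat.cast_sub (by omega)]; push_cast; ring
    rw [← h2]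
    exact_mod_cast this
  have hch2 : ((n - 2).choose (r + 1) : ℝ) * (r + 1) = (n - 2).choose r * (n - r - 2) := by
    have := Nat.choose_succ_right_eq (n - 2) r
    have h2 : (((n - 2 - r : ℕ)) : ℝ) = n - r - 2 := by
      rw [Nat.cast_sub (by omega), Nat.cast_sub (by omega)]; push_cast; ring
    rw [← h2]
    exact_mod_cast this
  have hαS : α * n.choose (r + 1) = S := by
    rw [hα]; field_simp
  have hbound : layerInner X (r + 2) (upOp f) (upOp f) ≤
      r * ((n : ℝ) - r - 3) * S + 2 * (n - 1) * (α * S) + (n - 2) * W := by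
    rw [hnorm]
    have t1 : ((r + 2) * α) ^ 2 * n.choose (r + 2) = (r + 2) * (n - r - 1) * (α * S) := by
      rw [← hαS]
      linear_combination (((r : ℝ) + 2) * α ^ 2) * hch1
    have t2 : ((r : ℝ) + 1) ^ 2 * ((n - 2).choose (r + 1) * ∑ i ∈ X, β i ^ 2) =
        (r + 1) * (n - r - 2) * W := by
      rw [← hβsq]
      linear_combination (((r : ℝ) + 1) * ∑ i ∈ X, β i ^ 2) * hch2
    rw [t1, t2]
    linarith
  have hUsum : ∑ B ∈ upFam X F (r + 2), upOp f B = (n - r - 1) * S := by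
    have hz : ∑ B ∈ X.powersetCard (r + 2), upOp f B = ∑ B ∈ upFam X F (r + 2), upOp f B := by
      symm
      refine sum_subset (upFam_subset X F (r + 2)) fun B hB hBn => ?_
      refine sum_eq_zero fun a _ => if_neg fun hmem => hBn ?_
      exact mem_filter.mpr ⟨hB, _, hmem, erase_subset _ _⟩
    rw [← hz]
    have : ∑ B ∈ X.powersetCard (r + 2), upOp f B =
        layerInner X (r + 2) (upOp f) (fun _ => 1) := by simp [layerInner]
    rw [this, layerInner_upOp, hfF]
    have : ∀ A ∈ F, downOp X (fun _ => 1) A = (n : ℝ) - r - 1 := by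
      intro A hA
      obtain ⟨hAX, hA1⟩ := mem_powersetCard.mp (hF hA)
      rw [downOp, sum_const, card_sdiff_of_subset hAX, nsmul_eq_mul, hA1,
        Nat.cast_sub (by omega)]
      push_cast
      ring
    rw [sum_congr rfl this, sum_const, nsmul_eq_mul]
    ring
  have hcs : (∑ B ∈ upFam X F (r + 2), upOp f B) ^ 2 ≤
      (upFam X F (r + 2)).card * ∑ B ∈ upFam X F (r + 2), upOp f B ^ 2 :=
    sq_sum_le_card_mul_sum_sq
  have hle : ∑ B ∈ upFam X F (r + 2), upOp f B ^ 2 ≤ layerInner X (r + 2) (upOp f) (upOp f) := by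
    simp only [layerInner, ← sq]
    exact sum_le_sum_of_subset_of_nonneg (upFam_subset X F (r + 2)) fun _ _ _ => sq_nonneg _
  rw [hUsum] at hcs
  refine hcs.trans ?_
  refine mul_le_mul_of_nonneg_left (hle.trans (hbound.trans (le_of_eq ?_))) (Nat.cast_nonneg _)
  rw [hα, hW]
  ring

lemma IntersectingFam.upFam {F : Finset (Finset ℕ)} (hint : IntersectingFam F) (X : Finset ℕ)
    (r : ℕ) : IntersectingFam (upFam X F r) := by
  intro A hA B hB
  obtain ⟨-, A', hA', hAA⟩ := mem_upFam.mp hA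
  obtain ⟨-, B', hB', hBB⟩ := mem_upFam.mp hB
  exact (hint A' hA' B' hB').mono (inter_subset_inter hAA hBB)

lemma upFam_self {X : Finset ℕ} {F : Finset (Finset ℕ)} {k : ℕ} (hF : F ⊆ X.powersetCard k) :
    upFam X F k = F := by
  ext B
  rw [mem_upFam]
  constructor
  · rintro ⟨⟨-, hB⟩, A, hA, hAB⟩
    rwa [← eq_of_subset_of_card_le hAB (by rw [hB, (mem_powersetCard.mp (hF hA)).2])]
  · exact fun hB => ⟨mem_powersetCard.mp (hF hB), B, hB, subset_rfl⟩

lemma upFam_upFam {X : Finset ℕ} {F : Finset (Finset ℕ)} {k j : ℕ} (hF : F ⊆ X.powersetCard k)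
    (hkj : k ≤ j) : upFam X (upFam X F j) (j + 1) = upFam X F (j + 1) := by
  ext B
  simp only [mem_upFam]
  refine and_congr_right fun hB => ⟨?_, ?_⟩
  · rintro ⟨C, ⟨-, A, hA, hAC⟩, hCB⟩
    exact ⟨A, hA, hAC.trans hCB⟩
  · rintro ⟨A, hA, hAB⟩
    have hAk := (mem_powersetCard.mp (hF hA)).2
    obtain ⟨C, hAC, hCB, hC⟩ := exists_subsuperset_card_eq (n := j) hAB (by omega) (by omega)
    exact ⟨C, ⟨⟨hCB.trans hB.1, hC⟩, A, hA, hAC⟩, hCB⟩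

lemma card_filter_notMem_le_card_upFam {X : Finset ℕ} {F : Finset (Finset ℕ)} {j i : ℕ}
    (hF : F ⊆ X.powersetCard j) (hi : i ∈ X) :
    (F.filter (fun A => i ∉ A)).card ≤ ((upFam X F (j + 1)).filter (fun A => i ∈ A)).card := by
  refine card_le_card_of_injOn (insert i) ?_ ?_
  · intro A hA
    simp only [coe_filter, Set.mem_ofPred_eq] at hA
    have h := mem_powersetCard.mp (hF hA.1)
    simp only [coe_filter, Set.mem_ofPred_eq, mem_upFam]
    exact ⟨⟨⟨insert_subset hi h.1, by rw [card_insert_of_notMem hA.2, h.2]⟩, A, hA.1,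
      subset_insert _ _⟩, mem_insert_self _ _⟩
  · intro A hA B hB h
    simp only [coe_filter, Set.mem_ofPred_eq] at hA hB
    rw [← erase_insert hA.2, h, erase_insert hB.2]

lemma mul_card_filter_mem_le_card_upFam {X : Finset ℕ} {F : Finset (Finset ℕ)} {j i : ℕ}
    (hF : F ⊆ X.powersetCard j) :
    (X.card - j) * (F.filter (fun A => i ∈ A)).card ≤
      j * ((upFam X F (j + 1)).filter (fun A => i ∈ A)).card := by
  have h1 : ((F.filter (fun A => i ∈ A)).sigma fun A => X \ A).card =
      (X.card - j) * (F.filter (fun A => i ∈ A)).card := by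
    rw [card_sigma, mul_comm, ← smul_eq_mul, ← sum_const]
    refine sum_congr rfl fun A hA => ?_
    have h := mem_powersetCard.mp (hF (mem_filter.mp hA).1)
    rw [card_sdiff_of_subset h.1, h.2]
  have h2 : (((upFam X F (j + 1)).filter (fun A => i ∈ A)).sigma fun A => A.erase i).card =
      j * ((upFam X F (j + 1)).filter (fun A => i ∈ A)).card := by
    rw [card_sigma, mul_comm, ← smul_eq_mul, ← sum_const]
    refine sum_congr rfl fun A hA => ?_
    rw [mem_filter, mem_upFam] at hA
    rw [card_erase_of_mem hA.2, hA.1.1.2, Nat.add_sub_cancel]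
  rw [← h1, ← h2]
  refine card_le_card_of_injOn (fun p => ⟨insert p.2 p.1, p.2⟩) ?_ ?_
  · rintro ⟨A, x⟩ h
    simp only [coe_sigma, Set.mem_sigma_iff, mem_coe, mem_filter, mem_sdiff] at h
    simp only [coe_sigma, Set.mem_sigma_iff, mem_coe, mem_filter, mem_upFam, mem_erase]
    obtain ⟨⟨hA, hiA⟩, hx, hxA⟩ := h
    have h := mem_powersetCard.mp (hF hA)
    refine ⟨⟨⟨⟨insert_subset hx h.1, by rw [card_insert_of_notMem hxA, h.2]⟩, A, hA,
      subset_insert _ _⟩, mem_insert_of_mem hiA⟩, ?_, mem_insert_self _ _⟩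
    rintro rfl
    exact hxA hiA
  · rintro ⟨A, x⟩ hA ⟨B, y⟩ hB h
    simp only [coe_sigma, Set.mem_sigma_iff, mem_coe, mem_filter, mem_sdiff] at hA hB
    simp only [Sigma.mk.injEq, heq_eq_eq] at h
    obtain ⟨h, rfl⟩ := h
    have : A = B := by rw [← erase_insert hA.2.2, h, erase_insert hB.2.2]
    rw [this]

lemma card_filter_notMem_le_choose {X : Finset ℕ} {F : Finset (Finset ℕ)} {j i : ℕ}
    (hF : F ⊆ X.powersetCard j) (hint : IntersectingFam F) (hi : i ∈ X) (hj : 1 ≤ j)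
    (hX : 2 * j + 1 ≤ X.card) :
    (F.filter (fun A => i ∉ A)).card ≤ (X.card - 2).choose (j - 1) := by
  have := IntersectingFam.card_le_choose (X := X.erase i) (j := j)
    (F := F.filter (fun A => i ∉ A)) (filter_notMem_subset_powersetCard hF)
    (fun A hA B hB => hint A (mem_filter.mp hA).1 B (mem_filter.mp hB).1) hj
    (by rw [card_erase_of_mem hi]; omega)
  rwa [card_erase_of_mem hi, show X.card - 1 - 1 = X.card - 2 by omega] at this

lemma slow_growth_contradiction {X : Finset ℕ} {d e : ℕ → ℝ}
    {n r S G c C2 b b' z δ I₀ : ℝ}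
    (hn : (X.card : ℝ) = n) (hr0 : 1 ≤ r) (hnr : 2 * r + 4 ≤ n) (hcpos : 0 < c)
    (hC2c : C2 * (n * (n - 1)) = c * ((r + 1) * (n - r - 1))) (hC2pos : 0 < C2) (hG0 : 0 ≤ G)
    (hz : 0 ≤ z) (hI₀ : 0 ≤ I₀) (hδ : δ < r + 1)
    (hb : S * n = b * c) (hGeq : (r + 2) * G = b' * c * (n - r - 1) / n)
    (hbδ : r + 1 - δ ≤ b) (hbj : b ≤ r + 1) (hI : b' - b ≤ I₀)
    (hdsum : ∑ i ∈ X, d i = (r + 1) * S) (hesum : ∑ i ∈ X, e i = (r + 2) * G)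
    (hinfl1 : ∀ i ∈ X, S - d i ≤ e i)
    (hinfl2 : ∀ i ∈ X, (n - r - 1) * d i ≤ (r + 1) * e i)
    (hE2 : ∀ i ∈ X, S - d i ≤ C2)
    (hspec : ((n - r - 1) * S) ^ 2 ≤ G * (r * (n - r - 3) * S + 2 * (n - 1) * S ^ 2 / c +
        (n - 2) * (∑ i ∈ X, (d i - (r + 1) * S / n) ^ 2) / C2))
    (hcon : ∀ i ∈ X, (1 - z) * ((n - r - 1) / n) * S < S - d i)
    (hnum : (n - 2) * (n - 1) * I₀ / n *
      (z + (n * (r + 1) / ((r + 1 - δ) * (n - 1)) - 1)) +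
      n * (r + 2) * I₀ / (r + 1 - δ + I₀) < 2 * (n - 1)) : False := by
  have hn0 : 0 < n := by linarith
  have hbpos : 0 < b := by linarith
  have hSeq : S = b * c / n := by rw [eq_div_iff hn0.ne']; exact hb
  have hSpos : 0 < S := by rw [hSeq]; positivity
  have hC2eq : C2 = c * ((r + 1) * (n - r - 1)) / (n * (n - 1)) := by
    rw [eq_div_iff (by nlinarith)]; exact hC2c
  set D : ℕ → ℝ := fun i => d i - (r + 1) * S / n with hD
  have hDsum : ∑ i ∈ X, D i = 0 := by
    rw [hD, sum_sub_distrib, hdsum, sum_const, nsmul_eq_mul, hn]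
    field_simp
    ring
  set q : ℝ := (n - r - 1) / n with hq
  have hq0 : 0 < q := by rw [hq]; apply div_pos <;> linarith
  have hqn : q * n = n - r - 1 := by rw [hq]; field_simp
  have hqd : (r + 1) / n = 1 - q := by rw [hq]; field_simp; ring
  set v : ℝ := C2 - S * q with hv
  have hDu : ∀ i ∈ X, D i ≤ z * q * S := by
    intro i hi
    have h1 := hcon i hi
    have : D i = d i - (1 - q) * S := by rw [hD, ← hqd]; ring
    rw [this]
    linarith
  have hDv : ∀ i ∈ X, -v ≤ D i := by
    intro i hi
    have h1 := hE2 i hi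
    have : D i = d i - (1 - q) * S := by rw [hD, ← hqd]; ring
    rw [this, hv]
    linarith
  set P : ℝ := (r + 2) * G - (n - r - 1) * S with hP
  have hPsum : ∑ i ∈ X, max 0 (D i) ≤ (r + 1) * P / n := by
    have h1 : ∀ i ∈ X, max 0 (D i) ≤ (r + 1) / n * (e i - (S - d i)) := by
      intro i hi
      have ha := hinfl1 i hi
      have hb := hinfl2 i hi
      have hco : (0 : ℝ) ≤ (r + 1) / n := by positivity
      refine max_le (mul_nonneg hco (by linarith)) ?_
      rw [hD, div_mul_eq_mul_div, le_div_iff₀ hn0]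
      have : (d i - (r + 1) * S / n) * n = d i * n - (r + 1) * S := by field_simp
      simp only [this]
      linarith
    refine (sum_le_sum h1).trans (le_of_eq ?_)
    rw [← mul_sum, sum_sub_distrib, sum_sub_distrib, hesum, hdsum, sum_const, nsmul_eq_mul, hn,
      hP]
    ring
  have hPI : P = (b' - b) * (n - r - 1) * c / n := by
    rw [hP, hGeq, hSeq]; ring
  have hP0 : 0 ≤ P := by
    have h1 : 0 ≤ ∑ i ∈ X, max 0 (D i) := sum_nonneg fun i _ => le_max_left _ _
    have h2 := h1.trans hPsum
    rw [le_div_iff₀ hn0, zero_mul] at h2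
    exact nonneg_of_mul_nonneg_right h2 (by linarith)
  have hI0 : 0 ≤ b' - b := by
    rw [hPI] at hP0
    by_contra! hneg
    have h2 : (b' - b) * (n - r - 1) * c / n < 0 := by
      apply div_neg_of_neg_of_pos _ hn0
      apply mul_neg_of_neg_of_pos _ hcpos
      apply mul_neg_of_neg_of_pos hneg
      linarith
    linarith
  have hn1 : (0 : ℝ) < n - 1 := by linarith
  have hveq : v = S * q * (n * (r + 1) / (b * (n - 1)) - 1) := by
    rw [hv, hC2eq, hSeq, hq]
    field_simp
  have hv0 : 0 ≤ v := by
    rw [hveq]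
    refine mul_nonneg (by positivity) ?_
    rw [sub_nonneg, le_div_iff₀ (by positivity)]
    have := mul_le_mul_of_nonneg_right hbj hn1.le
    linarith
  have hQ : ∑ i ∈ X, D i ^ 2 ≤ (z * q * S + v) * ((r + 1) * P / n) := by
    have h1 : ∀ i ∈ X, D i ^ 2 ≤ (z * q * S + v) * max 0 (D i) - v * D i := by
      intro i hi
      have h2 := hDu i hi
      have h3 := hDv i hi
      rcases le_total 0 (D i) with h | h
      · have := mul_nonneg h (sub_nonneg.mpr h2)
        rw [max_eq_right h]; linarith
      · have := mul_nonneg (neg_nonneg.mpr h) (sub_nonneg.mpr h3)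
        rw [max_eq_left h]; linarith
    refine (sum_le_sum h1).trans ?_
    rw [sum_sub_distrib, ← mul_sum, ← mul_sum, hDsum, mul_zero, sub_zero]
    exact mul_le_mul_of_nonneg_left hPsum (by positivity)
  set w : ℝ := n * (r + 1) / (b * (n - 1)) - 1 with hw
  -- rewriting the spectral inequality
  have hb'pos : 0 < b' := by linarith
  have hmain : (n - r - 1) * (r + 2) * b ≤ b' * (r * (n - r - 3) + 2 * (n - 1) * b / n +
      (n - 2) * (n - 1) * (q * (z + w)) * (b' - b) / n) := by
    have h1 : ((n - r - 1) * S) ^ 2 ≤ G * (r * (n - r - 3) * S +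
        2 * (n - 1) * S ^ 2 / c + (n - 2) * ((z * q * S + v) * ((r + 1) * P / n)) / C2) := by
      refine hspec.trans (mul_le_mul_of_nonneg_left ?_ hG0)
      have : (0 : ℝ) ≤ n - 2 := by linarith
      gcongr
    have h2 : (n - 2) * ((z * q * S + v) * ((r + 1) * P / n)) / C2 =
        S * ((n - 2) * (n - 1) * (q * (z + w)) * (b' - b) / n) := by
      have : n - r - 1 ≠ 0 := by linarith
      rw [hveq, hPI, hC2eq]
      field_simp
    have h3 : 2 * (n - 1) * S ^ 2 / c = S * (2 * (n - 1) * b / n) := by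
      rw [sq, hSeq]; field_simp
    rw [h2, h3] at h1
    set R : ℝ := r * (n - r - 3) + 2 * (n - 1) * b / n +
      (n - 2) * (n - 1) * (q * (z + w)) * (b' - b) / n with hR
    have h4 : ((n - r - 1) * S) ^ 2 ≤ G * (S * R) := by
      refine h1.trans (le_of_eq ?_); rw [hR]; ring
    have h5 : (n - r - 1) ^ 2 * S ≤ G * R := by
      have : ((n - r - 1) ^ 2 * S) * S ≤ (G * R) * S := by linarith
      exact le_of_mul_le_mul_right this hSpos
    have h6 : (n - r - 1) ^ 2 * S * (r + 2) ≤ (b' * c * (n - r - 1) / n) * R := by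
      have := mul_le_mul_of_nonneg_right h5 (show 0 ≤ r + 2 by linarith)
      rw [← hGeq]; linarith
    rw [hSeq] at h6
    have hpos : 0 < c * (n - r - 1) / n := by
      apply div_pos _ hn0
      apply mul_pos hcpos
      linarith
    have h7 : ((n - r - 1) * (r + 2) * b) * (c * (n - r - 1) / n) ≤
        (b' * R) * (c * (n - r - 1) / n) := by
      refine (le_of_eq ?_).trans (h6.trans (le_of_eq ?_)) <;> ring
    exact le_of_mul_le_mul_right h7 hpos
  have hstep : 2 * (n - 1) ≤ (n - 2) * (n - 1) * (b' - b) / n * (z + w) +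
      n * (r + 2) * ((b' - b) / b') := by
    have h1 : (n - r - 1) * (r + 2) * (1 - (b' - b) / b') ≤
        r * (n - r - 3) + 2 * (n - 1) * b / n +
          (n - 2) * (n - 1) * (q * (z + w)) * (b' - b) / n := by
      have : (n - r - 1) * (r + 2) * (1 - (b' - b) / b') = (n - r - 1) * (r + 2) * b / b' := by
        field_simp; ring
      rw [this, div_le_iff₀ hb'pos]
      linarith
    have h2 : 2 * (n - 1) * b / n ≤ 2 * (n - 1) * (1 - q) := by
      rw [← hqd, mul_div_assoc]; gcongr
    have h3 : q * (2 * (n - 1)) ≤ q * ((n - 2) * (n - 1) * (b' - b) / n * (z + w) +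
      n * (r + 2) * ((b' - b) / b')) := by
      have e1 : q * (n * (r + 2) * ((b' - b) / b')) =
        (n - r - 1) * (r + 2) * ((b' - b) / b') := by rw [← hqn]; ring
      have e2 : q * ((n - 2) * (n - 1) * (b' - b) / n * (z + w)) =
        (n - 2) * (n - 1) * (q * (z + w)) * (b' - b) / n := by ring
      rw [mul_add, e1, e2]
      linarith
    exact le_of_mul_le_mul_left h3 hq0
  have hδpos : 0 < (r : ℝ) + 1 - δ := by linarith
  have hwle : w ≤ n * (r + 1) / ((r + 1 - δ) * (n - 1)) - 1 := by
    rw [hw]; gcongr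
  have hw0 : 0 ≤ w := by
    rw [hveq] at hv0
    exact nonneg_of_mul_nonneg_right hv0 (by positivity)
  have hfrac : (b' - b) / b' ≤ I₀ / (r + 1 - δ + I₀) := by
    rw [div_le_div_iff₀ hb'pos (by linarith)]
    have h1 := mul_le_mul_of_nonneg_right hI hδpos.le
    have h2 := mul_le_mul_of_nonneg_left hbδ hI₀
    linarith
  have hfin1 : (n - 2) * (n - 1) * (b' - b) / n * (z + w) ≤ (n - 2) * (n - 1) * I₀ / n *
      (z + (n * (r + 1) / ((r + 1 - δ) * (n - 1)) - 1)) := by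
    have : (0 : ℝ) ≤ n - 2 := by linarith
    gcongr
  have hfin2 : n * (r + 2) * ((b' - b) / b') ≤ n * (r + 2) * I₀ / (r + 1 - δ + I₀) := by
    rw [mul_div_assoc]; gcongr
  linarith

/-- If the upper shadow of an intersecting family grows slowly, then some element has
large degree. -/
theorem exists_card_filter_notMem_le {X : Finset ℕ} {F : Finset (Finset ℕ)} {r : ℕ}
    {z δ I₀ b b' : ℝ}
    (hF : F ⊆ X.powersetCard (r + 1)) (hint : IntersectingFam F) (hX : 2 * r + 4 ≤ X.card)
    (hr : 1 ≤ r) (hz : 0 ≤ z) (hI₀ : 0 ≤ I₀) (hδ : δ < r + 1)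
    (hb : (F.card : ℝ) * X.card = b * X.card.choose (r + 1))
    (hb' : ((upFam X F (r + 2)).card : ℝ) * X.card = b' * X.card.choose (r + 2))
    (hbδ : (r : ℝ) + 1 - δ ≤ b) (hI : b' - b ≤ I₀)
    (hnum : ((X.card : ℝ) - 2) * (X.card - 1) * I₀ / X.card *
      (z + (X.card * (r + 1) / ((r + 1 - δ) * (X.card - 1)) - 1)) +
      X.card * (r + 2) * I₀ / (r + 1 - δ + I₀) < 2 * (X.card - 1)) :
    ∃ i ∈ X, ((F.filter (fun A => i ∉ A)).card : ℝ) ≤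
      (1 - z) * ((X.card - r - 1) / X.card) * F.card := by
  by_contra! hcon
  have hspec := sq_card_le_card_upFam_mul (r := r) hF (by omega)
  have hE1 := IntersectingFam.card_le_choose hF hint (by omega) (by omega)
  have hinfl1 : ∀ i ∈ X, _ := fun i hi => card_filter_notMem_le_card_upFam (i := i) hF hi
  have hinfl2 : ∀ i ∈ X, _ := fun i _ => mul_card_filter_mem_le_card_upFam (i := i) hF
  have hE2 : ∀ i ∈ X, _ := fun i hi =>
    card_filter_notMem_le_choose (i := i) hF hint hi (by omega) (by omega)
  have hsum1 := sum_card_filter_mem hF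
  have hsum2 := sum_card_filter_mem (upFam_subset X F (r + 1 + 1))
  have hadd := card_filter_mem_add_card_filter_notMem F
  have hrn : r + 1 ≤ X.card := by omega
  simp only [Nat.add_sub_cancel] at hE1 hE2
  set n : ℕ := X.card with hn
  set S : ℝ := (F.card : ℝ) with hS
  set G : ℝ := ((upFam X F (r + 2)).card : ℝ) with hG
  set c : ℝ := (n.choose (r + 1) : ℝ) with hc
  set C2 : ℝ := ((n - 2).choose r : ℝ) with hC2
  set d : ℕ → ℝ := fun i => ((F.filter (fun A => i ∈ A)).card : ℝ) with hd
  set e : ℕ → ℝ := fun i => (((upFam X F (r + 2)).filter (fun A => i ∈ A)).card : ℝ) with he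
  have hr0 : (1 : ℝ) ≤ r := by exact_mod_cast hr
  have hnr : 2 * (r : ℝ) + 4 ≤ n := by exact_mod_cast hX
  have hn0 : (0 : ℝ) < n := by linarith
  have hcpos : 0 < c := by
    rw [hc]; exact_mod_cast Nat.choose_pos (show r + 1 ≤ n by omega)
  have hC2c : C2 * (n * (n - 1)) = c * ((r + 1) * (n - r - 1)) := by
    obtain ⟨m, hm⟩ : ∃ m, n = m + 2 := ⟨n - 2, by omega⟩
    have h1 := Nat.add_one_mul_choose_eq (m + 1) r
    have h2 := Nat.choose_mul_succ_eq m r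
    have h1' : ((m : ℝ) + 1 + 1) * (m + 1).choose r = (m + 2).choose (r + 1) * (r + 1) := by
      exact_mod_cast h1
    have h2' : (m.choose r : ℝ) * (m + 1) = (m + 1).choose r * (m + 1 - r) := by
      rw [show ((m : ℝ) + 1 - r) = ((m + 1 - r : ℕ) : ℝ) by
        rw [Nat.cast_sub (by omega)]; push_cast; ring]
      exact_mod_cast h2
    rw [hC2, hc, hm]
    rw [Nat.add_sub_cancel]
    push_cast
    linear_combination ((m : ℝ) + 2) * h2' + ((m : ℝ) + 1 - r) * h1'
  have hc' : (n.choose (r + 2) : ℝ) * (r + 2) = c * (n - r - 1) := by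
    have := Nat.choose_succ_right_eq n (r + 1)
    have h2 : (((n - (r + 1) : ℕ)) : ℝ) = n - r - 1 := by
      rw [Nat.cast_sub (by omega)]; push_cast; ring
    rw [← h2, hc]
    exact_mod_cast this
  have hC2pos : 0 < C2 := by
    rw [hC2]; exact_mod_cast Nat.choose_pos (show r ≤ n - 2 by omega)
  have hGeq : (r + 2) * G = b' * c * (n - r - 1) / n := by
    rw [eq_div_iff hn0.ne']
    linear_combination ((r : ℝ) + 2) * hb' + b' * hc'
  have hbj : b ≤ r + 1 := by
    have h1 : S ≤ (n - 1).choose r := by rw [hS]; exact_mod_cast hE1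
    have h2 := Nat.add_one_mul_choose_eq (n - 1) r
    rw [show n - 1 + 1 = n by omega] at h2
    have h3 : (n : ℝ) * (n - 1).choose r = c * (r + 1) := by rw [hc]; exact_mod_cast h2
    have h4 : b * c ≤ (r + 1) * c := by
      have := mul_le_mul_of_nonneg_right h1 hn0.le
      linarith
    exact le_of_mul_le_mul_right h4 hcpos
  have hnot : ∀ i, ((F.filter (fun A => i ∉ A)).card : ℝ) = S - d i := by
    intro i
    have : d i + ((F.filter (fun A => i ∉ A)).card : ℝ) = S := by
      simp only [hd, hS]; exact_mod_cast hadd i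
    linarith
  refine slow_growth_contradiction (X := X) (d := d) (e := e)
    (congrArg Nat.cast hn.symm) hr0 hnr hcpos hC2c hC2pos
    (Nat.cast_nonneg _) hz hI₀ hδ hb hGeq hbδ hbj hI ?_ ?_ ?_ ?_ ?_ hspec ?_ hnum
  · rw [hd, ← Nat.cast_sum, hsum1]; push_cast; rfl
  · rw [he, ← Nat.cast_sum, hsum2]
    have : ((r : ℝ) + 1 + 1) = r + 2 := by ring
    push_cast
    rw [this]
  · intro i hi
    rw [← hnot]; simp only [he]; exact_mod_cast hinfl1 i hi
  · intro i hi
    have h2 : (((n - (r + 1) : ℕ)) : ℝ) = n - r - 1 := by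
      rw [Nat.cast_sub (by omega)]; push_cast; ring
    rw [← h2]
    simp only [hd, he]
    exact_mod_cast hinfl2 i hi
  · intro i hi
    rw [← hnot, hC2]; exact_mod_cast hE2 i hi
  · intro i hi
    rw [← hnot]; exact hcon i hi

lemma exists_step_le {β : ℕ → ℝ} {k l : ℕ} {δ I : ℝ} (h₀ : k - δ ≤ β k) (hI : 1 ≤ I)
    (hub : β (k + l) ≤ k + l) (hl : 1 ≤ l) (hδ : δ ≤ l * (I - 1)) :
    ∃ i < l, (k : ℝ) + i - δ ≤ β (k + i) ∧ β (k + i + 1) - β (k + i) ≤ I := by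
  by_contra! hcon
  have key : ∀ i ≤ l, k - δ + i * I ≤ β (k + i) ∧ (1 ≤ i → k - δ + i * I < β (k + i)) := by
    intro i
    induction i with
    | zero => intro _; simpa using h₀
    | succ i ih =>
      intro hi
      have h1 := (ih (by omega)).1
      have h2 : (i : ℝ) ≤ i * I := le_mul_of_one_le_right (Nat.cast_nonneg _) hI
      have h3 := hcon i (by omega) (by linarith)
      have h4 : k - δ + ((i + 1 : ℕ) : ℝ) * I < β (k + (i + 1)) := by
        rw [← add_assoc]; push_cast; linarith
      exact ⟨h4.le, fun _ => h4⟩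
  have := (key l le_rfl).2 hl
  linarith

lemma choose_pow_three_mul_le (N r : ℕ) (hr : r ≤ N) :
    (N.choose r : ℝ) ^ 3 * (N - r) ≤ rchoose (N - 1 / 3) r ^ 3 * N := by
  induction r with
  | zero => simp [rchoose_zero]
  | succ r ih =>
    have ih := ih (by omega)
    have hrN : (r : ℝ) + 1 ≤ N := by exact_mod_cast hr
    rw [← rchoose_natCast] at ih ⊢
    rw [rchoose_succ, rchoose_succ]
    push_cast
    set f := rchoose (N - 1 / 3) r
    set g := rchoose N r with hg
    set a : ℝ := (N : ℝ) - r with ha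
    have hg0 : 0 ≤ g := rchoose_nonneg (by linarith)
    have ha1 : 1 ≤ a := by linarith
    have h1 : a ^ 2 * (a - 1) ≤ (a - 1 / 3) ^ 3 := by nlinarith
    have h2 : g ^ 3 * a * (a ^ 2 * (a - 1)) ≤ f ^ 3 * N * (a - 1 / 3) ^ 3 := by
      refine mul_le_mul ih h1 ?_ ?_
      · exact mul_nonneg (sq_nonneg a) (by linarith)
      · exact le_trans (by positivity) ih
    have e1 : (g * a / (r + 1)) ^ 3 * (N - (r + 1)) =
        g ^ 3 * a * (a ^ 2 * (a - 1)) / ((r : ℝ) + 1) ^ 3 := by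
      rw [div_pow, ha]; ring
    have e2 : (f * (N - 1 / 3 - r) / (r + 1)) ^ 3 * N =
        f ^ 3 * N * (a - 1 / 3) ^ 3 / ((r : ℝ) + 1) ^ 3 := by
      rw [div_pow, ha]; ring
    rw [e1, e2]
    gcongr

lemma choose_mul_pow_le_choose_mul_pow {a b : ℕ} (hab : a ≤ b) (m : ℕ) :
    a.choose m * b ^ m ≤ b.choose m * a ^ m := by
  induction m with
  | zero => simp
  | succ m ih =>
    have h1 : (a - m) * b ≤ (b - m) * a := by
      rcases le_or_gt a m with h | h
      · simp [Nat.sub_eq_zero_of_le h]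
      · obtain ⟨c, rfl⟩ := Nat.exists_eq_add_of_lt h
        obtain ⟨d, rfl⟩ := Nat.exists_eq_add_of_le hab
        rw [show m + c + 1 - m = c + 1 by omega, show m + c + 1 + d - m = c + 1 + d by omega]
        nlinarith [Nat.zero_le (m * d)]
    have h2 := Nat.choose_succ_right_eq a m
    have h3 := Nat.choose_succ_right_eq b m
    refine Nat.le_of_mul_le_mul_right (?_ : _ * (m + 1) ≤ _ * (m + 1)) (Nat.succ_pos m)
    calc a.choose (m + 1) * b ^ (m + 1) * (m + 1)
        = (a.choose m * b ^ m) * ((a - m) * b) := by rw [pow_succ]; linear_combination b ^ m * b * h2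
      _ ≤ (b.choose m * a ^ m) * ((b - m) * a) := Nat.mul_le_mul ih h1
      _ = b.choose (m + 1) * a ^ (m + 1) * (m + 1) := by
        rw [pow_succ]
        exact (by linear_combination a ^ m * a * h3 :
          b.choose (m + 1) * (a ^ m * a) * (m + 1) = (b.choose m * a ^ m) * ((b - m) * a)).symm

/-- Large `t`-degrees force a lower bound on the size of the family. -/
lemma mul_le_card_mul_of_lt_tDeg {X : Finset ℕ} {k t : ℕ} {τ : ℝ} {F : Finset (Finset ℕ)}
    (hF : F ⊆ X.powersetCard k) (htk : t + 1 ≤ k) (hk : k ≤ X.card)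
    (hτ : ((X.card - t - k - 1).choose (k - t - 1) : ℝ) ≤
      τ * (X.card - t - 1).choose (k - t - 1))
    (h : ∀ S ∈ X.powersetCard t, (X.card - t - 1).choose (k - t - 1) -
      (X.card - t - k - 1).choose (k - t - 1) < tDeg F S) :
    (X.card.choose k : ℝ) * ((k - t) * (1 - τ)) ≤ F.card * (X.card - t) := by
  have h1 := choose_mul_le_of_lt_tDeg hF h
  set n := X.card with hn
  set A := (n - t - 1).choose (k - t - 1) with hA
  set B := (n - t - k - 1).choose (k - t - 1) with hB
  have hAB : B ≤ A := Nat.choose_le_choose _ (by omega)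
  have h2 : n.choose t * (A - B + 1) ≤ F.card * k.choose t := h1
  have h3 : (n.choose t : ℝ) * (A - B) ≤ F.card * k.choose t := by
    have : ((n.choose t * (A - B + 1) : ℕ) : ℝ) ≤ (F.card * k.choose t : ℕ) := by
      exact_mod_cast h2
    push_cast [Nat.cast_sub hAB] at this
    nlinarith [(Nat.cast_nonneg (n.choose t) : (0 : ℝ) ≤ _)]
  have h4 : (n.choose k : ℝ) * k.choose t = n.choose t * (n - t).choose (k - t) := by
    exact_mod_cast Nat.choose_mul (by omega : t ≤ k)
  have h5 : ((n : ℝ) - t) * A = (n - t).choose (k - t) * (k - t) := by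
    have := Nat.add_one_mul_choose_eq (n - t - 1) (k - t - 1)
    rw [show n - t - 1 + 1 = n - t by omega, show k - t - 1 + 1 = k - t by omega] at this
    rw [← Nat.cast_sub (by omega : t ≤ n), ← Nat.cast_sub (by omega : t ≤ k)]
    exact_mod_cast this
  have hkt : (0 : ℝ) < k.choose t := by exact_mod_cast Nat.choose_pos (by omega : t ≤ k)
  have hnt : (0 : ℝ) ≤ (n : ℝ) - t := by
    rw [← Nat.cast_sub (by omega : t ≤ n)]; positivity
  refine le_of_mul_le_mul_right ?_ hkt
  calc (n.choose k : ℝ) * ((k - t) * (1 - τ)) * k.choose t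
      = n.choose t * (A - τ * A) * (n - t) := by
        linear_combination ((k : ℝ) - t) * (1 - τ) * h4 - (1 - τ) * n.choose t * h5
    _ ≤ n.choose t * (A - B) * (n - t) := by gcongr
    _ ≤ F.card * k.choose t * (n - t) := by gcongr
    _ = _ := by ring

theorem exists_card_filter_notMem_lt {X : Finset ℕ} {F : Finset (Finset ℕ)} {k l : ℕ}
    {z δ I : ℝ} (hF : F ⊆ X.powersetCard k) (hint : IntersectingFam F)
    (hX : 2 * (k + l) ≤ X.card) (hl : 1 ≤ l) (hk : 2 ≤ k) (hz : 0 ≤ z) (hz1 : z ≤ 1)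
    (hI : 1 ≤ I) (hδk : δ < k) (hδ : δ ≤ l * (I - 1))
    (hcard : (X.card.choose k : ℝ) * (k - δ) ≤ F.card * X.card)
    (hzk : (1 - z) ^ 3 * (X.card - 2) < k - 1)
    (hnum : ∀ j : ℝ, k ≤ j → ((X.card : ℝ) - 2) * (X.card - 1) * I / X.card *
      (z + (X.card * j / ((j - δ) * (X.card - 1)) - 1)) +
      X.card * (j + 1) * I / (j - δ + I) < 2 * (X.card - 1)) :
    ∃ i ∈ X, ((F.filter (fun A => i ∉ A)).card : ℝ) <
      rchoose (X.card - 7 / 3) (X.card - 1 - k) := by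
  set β : ℕ → ℝ := fun j => ((upFam X F j).card : ℝ) * X.card / X.card.choose j with hβ
  have hchoose : ∀ j ≤ X.card, (0 : ℝ) < X.card.choose j := fun j hj => by
    exact_mod_cast Nat.choose_pos hj
  have hn0 : (0 : ℝ) < X.card := by
    exact_mod_cast (by omega : 0 < X.card)
  have hEKR : ∀ j, 1 ≤ j → 2 * j ≤ X.card → ((upFam X F j).card : ℝ) ≤
      (X.card - 1).choose (j - 1) := fun j h1 h2 => by
    exact_mod_cast IntersectingFam.card_le_choose (upFam_subset X F j) (hint.upFam X j) h1 h2
  have hub : ∀ j, 1 ≤ j → 2 * j ≤ X.card → β j ≤ j := by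
    intro j h1 h2
    simp only [hβ]
    rw [div_le_iff₀ (hchoose j (by omega))]
    have h3 := Nat.add_one_mul_choose_eq (X.card - 1) (j - 1)
    rw [show X.card - 1 + 1 = X.card by omega, show j - 1 + 1 = j by omega] at h3
    have h4 : (X.card : ℝ) * (X.card - 1).choose (j - 1) = X.card.choose j * j := by
      exact_mod_cast h3
    have := mul_le_mul_of_nonneg_right (hEKR j h1 h2) hn0.le
    linarith
  obtain ⟨i, hil, hb, hbI⟩ := exists_step_le (β := β) (k := k) (l := l) (δ := δ) (I := I) (by
    simp only [hβ]
    rw [upFam_self hF, le_div_iff₀ (hchoose k (by omega))]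
    linarith) hI (by exact_mod_cast hub (k + l) (by omega) hX) hl hδ
  obtain ⟨r, hr⟩ : ∃ r, k + i = r + 1 := ⟨k + i - 1, by omega⟩
  have hrR : (k : ℝ) + i = r + 1 := by exact_mod_cast hr
  have hki : (k : ℝ) ≤ r + 1 := by rw [← hrR]; linarith [(Nat.cast_nonneg i : (0 : ℝ) ≤ i)]
  rw [hrR] at hb
  rw [hr] at hb hbI
  obtain ⟨x, hx, hxcard⟩ := exists_card_filter_notMem_le (X := X) (F := upFam X F (r + 1))
    (r := r) (z := z) (δ := δ) (I₀ := I) (b := β (r + 1)) (b' := β (r + 1 + 1))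
    (upFam_subset X F _) (hint.upFam X _) (by omega) (by omega) hz (by linarith) (by linarith)
    (by simp only [hβ]; rw [div_mul_cancel₀ _ (hchoose _ (by omega)).ne'])
    (by
      simp only [hβ]
      rw [show r + 2 = r + 1 + 1 from rfl, upFam_upFam hF (by omega),
        div_mul_cancel₀ _ (hchoose _ (by omega)).ne'])
    hb hbI (by
      have := hnum (r + 1) hki
      rw [show (r : ℝ) + 2 = r + 1 + 1 by ring]
      exact this)
  refine ⟨x, hx, ?_⟩
  by_contra! hγ
  have hXe : (X.erase x).card = X.card - 1 := card_erase_of_mem hx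
  have hsup := rchoose_le_card_of_superset (X := X.erase x) (a := k) (b := r + 1)
    (𝒜 := F.filter (fun A => x ∉ A)) (𝒢 := (upFam X F (r + 1)).filter (fun A => x ∉ A))
    (y := X.card - 7 / 3) (filter_notMem_subset_powersetCard hF) (by
      intro A hA B hB hAB
      rw [mem_filter] at hA ⊢
      rw [mem_powersetCard, subset_erase] at hB
      exact ⟨mem_upFam.mpr ⟨⟨hB.1.1, hB.2⟩, A, hA.1, hAB⟩, hB.1.2⟩) (by omega) (by omega)
    (by
      rw [hXe, Nat.cast_sub (by omega)]; push_cast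
      have : (2 : ℝ) ≤ k := by exact_mod_cast hk
      linarith) (by rw [hXe]; exact hγ)
  rw [hXe, show X.card - 1 - (r + 1) = X.card - 2 - r by omega] at hsup
  have h3 := choose_pow_three_mul_le (X.card - 2) (X.card - 2 - r) (by omega)
  rw [Nat.choose_symm (by omega), Nat.cast_sub (by omega : r ≤ X.card - 2),
    Nat.cast_sub (by omega : 2 ≤ X.card)] at h3
  push_cast at h3
  rw [show (X.card : ℝ) - 2 - 1 / 3 = X.card - 7 / 3 by ring] at h3
  have hE := hEKR (r + 1) (by omega) (by omega)
  rw [Nat.add_sub_cancel] at hE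
  have h4 : ((X.card - 1).choose r : ℝ) * (X.card - r - 1) =
      (X.card - 1) * (X.card - 2).choose r := by
    have := Nat.choose_mul_succ_eq (X.card - 2) r
    rw [show X.card - 2 + 1 = X.card - 1 by omega] at this
    rw [show ((X.card : ℝ) - r - 1) = ((X.card - 1 - r : ℕ) : ℝ) by
      rw [Nat.cast_sub (by omega), Nat.cast_sub (by omega)]; push_cast; ring,
      show ((X.card : ℝ) - 1) = ((X.card - 1 : ℕ) : ℝ) by
      rw [Nat.cast_sub (by omega)]; push_cast; ring]
    have h5 : ((X.card - 2).choose r : ℝ) * (X.card - 1 : ℕ) =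
      (X.card - 1).choose r * (X.card - 1 - r : ℕ) := by exact_mod_cast this
    linarith
  set n : ℝ := (X.card : ℝ) with hn
  set f := rchoose (n - 7 / 3) (X.card - 2 - r) with hf
  set C := ((X.card - 2).choose r : ℝ) with hC
  have hC0 : 0 < C := by
    rw [hC]; exact_mod_cast Nat.choose_pos (by omega : r ≤ X.card - 2)
  have hrn : 2 * (r : ℝ) + 4 ≤ n := by
    rw [hn]; exact_mod_cast (by omega : 2 * r + 4 ≤ X.card)
  have hr1 : (1 : ℝ) ≤ r := by exact_mod_cast (by omega : 1 ≤ r)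
  have hf0 : 0 ≤ f := by
    refine rchoose_nonneg ?_
    rw [Nat.cast_sub (by omega), Nat.cast_sub (by omega)]
    push_cast; linarith
  have h6 : f ≤ (1 - z) * C := by
    have h7 : (1 - z) * ((n - r - 1) / n) * (upFam X F (r + 1)).card ≤
        (1 - z) * ((n - r - 1) / n) * (X.card - 1).choose r := by
      refine mul_le_mul_of_nonneg_left hE ?_
      exact mul_nonneg (by linarith) (div_nonneg (by linarith) hn0.le)
    have h8 : (1 - z) * ((n - r - 1) / n) * (X.card - 1).choose r =
        (1 - z) * C * ((n - 1) / n) := by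
      linear_combination (1 - z) / n * h4
    have h9 : (1 - z) * C * ((n - 1) / n) ≤ (1 - z) * C * 1 := by
      refine mul_le_mul_of_nonneg_left ?_ (mul_nonneg (by linarith) hC0.le)
      rw [div_le_one hn0]; linarith
    linarith
  have h10 : f ^ 3 ≤ ((1 - z) * C) ^ 3 := pow_le_pow_left₀ hf0 h6 3
  have h11 : C ^ 3 * r ≤ C ^ 3 * ((1 - z) ^ 3 * (n - 2)) := by
    have := mul_le_mul_of_nonneg_right h10 (by linarith : (0 : ℝ) ≤ n - 2)
    rw [mul_pow] at this
    linarith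
  have h12 := le_of_mul_le_mul_left h11 (by positivity)
  linarith

lemma growth_numerics {n j δ I q p : ℝ} (hn : 60 ≤ n) (hjδ : δ < j) (hI : 0 ≤ I)
    (hq : j ≤ q * (j - δ)) (hp : (j + 1) * I ≤ p * (j - δ + I))
    (hw : 1 / 2 ≤ (q - 5998 / 10000) * I) (hsum : (q - 5998 / 10000) * I + p ≤ 1982 / 1000) :
    (n - 2) * (n - 1) * I / n * (39 / 100 + (n * j / ((j - δ) * (n - 1)) - 1)) +
      n * (j + 1) * I / (j - δ + I) < 2 * (n - 1) := by
  have h0 : 0 < j - δ := by linarith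
  have h1 : (n - 2) * (n - 1) * I / n * (39 / 100 + (n * j / ((j - δ) * (n - 1)) - 1)) =
      (n - 2) * I * (j / (j - δ) - 61 / 100 * ((n - 1) / n)) := by
    have : n - 1 ≠ 0 := by linarith
    field_simp
    ring
  have h2 : n * (j + 1) * I / (j - δ + I) ≤ n * p := by
    rw [div_le_iff₀ (by linarith)]
    have := mul_le_mul_of_nonneg_left hp (by linarith : (0 : ℝ) ≤ n)
    linarith
  have h3 : j / (j - δ) ≤ q := by rw [div_le_iff₀ h0]; exact hq
  have h4 : 59 / 60 ≤ (n - 1) / n := by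
    rw [div_le_div_iff₀ (by norm_num) (by linarith)]; linarith
  have h5 : (n - 2) * I * (j / (j - δ) - 61 / 100 * ((n - 1) / n)) ≤
      (n - 2) * I * (q - 5998 / 10000) := by
    refine mul_le_mul_of_nonneg_left (by linarith) (mul_nonneg (by linarith) hI)
  rw [h1]
  have h6 := mul_le_mul_of_nonneg_left hsum (by linarith : (0 : ℝ) ≤ n)
  linarith

lemma mul_three_quarters_pow_le (m : ℕ) (hm : 13 ≤ m) :
    (16 * (m : ℝ) - 19) * (3 / 4) ^ m ≤ 6 := by
  induction m, hm using Nat.le_induction with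
  | base => norm_num
  | succ m hm ih =>
    have hm' : (13 : ℝ) ≤ m := by exact_mod_cast hm
    have h : (16 * ((m + 1 : ℕ) : ℝ) - 19) * (3 / 4) ≤ 16 * (m : ℝ) - 19 := by
      push_cast; linarith
    calc (16 * ((m + 1 : ℕ) : ℝ) - 19) * (3 / 4) ^ (m + 1)
        = (16 * ((m + 1 : ℕ) : ℝ) - 19) * (3 / 4) * (3 / 4) ^ m := by ring
      _ ≤ (16 * (m : ℝ) - 19) * (3 / 4) ^ m := by gcongr
      _ ≤ 6 := ih

lemma sq_mul_three_quarters_pow_le (m : ℕ) (hm : 33 ≤ m) :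
    ((m : ℝ) + 2) ^ 2 * (3 / 4) ^ m ≤ 1 := by
  induction m, hm using Nat.le_induction with
  | base => norm_num
  | succ m hm ih =>
    have hm' : (33 : ℝ) ≤ m := by exact_mod_cast hm
    have h : (((m + 1 : ℕ) : ℝ) + 2) ^ 2 * (3 / 4) ≤ ((m : ℝ) + 2) ^ 2 := by
      push_cast; nlinarith
    calc (((m + 1 : ℕ) : ℝ) + 2) ^ 2 * (3 / 4) ^ (m + 1)
        = (((m + 1 : ℕ) : ℝ) + 2) ^ 2 * (3 / 4) * (3 / 4) ^ m := by ring
      _ ≤ ((m : ℝ) + 2) ^ 2 * (3 / 4) ^ m := by gcongr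
      _ ≤ 1 := ih

/-- The ratio of the two binomial coefficients is at most a power of `a / b`. -/
lemma choose_le_pow_mul_choose {a b : ℕ} (hab : a ≤ b) (hb : 0 < b) {θ : ℝ}
    (hθ : (a : ℝ) ≤ θ * b) (m : ℕ) : (a.choose m : ℝ) ≤ θ ^ m * b.choose m := by
  have h : (a.choose m : ℝ) * (b : ℝ) ^ m ≤ b.choose m * (a : ℝ) ^ m := by
    exact_mod_cast choose_mul_pow_le_choose_mul_pow hab m
  have hb' : (0 : ℝ) < b := by exact_mod_cast hb
  refine le_of_mul_le_mul_right ?_ (pow_pos hb' m)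
  calc (a.choose m : ℝ) * (b : ℝ) ^ m ≤ b.choose m * (a : ℝ) ^ m := h
    _ ≤ b.choose m * (θ * b) ^ m := by gcongr
    _ = _ := by rw [mul_pow]; ring

/-- The numerical range of the parameters. -/
def Admissible (n k t : ℕ) : Prop :=
  (t = 1 ∧ 2 * k + 5 ≤ n ∧ 35 ≤ k) ∨ (2 ≤ t ∧ 4 * t + 8 ≤ k ∧ 2 * k + 14 * t ≤ n)

theorem exists_card_filter_notMem_lt_of_lt_four_mul {X : Finset ℕ} {F : Finset (Finset ℕ)}
    {k t : ℕ} (hadm : Admissible X.card k t) (hn4 : X.card < 4 * k)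
    (hF : F ⊆ X.powersetCard k) (hint : IntersectingFam F)
    (h : ∀ S ∈ X.powersetCard t, (X.card - t - 1).choose (k - t - 1) -
      (X.card - t - k - 1).choose (k - t - 1) < tDeg F S) :
    ∃ i ∈ X, ((F.filter (fun A => i ∉ A)).card : ℝ) <
      rchoose (X.card - 7 / 3) (X.card - 1 - k) := by
  have hτ : ((X.card - t - k - 1).choose (k - t - 1) : ℝ) ≤
      (3 / 4) ^ (k - t - 1) * (X.card - t - 1).choose (k - t - 1) := by
    refine choose_le_pow_mul_choose (by omega) (by unfold Admissible at hadm; omega) ?_ _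
    have h1 : 4 * (X.card - t - k - 1) ≤ 3 * (X.card - t - 1) := by
      unfold Admissible at hadm; omega
    have h2 : (4 : ℝ) * (X.card - t - k - 1 : ℕ) ≤ 3 * (X.card - t - 1 : ℕ) := by
      exact_mod_cast h1
    linarith
  have hsize := mul_le_card_mul_of_lt_tDeg hF (by unfold Admissible at hadm; omega)
    (by unfold Admissible at hadm; omega) hτ h
  set τ : ℝ := (3 / 4 : ℝ) ^ (k - t - 1) with hτdef
  have hconv : ∀ δ : ℝ, (X.card : ℝ) * (k - t) * τ ≤ δ * (X.card - t) - t * (X.card - k) →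
      (t : ℝ) < X.card → (X.card.choose k : ℝ) * (k - δ) ≤ F.card * X.card := by
    intro δ hδ ht
    have hC : (0 : ℝ) ≤ X.card.choose k := Nat.cast_nonneg _
    refine le_of_mul_le_mul_right ?_ (sub_pos.mpr ht)
    have h1 := mul_le_mul_of_nonneg_right hsize (Nat.cast_nonneg X.card : (0 : ℝ) ≤ X.card)
    have h2 := mul_le_mul_of_nonneg_left hδ hC
    linarith
  have hn4' : (X.card : ℝ) + 1 ≤ 4 * k := by exact_mod_cast hn4
  have hτ0 : 0 < τ := by positivity
  rcases hadm with ⟨rfl, hn, hk⟩ | ⟨ht, hk, hn⟩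
  · have hn' : 2 * (k : ℝ) + 5 ≤ X.card := by exact_mod_cast hn
    have hk' : (35 : ℝ) ≤ k := by exact_mod_cast hk
    have hτk : (k : ℝ) ^ 2 * τ ≤ 1 := by
      have := sq_mul_three_quarters_pow_le (k - 2) (by omega)
      rw [Nat.cast_sub (by omega : 2 ≤ k)] at this
      push_cast at this
      rwa [sub_add_cancel] at this
    have hτn : (X.card : ℝ) * (k - 1) * τ ≤ 4 := by
      have h1 : (X.card : ℝ) * (k - 1) ≤ 4 * k * k := by
        refine mul_le_mul ?_ ?_ ?_ ?_ <;> linarith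
      have h2 := mul_le_mul_of_nonneg_right h1 hτ0.le
      linarith
    have hz : (1 - 39 / 100 : ℝ) ^ 3 * (X.card - 2) < k - 1 := by
      norm_num; linarith
    have hnum : ∀ δ : ℝ, 0 ≤ δ → δ ≤ 8 / 10 → ∀ j : ℝ, k ≤ j →
        ((X.card : ℝ) - 2) * (X.card - 1) * (13 / 10) / X.card *
        (39 / 100 + (X.card * j / ((j - δ) * (X.card - 1)) - 1)) +
        X.card * (j + 1) * (13 / 10) / (j - δ + 13 / 10) < 2 * (X.card - 1) := by
      intro δ hδ0 hδ j hj
      refine growth_numerics (q := 10234 / 10000) (p := 13184 / 10000) ?_ ?_ ?_ ?_ ?_ ?_ ?_ <;> linarith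
    rcases Nat.lt_or_ge (2 * k + 5) X.card with hlt | hge
    · have hlt' : 2 * (k : ℝ) + 6 ≤ X.card := by exact_mod_cast hlt
      refine exists_card_filter_notMem_lt (l := 3) (z := 39 / 100) (δ := 8 / 10) (I := 13 / 10)
        hF hint (by omega) (by omega) (by omega) (by norm_num) (by norm_num) (by norm_num)
        (by linarith) (by norm_num) (hconv _ ?_ ?_) hz (hnum _ (by norm_num) le_rfl)
      · push_cast; linarith
      · push_cast; linarith
    · have heq : (X.card : ℝ) = 2 * k + 5 := by exact_mod_cast (le_antisymm hge hn)
      refine exists_card_filter_notMem_lt (l := 2) (z := 39 / 100) (δ := 6 / 10) (I := 13 / 10)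
        hF hint (by omega) (by omega) (by omega) (by norm_num) (by norm_num) (by norm_num)
        (by linarith) (by norm_num) (hconv _ ?_ ?_) hz (hnum _ (by norm_num) (by norm_num))
      · push_cast; linarith
      · push_cast; linarith
  · have hn' : 2 * (k : ℝ) + 14 * t ≤ X.card := by exact_mod_cast hn
    have hk' : 4 * (t : ℝ) + 8 ≤ k := by exact_mod_cast hk
    have ht' : (2 : ℝ) ≤ t := by exact_mod_cast ht
    refine exists_card_filter_notMem_lt (l := 7 * t) (z := 39 / 100) (δ := t) (I := 8 / 7)
        hF hint (by omega) (by omega) (by omega) (by norm_num) (by norm_num) (by norm_num)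
        (by linarith) (by push_cast; linarith) (hconv _ ?_ ?_) (by norm_num; linarith) ?_
    · have h1 := mul_three_quarters_pow_le (k - t - 1) (by omega)
      have h2 : ((k - t - 1 : ℕ) : ℝ) = k - t - 1 := by
        rw [Nat.cast_sub (by omega), Nat.cast_sub (by omega)]; push_cast; ring
      rw [h2, ← hτdef] at h1
      have h3 : (X.card : ℝ) * 3 * τ ≤ (16 * ((k : ℝ) - t - 1) - 19) * τ := by
        refine mul_le_mul_of_nonneg_right ?_ hτ0.le
        linarith
      have h4 : ((k : ℝ) - t) * (X.card * τ) ≤ (k - t) * t :=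
        mul_le_mul_of_nonneg_left (by linarith) (by linarith)
      linarith
    · linarith
    · intro j hj
      refine growth_numerics (q := 7 / 6) (p := 4 / 3) ?_ ?_ ?_ ?_ ?_ ?_ ?_ <;> linarith

/-- A family is stable on `X` if replacing an element by a smaller element of `X` stays in it. -/
def StableOn (X : Finset ℕ) (F : Finset (Finset ℕ)) : Prop :=
  ∀ A ∈ F, ∀ i ∈ X, ∀ j ∈ A, i < j → i ∉ A → insert i (A.erase j) ∈ F

theorem StableOn.card_le_choose {N s m : ℕ} {X : Finset ℕ} {F : Finset (Finset ℕ)}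
    (hN : X.card = N) (hst : StableOn X F)
    (hF : F ⊆ X.powersetCard (s + m)) (hs : ∀ A ∈ F, ∀ B ∈ F, s ≤ (A ∩ B).card)
    (hX : s + 2 * m ≤ N) : F.card ≤ N.choose m := by
  induction N generalizing m X F with
  | zero =>
    obtain rfl : m = 0 := by omega
    have := card_le_card hF
    rw [card_powersetCard, hN, show s + 0 = 0 by omega] at this
    exact this
  | succ N ih =>
    rcases Nat.eq_zero_or_pos m with rfl | hm
    · rw [Nat.choose_zero_right, card_le_one]
      intro A hA B hB
      have hA' := (mem_powersetCard.mp (hF hA)).2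
      have hB' := (mem_powersetCard.mp (hF hB)).2
      have h := hs A hA B hB
      have h1 : A ∩ B = A := eq_of_subset_of_card_le inter_subset_left (by omega)
      have h2 : A ∩ B = B := eq_of_subset_of_card_le inter_subset_right (by omega)
      rw [← h1, h2]
    rcases hX.eq_or_lt with heq | hlt
    · have := card_le_card hF
      rw [card_powersetCard, hN, ← heq, ← Nat.choose_symm (by omega)] at this
      rw [← heq]
      convert this using 2
      omega
    obtain ⟨m, rfl⟩ : ∃ m', m = m' + 1 := ⟨m - 1, by omega⟩
    have hne : X.Nonempty := card_pos.mp (by omega)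
    obtain ⟨x, hx, hmax⟩ : ∃ x ∈ X, ∀ y ∈ X, y ≤ x := X.exists_max_image id hne
    have hXe : (X.erase x).card = N := by rw [card_erase_of_mem hx]; omega
    have h1 : (F.filter (fun A => x ∉ A)).card ≤ N.choose (m + 1) := by
      refine ih hXe ?_ (filter_notMem_subset_powersetCard hF) ?_ (by omega)
      · intro A hA i hi j hj hij hiA
        rw [mem_filter] at hA ⊢
        refine ⟨hst A hA.1 i (mem_of_mem_erase hi) j hj hij hiA, ?_⟩
        rw [mem_insert, mem_erase]
        have := ne_of_mem_erase hi
        have := hA.2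
        tauto
      · intro A hA B hB
        exact hs A (mem_filter.mp hA).1 B (mem_filter.mp hB).1
    have h2 : (F.memberSubfamily x).card ≤ N.choose m := by
      have hsub : F.memberSubfamily x ⊆ (X.erase x).powersetCard (s + m) :=
        memberSubfamily_subset_powersetCard hF
      refine ih hXe ?_ hsub ?_ (by omega)
      · intro A hA i hi j hj hij hiA
        rw [mem_memberSubfamily] at hA ⊢
        have hix := ne_of_mem_erase hi
        have hjx : j ≠ x := fun h => hA.2 (h ▸ hj)
        have := hst _ hA.1 i (mem_of_mem_erase hi) j (mem_insert_of_mem hj) hij (by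
          rw [mem_insert]; tauto)
        rw [erase_insert_of_ne hjx.symm, insert_comm] at this
        refine ⟨this, ?_⟩
        rw [mem_insert, mem_erase]
        tauto
      · intro A hA B hB
        have hA' := mem_powersetCard.mp (hsub hA)
        have hB' := mem_powersetCard.mp (hsub hB)
        rw [mem_memberSubfamily] at hA hB
        by_contra! hcon
        have hU : (A ∪ B).card < (X.erase x).card := by
          have h3 := card_union_add_card_inter A B
          have h4 := hs _ hA.1 _ hB.1
          rw [← insert_inter_distrib, card_insert_of_notMem (fun h => hA.2 (mem_inter.mp h).1)]
            at h4
          omega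
        obtain ⟨i, hi, hiU⟩ := exists_mem_notMem_of_card_lt_card hU
        rw [mem_union, not_or] at hiU
        have hix := ne_of_mem_erase hi
        have hlt : i < x := lt_of_le_of_ne (hmax i (mem_of_mem_erase hi)) hix
        have h5 := hst _ hA.1 i (mem_of_mem_erase hi) x (mem_insert_self _ _) hlt (by
          rw [mem_insert]; tauto)
        rw [erase_insert hA.2] at h5
        have h6 := hs _ h5 _ hB.1
        have h7 : insert i A ∩ insert x B ⊆ A ∩ B := by
          intro y hy
          simp only [mem_inter, mem_insert] at hy ⊢
          rcases hy with ⟨rfl | hyA, rfl | hyB⟩ <;> tauto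
        have := card_le_card h7
        omega
    rw [← card_filter_mem_add_card_filter_notMem F x, card_filter_mem_eq, Nat.choose_succ_succ']
    omega

lemma compress_singleton {i j : ℕ} (A : Finset ℕ) (hij : i ≠ j) :
    UV.compress {i} {j} A = if i ∉ A ∧ j ∈ A then insert i (A.erase j) else A := by
  unfold UV.compress
  simp only [disjoint_singleton_left, singleton_subset_iff]
  split_ifs with h
  · ext y
    simp only [sup_eq_union, mem_sdiff, mem_union, mem_singleton, mem_insert, mem_erase]
    constructor
    · tauto
    · rintro (rfl | h')
      · exact ⟨Or.inr rfl, hij⟩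
      · tauto
  · rfl

lemma compress_subset {i j : ℕ} {X A : Finset ℕ} (hij : i ≠ j) (hi : i ∈ X) (hA : A ⊆ X) :
    UV.compress {i} {j} A ⊆ X := by
  rw [compress_singleton A hij]
  split_ifs with h
  · exact insert_subset hi ((erase_subset _ _).trans hA)
  · exact hA

lemma compression_subset_powersetCard {i j k : ℕ} {X : Finset ℕ} {F : Finset (Finset ℕ)}
    (hij : i ≠ j) (hi : i ∈ X) (hF : F ⊆ X.powersetCard k) :
    UV.compression {i} {j} F ⊆ X.powersetCard k := by
  intro A hA
  rw [UV.mem_compression] at hA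
  rcases hA with ⟨hA, -⟩ | ⟨-, B, hB, rfl⟩
  · exact hF hA
  · have hB' := mem_powersetCard.mp (hF hB)
    exact mem_powersetCard.mpr ⟨compress_subset hij hi hB'.1,
      (UV.card_compress (by simp) B).trans hB'.2⟩

lemma exists_of_mem_compression_of_notMem {i j : ℕ} {A : Finset ℕ} {F : Finset (Finset ℕ)}
    (hij : i ≠ j) (hA : A ∈ UV.compression {i} {j} F) (hAF : A ∉ F) :
    ∃ B ∈ F, i ∉ B ∧ j ∈ B ∧ A = insert i (B.erase j) := by
  rw [UV.mem_compression] at hA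
  rcases hA with ⟨hA, -⟩ | ⟨-, B, hB, rfl⟩
  · exact absurd hA hAF
  · rw [compress_singleton B hij] at hAF ⊢
    split_ifs at hAF ⊢ with h
    · exact ⟨B, hB, h.1, h.2, rfl⟩
    · exact absurd hB hAF

lemma insert_erase_mem_of_mem_compression {i j : ℕ} {A : Finset ℕ} {F : Finset (Finset ℕ)}
    (hij : i ≠ j) (hA : A ∈ UV.compression {i} {j} F) (hi : i ∉ A) :
    A ∈ F ∧ (j ∈ A → insert i (A.erase j) ∈ F) := by
  rw [UV.mem_compression] at hA
  rcases hA with ⟨hA, h⟩ | ⟨hA, B, hB, rfl⟩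
  · refine ⟨hA, fun hj => ?_⟩
    rwa [compress_singleton A hij, if_pos ⟨hi, hj⟩] at h
  · rw [compress_singleton B hij] at hi hA
    split_ifs at hi hA with h
    · exact absurd (mem_insert_self _ _) hi
    · exact absurd hB hA

lemma IntersectingFam.compression {i j : ℕ} {F : Finset (Finset ℕ)} (hij : i ≠ j)
    (hint : IntersectingFam F) : IntersectingFam (UV.compression {i} {j} F) := by
  have key : ∀ A ∈ UV.compression {i} {j} F, A ∈ F → ∀ B ∈ UV.compression {i} {j} F, B ∉ F →
      (A ∩ B).Nonempty := by
    intro A hA hAF B hB hBF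
    obtain ⟨C, hC, hiC, hjC, rfl⟩ := exists_of_mem_compression_of_notMem hij hB hBF
    by_cases hi : i ∈ A
    · exact ⟨i, mem_inter.mpr ⟨hi, mem_insert_self _ _⟩⟩
    have h1 := (insert_erase_mem_of_mem_compression hij hA hi).2
    by_cases hj : j ∈ A
    · obtain ⟨y, hy⟩ := hint _ (h1 hj) _ hC
      rw [mem_inter, mem_insert, mem_erase] at hy
      refine ⟨y, ?_⟩
      rw [mem_inter, mem_insert, mem_erase]
      rcases hy with ⟨rfl | h, h'⟩
      · exact absurd h' hiC
      · exact ⟨h.2, Or.inr ⟨h.1, h'⟩⟩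
    · obtain ⟨y, hy⟩ := hint _ hAF _ hC
      rw [mem_inter] at hy
      refine ⟨y, ?_⟩
      rw [mem_inter, mem_insert, mem_erase]
      exact ⟨hy.1, Or.inr ⟨fun h => hj (h ▸ hy.1), hy.2⟩⟩
  intro A hA B hB
  by_cases hAF : A ∈ F <;> by_cases hBF : B ∈ F
  · exact hint A hAF B hBF
  · exact key A hA hAF B hB hBF
  · rw [inter_comm]; exact key B hB hBF A hA hAF
  · obtain ⟨C, -, -, -, rfl⟩ := exists_of_mem_compression_of_notMem hij hA hAF
    obtain ⟨D, -, -, -, rfl⟩ := exists_of_mem_compression_of_notMem hij hB hBF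
    exact ⟨i, mem_inter.mpr ⟨mem_insert_self _ _, mem_insert_self _ _⟩⟩

lemma card_filter_notMem_le_compression {i j l : ℕ} (hij : i ≠ j) (hl : l ≠ i)
    (F : Finset (Finset ℕ)) : (F.filter (fun A => l ∉ A)).card ≤
      ((UV.compression {i} {j} F).filter (fun A => l ∉ A)).card := by
  rw [← UV.card_compression {i} {j} (F.filter (fun A => l ∉ A))]
  have hcomp : ∀ A : Finset ℕ, l ∉ A → l ∉ UV.compress {i} {j} A := by
    intro A hA
    rw [compress_singleton A hij]
    split_ifs
    · rw [mem_insert, mem_erase]; tauto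
    · exact hA
  refine card_le_card fun A hA => ?_
  rw [UV.mem_compression] at hA
  rw [mem_filter, UV.mem_compression]
  rcases hA with ⟨h1, h2⟩ | ⟨h1, B, hB, rfl⟩
  · rw [mem_filter] at h1 h2
    exact ⟨Or.inl ⟨h1.1, h2.1⟩, h1.2⟩
  · rw [mem_filter] at h1 hB
    have h3 := hcomp B hB.2
    exact ⟨Or.inr ⟨fun h => h1 ⟨h, h3⟩, B, hB.1, rfl⟩, h3⟩

lemma card_filter_notMem_notMem_le_compression {i j : ℕ} (hij : i ≠ j)
    (F : Finset (Finset ℕ)) : (F.filter (fun A => i ∉ A ∧ j ∉ A)).card ≤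
      ((UV.compression {i} {j} F).filter (fun A => i ∉ A)).card := by
  refine card_le_card fun A hA => ?_
  rw [mem_filter] at hA
  rw [mem_filter, UV.mem_compression, compress_singleton A hij, if_neg (by tauto)]
  exact ⟨Or.inl ⟨hA.1, hA.1⟩, hA.2.1⟩

lemma sum_sum_compression_lt {i j : ℕ} {F : Finset (Finset ℕ)} (hij : i < j)
    {A : Finset ℕ} (hA : A ∈ F) (hiA : i ∉ A) (hjA : j ∈ A) (hnot : insert i (A.erase j) ∉ F) :
    ∑ B ∈ UV.compression {i} {j} F, ∑ y ∈ B, y < ∑ B ∈ F, ∑ y ∈ B, y := by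
  have hlt : ∀ B ∈ F, UV.compress {i} {j} B ∉ F →
      ∑ y ∈ UV.compress {i} {j} B, y < ∑ y ∈ B, y := by
    intro B hB hBF
    rw [compress_singleton B hij.ne] at hBF ⊢
    split_ifs at hBF ⊢ with h
    · rw [sum_insert (fun h' => h.1 (mem_of_mem_erase h')), ← add_sum_erase B _ h.2]
      omega
    · exact absurd hB hBF
  rw [UV.compression, sum_union UV.compress_disjoint, filter_image, sum_image UV.compress_injOn,
    ← sum_filter_add_sum_filter_not F (fun B => UV.compress {i} {j} B ∈ F)]
  refine Nat.add_lt_add_left (sum_lt_sum_of_nonempty ⟨A, ?_⟩ ?_) _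
  · rw [mem_filter, compress_singleton A hij.ne, if_pos ⟨hiA, hjA⟩]
    exact ⟨hA, hnot⟩
  · intro B hB
    rw [mem_filter] at hB
    exact hlt B hB.1 hB.2

/-- Shifting cannot make all degrees jump over the gap between the two binomials. -/
lemma choose_le_card_filter_notMem_compression {i j k l : ℕ} {X : Finset ℕ}
    {F : Finset (Finset ℕ)} (hij : i ≠ j) (hi : i ∈ X) (hj : j ∈ X) (hl : l ∈ X)
    (hF : F ⊆ X.powersetCard k) (hint : IntersectingFam F) (hk : 3 ≤ k) (hX : 2 * k ≤ X.card)
    (h : ∀ x ∈ X, (X.card - 1).choose (k - 2) < (F.filter (fun A => x ∉ A)).card) :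
    (X.card - 4).choose (k - 3) ≤
      ((UV.compression {i} {j} F).filter (fun A => l ∉ A)).card := by
  have hpas : (X.card - 3).choose (k - 2) + (X.card - 4).choose (k - 3) ≤
      (X.card - 1).choose (k - 2) := by
    obtain ⟨N, hN⟩ : ∃ N, X.card = N + 4 := ⟨X.card - 4, by omega⟩
    obtain ⟨K, rfl⟩ : ∃ K, k = K + 3 := ⟨k - 3, by omega⟩
    rw [hN]
    simp only [show N + 4 - 3 = N + 1 by omega, show N + 4 - 1 = N + 3 by omega,
      Nat.add_sub_cancel, show K + 3 - 2 = K + 1 by omega]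
    rw [Nat.choose_succ_succ' (N + 2) K]
    have h1 : (N + 1).choose (K + 1) ≤ (N + 2).choose (K + 1) := Nat.choose_le_choose _ (by omega)
    have h2 : N.choose K ≤ (N + 2).choose K := Nat.choose_le_choose _ (by omega)
    omega
  by_cases hli : l = i
  swap
  · have := card_filter_notMem_le_compression (j := j) hij hli F
    have := h l hl
    omega
  subst hli
  by_contra! hcon
  have hnn := card_filter_notMem_notMem_le_compression hij F
  set P := (F.filter (fun A => l ∉ A)).memberSubfamily j with hP
  set Q := (F.filter (fun A => j ∉ A)).memberSubfamily l with hQ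
  have hPc : P.card + (F.filter (fun A => l ∉ A ∧ j ∉ A)).card =
      (F.filter (fun A => l ∉ A)).card := by
    rw [← card_filter_mem_add_card_filter_notMem (F.filter (fun A => l ∉ A)) j,
      card_filter_mem_eq, filter_filter]
  have hQc : Q.card + (F.filter (fun A => l ∉ A ∧ j ∉ A)).card =
      (F.filter (fun A => j ∉ A)).card := by
    rw [← card_filter_mem_add_card_filter_notMem (F.filter (fun A => j ∉ A)) l,
      card_filter_mem_eq, filter_filter]
    simp only [and_comm]
    rfl
  have hPs : P ⊆ ((X.erase l).erase j).powersetCard (k - 1) :=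
    memberSubfamily_subset_powersetCard (filter_notMem_subset_powersetCard hF)
  have hQs : Q ⊆ ((X.erase l).erase j).powersetCard (k - 1) := by
    rw [erase_right_comm]
    exact memberSubfamily_subset_powersetCard (filter_notMem_subset_powersetCard hF)
  have hYc : ((X.erase l).erase j).card = X.card - 2 := by
    rw [card_erase_of_mem (mem_erase.mpr ⟨hij.symm, hj⟩), card_erase_of_mem hi]
    omega
  have hcr : CrossIntersecting P Q := by
    intro A hA B hB
    rw [mem_memberSubfamily, mem_filter, mem_insert] at hA hB
    obtain ⟨y, hy⟩ := hint _ hA.1.1 _ hB.1.1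
    rw [mem_inter, mem_insert, mem_insert] at hy
    refine ⟨y, mem_inter.mpr ?_⟩
    rcases hy with ⟨rfl | h1, rfl | h2⟩ <;> tauto
  have hγi := h l hi
  have hγj := h j hj
  have hbound := hcr.card_add_rchoose_le (y := ((X.card - 3 : ℕ) : ℝ)) hPs hQs (by omega)
    (by
      rw [hYc, Nat.cast_sub (by omega), Nat.cast_sub (by omega), Nat.cast_sub (by omega)]
      have : (3 : ℝ) ≤ k := by exact_mod_cast hk
      push_cast; linarith)
    (by
      rw [hYc, rchoose_natCast, show X.card - 2 - (k - 1) = X.card - 3 - (k - 2) by omega,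
        Nat.choose_symm (by omega)]
      exact_mod_cast (by omega : (X.card - 3).choose (k - 2) ≤ P.card))
  rw [rchoose_natCast, hYc] at hbound
  have hbound' : Q.card + (X.card - 3).choose (k - 1) ≤ (X.card - 2).choose (k - 1) := by
    exact_mod_cast hbound
  have := Nat.choose_succ_succ' (X.card - 3) (k - 2)
  rw [show X.card - 3 + 1 = X.card - 2 by omega, show k - 2 + 1 = k - 1 by omega] at this
  omega

lemma StableOn.exists_card_filter_notMem_le {k : ℕ} {X : Finset ℕ} {F : Finset (Finset ℕ)}
    (hst : StableOn X F) (hF : F ⊆ X.powersetCard k) (hint : IntersectingFam F) (hk : 2 ≤ k)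
    (hX : 2 * k ≤ X.card) :
    ∃ x ∈ X, (F.filter (fun A => x ∉ A)).card ≤ (X.card - 1).choose (k - 2) := by
  have hne : X.Nonempty := card_pos.mp (by omega)
  obtain ⟨x, hx, hmin⟩ : ∃ x ∈ X, ∀ y ∈ X, x ≤ y := X.exists_min_image id hne
  refine ⟨x, hx, ?_⟩
  refine StableOn.card_le_choose (X := X.erase x) (s := 2) (m := k - 2)
    (card_erase_of_mem hx) ?_ ?_ ?_ (by omega)
  · intro A hA i hi j hj hij hiA
    rw [mem_filter] at hA ⊢
    refine ⟨hst A hA.1 i (mem_of_mem_erase hi) j hj hij hiA, ?_⟩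
    rw [mem_insert, mem_erase]
    have := ne_of_mem_erase hi
    have := hA.2
    tauto
  · rw [show 2 + (k - 2) = k by omega]
    exact filter_notMem_subset_powersetCard hF
  · intro A hA B hB
    rw [mem_filter] at hA hB
    by_contra! hlt
    obtain ⟨j, hj⟩ := hint A hA.1 B hB.1
    have h1 : (A ∩ B) = {j} := by
      refine (eq_of_subset_of_card_le (singleton_subset_iff.mpr hj) ?_).symm
      rw [card_singleton]; omega
    have hjA := (mem_inter.mp hj).1
    have hjx : j ≠ x := fun h => hA.2 (h ▸ hjA)
    have hjX := (mem_powersetCard.mp (hF hA.1)).1 hjA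
    have h2 := hst A hA.1 x hx j hjA (lt_of_le_of_ne (hmin j hjX) hjx.symm) hA.2
    obtain ⟨y, hy⟩ := hint _ h2 B hB.1
    rw [mem_inter, mem_insert, mem_erase] at hy
    rcases hy with ⟨rfl | h, h'⟩
    · exact hB.2 h'
    · have : y ∈ A ∩ B := mem_inter.mpr ⟨h.2, h'⟩
      rw [h1, mem_singleton] at this
      exact h.1 this

/-- If no intersecting family of the same size has a diversity-like count in the gap, then some
element is missed by few sets. -/
theorem exists_card_filter_notMem_lt_of_gap {k : ℕ} {X : Finset ℕ} {F : Finset (Finset ℕ)}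
    (hF : F ⊆ X.powersetCard k) (hint : IntersectingFam F) (hk : 3 ≤ k) (hX : 2 * k ≤ X.card)
    (hgap : ∀ G ⊆ X.powersetCard k, IntersectingFam G → G.card = F.card → ∀ x ∈ X,
      (X.card - 4).choose (k - 3) ≤ (G.filter (fun A => x ∉ A)).card →
      (X.card - 1).choose (k - 2) < (G.filter (fun A => x ∉ A)).card) :
    ∃ x ∈ X, (F.filter (fun A => x ∉ A)).card < (X.card - 4).choose (k - 3) := by
  classical
  by_contra! hcon
  let S : Finset (Finset (Finset ℕ)) := (X.powersetCard k).powerset.filter fun G =>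
    IntersectingFam G ∧ G.card = F.card ∧
      ∀ x ∈ X, (X.card - 1).choose (k - 2) < (G.filter (fun A => x ∉ A)).card
  have hFS : F ∈ S := by
    rw [mem_filter, mem_powerset]
    exact ⟨hF, hint, rfl, fun x hx => hgap F hF hint rfl x hx (hcon x hx)⟩
  obtain ⟨G, hGS, hmin⟩ := S.exists_min_image (fun G => ∑ B ∈ G, ∑ y ∈ B, y) ⟨F, hFS⟩
  rw [mem_filter, mem_powerset] at hGS
  obtain ⟨hG, hGint, hGc, hGx⟩ := hGS
  have hst : StableOn X G := by
    intro A hA i hi j hj hij hiA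
    by_contra hnot
    have hjX := (mem_powersetCard.mp (hG hA)).1 hj
    have hlt := sum_sum_compression_lt hij hA hiA hj hnot
    refine absurd hlt (not_lt.mpr (hmin _ ?_))
    have h1 := compression_subset_powersetCard hij.ne hi hG
    have h2 := hGint.compression hij.ne
    have h3 : (UV.compression {i} {j} G).card = F.card := (UV.card_compression _ _ _).trans hGc
    rw [mem_filter, mem_powerset]
    exact ⟨h1, h2, h3, fun x hx => hgap _ h1 h2 h3 x hx
      (choose_le_card_filter_notMem_compression hij.ne hi hjX hx hG hGint hk hX hGx)⟩
  obtain ⟨x, hx, hle⟩ := hst.exists_card_filter_notMem_le hG hGint (by omega) hX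
  exact absurd (hGx x hx) (not_lt.mpr hle)

lemma choose_sub_one_mul {n k : ℕ} (hk : 1 ≤ k) (hkn : k ≤ n) :
    (((n - 1).choose (k - 1) : ℕ) : ℝ) * n = n.choose k * k := by
  have := Nat.add_one_mul_choose_eq (n - 1) (k - 1)
  rw [show n - 1 + 1 = n by omega, show k - 1 + 1 = k by omega] at this
  rw [mul_comm]
  exact_mod_cast this

/-- Removing one point from the ground set costs a factor of at least `1 - k / n`. -/
lemma one_sub_mul_choose_le {n k i : ℕ} {p : ℝ} (hp : p * n = k) (hk : 1 ≤ k)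
    (hn : k * (i + 1) ≤ n) (hin : i + k < n) :
    (1 - p) * (n - 1 - i).choose (k - 1) ≤ (n - 2 - i).choose (k - 1) := by
  have h := Nat.choose_mul_succ_eq (n - 2 - i) (k - 1)
  rw [show n - 2 - i + 1 = n - 1 - i by omega, show n - 1 - i - (k - 1) = n - k - i by omega] at h
  have h' : ((n - 2 - i).choose (k - 1) : ℝ) * (n - 1 - i : ℕ) =
      (n - 1 - i).choose (k - 1) * (n - k - i : ℕ) := by exact_mod_cast h
  have e1 : ((n - 1 - i : ℕ) : ℝ) = n - 1 - i := by
    rw [Nat.cast_sub (by omega), Nat.cast_sub (by omega)]; push_cast; ring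
  have e2 : ((n - k - i : ℕ) : ℝ) = n - k - i := by
    rw [Nat.cast_sub (by omega), Nat.cast_sub (by omega)]
  rw [e1, e2] at h'
  have hn1 : (1 : ℝ) ≤ n - 1 - i := by
    rw [← e1]; exact_mod_cast (by omega : 1 ≤ n - 1 - i)
  have hn' : (k : ℝ) * (i + 1) ≤ n := by exact_mod_cast hn
  have hn0 : (0 : ℝ) < n := by linarith [(Nat.cast_nonneg i : (0 : ℝ) ≤ i)]
  have h3 : (1 - p) * ((n : ℝ) - 1 - i) ≤ n - k - i := by
    have hp1 : p * (i + 1) ≤ 1 := by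
      refine le_of_mul_le_mul_right ?_ hn0
      calc p * (i + 1) * n = k * (i + 1) := by rw [← hp]; ring
        _ ≤ 1 * n := by linarith
    linarith
  refine le_of_mul_le_mul_right ?_ (by linarith : (0 : ℝ) < n - 1 - i)
  rw [h']
  have := mul_le_mul_of_nonneg_left h3 (Nat.cast_nonneg ((n - 1 - i).choose (k - 1)) : (0 : ℝ) ≤ _)
  linarith

theorem IntersectingFam.card_le_of_mem_gap {k : ℕ} {p : ℝ} {X : Finset ℕ} {F : Finset (Finset ℕ)}
    (hF : F ⊆ X.powersetCard k) (hint : IntersectingFam F) (hk : 3 ≤ k) (hX : 4 * k ≤ X.card)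
    (hp : p * X.card = k) {x : ℕ} (hx : x ∈ X)
    (hlo : (X.card - 4).choose (k - 3) ≤ (F.filter (fun A => x ∉ A)).card)
    (hhi : (F.filter (fun A => x ∉ A)).card ≤ (X.card - 1).choose (k - 2)) :
    (F.card : ℝ) ≤ (X.card - 1).choose (k - 1) * (4 * p - 4 * p ^ 2 + 4 / 3 * p ^ 3) := by
  have hadd := card_filter_mem_add_card_filter_notMem F x
  have hcross : ∀ s, 2 ≤ s → s ≤ k → (X.card - 1 - s).choose (k - s) ≤
      (F.filter (fun A => x ∉ A)).card →
      (F.filter (fun A => x ∈ A)).card + (X.card - 1 - s).choose (k - 1) ≤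
        (X.card - 1).choose (k - 1) := by
    intro s hs2 hs h
    have := hint.card_filter_mem_add_rchoose_le (y := ((X.card - 1 - s : ℕ) : ℝ)) hF hx (by omega)
      (by omega) (by
        rw [Nat.cast_sub (by omega), Nat.cast_sub (by omega)]
        have : (s : ℝ) ≤ k := by exact_mod_cast hs
        push_cast; linarith) (by
        rw [rchoose_natCast, show X.card - 1 - k = X.card - 1 - s - (k - s) by omega,
          Nat.choose_symm (by omega)]
        exact_mod_cast h)
    rw [rchoose_natCast] at this
    exact_mod_cast this
  have a1 := one_sub_mul_choose_le (i := 0) hp (by omega) (by omega) (by omega)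
  have a2 := one_sub_mul_choose_le (i := 1) hp (by omega) (by omega) (by omega)
  have a3 := one_sub_mul_choose_le (i := 2) hp (by omega) (by omega) (by omega)
  rw [Nat.sub_zero, Nat.sub_zero] at a1
  rw [Nat.sub_sub, Nat.sub_sub] at a2 a3
  norm_num at a2 a3
  have hn0 : (0 : ℝ) < X.card := by exact_mod_cast (by omega : 0 < X.card)
  have hk3 : (3 : ℝ) ≤ k := by exact_mod_cast hk
  have hnk : 4 * (k : ℝ) ≤ X.card := by exact_mod_cast hX
  have hp0 : 0 < p := by
    by_contra! hneg
    have := mul_nonpos_of_nonpos_of_nonneg hneg hn0.le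
    linarith
  have hp4 : p ≤ 1 / 4 := by
    refine le_of_mul_le_mul_right ?_ hn0
    linarith
  set M : ℝ := ((X.card - 1).choose (k - 1) : ℝ) with hM
  have hM0 : 0 < M := by
    rw [hM]; exact_mod_cast Nat.choose_pos (by omega : k - 1 ≤ X.card - 1)
  have b1 : ((X.card - 3).choose (k - 2) : ℝ) ≤ M * (p * (1 - p)) := by
    have h1 := choose_sub_one_mul (n := X.card - 1) (k := k - 1) (by omega) (by omega)
    have h2 := Nat.choose_mul_succ_eq (X.card - 3) (k - 2)
    rw [show X.card - 3 + 1 = X.card - 2 by omega,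
      show X.card - 2 - (k - 2) = X.card - k by omega] at h2
    have h2' : ((X.card - 3).choose (k - 2) : ℝ) * (X.card - 2 : ℕ) =
      (X.card - 2).choose (k - 2) * (X.card - k : ℕ) := by exact_mod_cast h2
    rw [show X.card - 1 - 1 = X.card - 2 by omega, show k - 1 - 1 = k - 2 by omega] at h1
    rw [Nat.cast_sub (by omega), Nat.cast_sub (by omega)] at h1 h2'
    push_cast at h1 h2'
    set n : ℝ := (X.card : ℝ)
    set c := ((X.card - 3).choose (k - 2) : ℝ)
    have h3 : c * ((n - 2) * (n - 1)) = M * ((k - 1) * (n - k)) := by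
      linear_combination (n - 1) * h2' + (n - k) * h1
    have h4 : ((k : ℝ) - 1) * (n - k) ≤ p * (1 - p) * ((n - 2) * (n - 1)) := by
      have e : (n : ℝ) - k = n * (1 - p) := by rw [← hp]; ring
      have e2 : ((k : ℝ) - 1) * n ≤ p * ((n - 2) * (n - 1)) := by
        rw [← hp]
        have : 0 ≤ n * (1 - 3 * p) := mul_nonneg hn0.le (by linarith)
        have e3 : p * ((n - 2) * (n - 1)) - (p * n - 1) * n = n * (1 - 3 * p) + 2 * p := by ring
        linarith
      rw [e]
      have := mul_le_mul_of_nonneg_right e2 (by linarith : (0 : ℝ) ≤ 1 - p)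
      linarith
    have h5 : 0 < (n - 2) * (n - 1) := mul_pos (by linarith) (by linarith)
    refine le_of_mul_le_mul_right ?_ h5
    rw [h3]
    have := mul_le_mul_of_nonneg_left h4 hM0.le
    linarith
  have b2 : ((X.card - 1).choose (k - 2) : ℝ) * (1 - p) ≤ M * p := by
    have h1 := Nat.choose_succ_right_eq (X.card - 1) (k - 2)
    rw [show k - 2 + 1 = k - 1 by omega,
      show X.card - 1 - (k - 2) = X.card + 1 - k by omega] at h1
    have h1' : M * (k - 1 : ℕ) = (X.card - 1).choose (k - 2) * (X.card + 1 - k : ℕ) := by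
      rw [hM]; exact_mod_cast h1
    rw [Nat.cast_sub (by omega), Nat.cast_sub (by omega)] at h1'
    push_cast at h1'
    set n : ℝ := (X.card : ℝ)
    set c := ((X.card - 1).choose (k - 2) : ℝ) with hc
    have hc0 : 0 ≤ c := Nat.cast_nonneg _
    refine le_of_mul_le_mul_right ?_ hn0
    have e : (n : ℝ) - k = n * (1 - p) := by rw [← hp]; ring
    have e2 : M * p * n = M * k := by rw [← hp]; ring
    have e3 : c * (1 - p) * n = c * (n - k) := by rw [e]; ring
    rw [e2, e3]
    linarith
  have hP : 0 ≤ (1 - p) := by linarith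
  rcases le_total (F.filter (fun A => x ∉ A)).card ((X.card - 3).choose (k - 2)) with hle | hge
  · have h := hcross 3 (by omega) hk (by simpa only [Nat.sub_sub] using hlo)
    rw [Nat.sub_sub] at h
    have h1 : F.card + (X.card - (1 + 3)).choose (k - 1) ≤
      (X.card - 1).choose (k - 1) + (X.card - 3).choose (k - 2) := by omega
    norm_num at h1
    have h2 : (F.card : ℝ) + (X.card - 4).choose (k - 1) ≤ M + (X.card - 3).choose (k - 2) := by
      rw [hM]; exact_mod_cast h1
    have h3 : (1 - p) * ((1 - p) * ((1 - p) * M)) ≤ (X.card - 4).choose (k - 1) :=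
      (mul_le_mul_of_nonneg_left ((mul_le_mul_of_nonneg_left a1 hP).trans a2) hP).trans a3
    have h4 : 0 ≤ M * p ^ 3 := by positivity
    linarith
  · have h := hcross 2 le_rfl (by omega) (by simpa only [Nat.sub_sub] using hge)
    rw [Nat.sub_sub] at h
    have h1 : F.card + (X.card - (1 + 2)).choose (k - 1) ≤
      (X.card - 1).choose (k - 1) + (X.card - 1).choose (k - 2) := by omega
    norm_num at h1
    have h2 : (F.card : ℝ) + (X.card - 3).choose (k - 1) ≤ M + (X.card - 1).choose (k - 2) := by
      rw [hM]; exact_mod_cast h1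
    have h3 : (1 - p) * ((1 - p) * M) ≤ (X.card - 3).choose (k - 1) :=
      (mul_le_mul_of_nonneg_left a1 hP).trans a2
    have h4 : ((X.card - 1).choose (k - 2) : ℝ) ≤ M * (p * (1 + p + 4 / 3 * p ^ 2)) := by
      refine le_of_mul_le_mul_right ?_ (by linarith : (0 : ℝ) < 1 - p)
      refine b2.trans ?_
      have : (1 : ℝ) ≤ (1 + p + 4 / 3 * p ^ 2) * (1 - p) := by
        have : 0 ≤ p ^ 2 * (1 / 4 - p) := mul_nonneg (sq_nonneg p) (by linarith)
        linarith
      have := mul_le_mul_of_nonneg_left this (mul_pos hM0 hp0).le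
      linarith
    have h5 : 0 ≤ M * (p * (1 - 4 * p)) :=
      mul_nonneg hM0.le (mul_nonneg hp0.le (by linarith))
    linarith

lemma one_sub_pow_mul_le_one {p : ℝ} (hp : 0 ≤ p) (hp1 : p ≤ 1) (m : ℕ) :
    (1 - p) ^ m * (1 + m * p + m * (m - 1) / 2 * p ^ 2) ≤ 1 := by
  induction m with
  | zero => simp
  | succ m ih =>
    refine le_trans ?_ ih
    rw [pow_succ, mul_assoc]
    refine mul_le_mul_of_nonneg_left ?_ (pow_nonneg (by linarith) m)
    push_cast
    have h1 : 0 ≤ (m : ℝ) * (m + 1) / 2 * p ^ 3 := by positivity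
    have h2 := sq_nonneg p
    linarith

lemma gap_numerics_of_le {k t n p τ : ℝ} (hk : 0 < k) (hp : p * n = k)
    (hp4 : p ≤ 1 / 4) (hp6 : 1 / 6 ≤ p) (ht : 14 * t ≤ n - 2 * k) (hτ : τ ≤ 187 / 2000) :
    (4 * p - 4 * p ^ 2 + 4 / 3 * p ^ 3) * k < (k - t) * (1 - τ) := by
  have hp0 : 0 < p := by linarith
  have h1 : k * (16 * p - 1) / 14 ≤ p * (k - t) := by
    have := mul_le_mul_of_nonneg_left ht hp0.le
    linarith
  have hkt : 0 ≤ k - t := by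
    have : 0 ≤ p * (k - t) := le_trans
      (div_nonneg (mul_nonneg hk.le (by linarith)) (by norm_num)) h1
    exact nonneg_of_mul_nonneg_right this hp0
  have hpoly : p * (4 * p - 4 * p ^ 2 + 4 / 3 * p ^ 3) < (16 * p - 1) / 14 * (1813 / 2000) := by
    have h2 : 0 ≤ (p - 1 / 6) * (1 / 4 - p) := mul_nonneg (by linarith) (by linarith)
    have h3 : 0 ≤ 4 / 3 * p ^ 2 - 31 / 9 * p + 25 / 10 := by
      have := sq_nonneg p
      linarith
    have := mul_nonneg h2 h3
    nlinarith
  refine lt_of_mul_lt_mul_left ?_ hp0.le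
  calc p * ((4 * p - 4 * p ^ 2 + 4 / 3 * p ^ 3) * k)
      = p * (4 * p - 4 * p ^ 2 + 4 / 3 * p ^ 3) * k := by ring
    _ < (16 * p - 1) / 14 * (1813 / 2000) * k := mul_lt_mul_of_pos_right hpoly hk
    _ = k * (16 * p - 1) / 14 * (1813 / 2000) := by ring
    _ ≤ p * (k - t) * (1813 / 2000) := by linarith
    _ ≤ p * (k - t) * (1 - τ) :=
      mul_le_mul_of_nonneg_left (by linarith) (mul_nonneg hp0.le hkt)
    _ = p * ((k - t) * (1 - τ)) := by ring

lemma gap_numerics_of_ge {k t p τ : ℝ} (hk : 0 < k) (hp0 : 0 < p) (hp6 : p ≤ 1 / 6)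
    (ht : 4 * t ≤ k) (hτ : τ * (1 + 13 * p + 78 * p ^ 2) ≤ 1) :
    (4 * p - 4 * p ^ 2 + 4 / 3 * p ^ 3) * k < (k - t) * (1 - τ) := by
  have hq : 0 < 1 + 13 * p + 78 * p ^ 2 := by positivity
  have h1 : (4 * p - 4 * p ^ 2 + 4 / 3 * p ^ 3) * (1 + 13 * p + 78 * p ^ 2) <
      3 / 4 * (13 * p + 78 * p ^ 2) := by
    have h2 : 0 ≤ p * (p * (1 / 6 - p)) :=
      mul_nonneg hp0.le (mul_nonneg hp0.le (by linarith))
    have h3 : 0 ≤ p ^ 4 * (1 / 6 - p) := mul_nonneg (by positivity) (by linarith)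
    have h4 : 0 < p ^ 4 := by positivity
    have h5 : 0 ≤ p * (1 / 6 - p) := mul_nonneg hp0.le (by linarith)
    nlinarith
  refine lt_of_mul_lt_mul_right ?_ hq.le
  have h2 : 13 * p + 78 * p ^ 2 ≤ (1 - τ) * (1 + 13 * p + 78 * p ^ 2) := by linarith
  calc (4 * p - 4 * p ^ 2 + 4 / 3 * p ^ 3) * k * (1 + 13 * p + 78 * p ^ 2)
      = (4 * p - 4 * p ^ 2 + 4 / 3 * p ^ 3) * (1 + 13 * p + 78 * p ^ 2) * k := by ring
    _ < 3 / 4 * (13 * p + 78 * p ^ 2) * k := mul_lt_mul_of_pos_right h1 hk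
    _ = 3 / 4 * k * (13 * p + 78 * p ^ 2) := by ring
    _ ≤ (k - t) * (13 * p + 78 * p ^ 2) :=
      mul_le_mul_of_nonneg_right (by linarith) (by positivity)
    _ ≤ (k - t) * ((1 - τ) * (1 + 13 * p + 78 * p ^ 2)) :=
      mul_le_mul_of_nonneg_left h2 (by linarith)
    _ = _ := by ring

theorem exists_card_filter_notMem_lt_of_four_mul_le {X : Finset ℕ} {F : Finset (Finset ℕ)}
    {k t : ℕ} (hadm : Admissible X.card k t) (hn4 : 4 * k ≤ X.card)
    (hF : F ⊆ X.powersetCard k) (hint : IntersectingFam F)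
    (h : ∀ S ∈ X.powersetCard t, (X.card - t - 1).choose (k - t - 1) -
      (X.card - t - k - 1).choose (k - t - 1) < tDeg F S) :
    ∃ x ∈ X, (F.filter (fun A => x ∉ A)).card < (X.card - 4).choose (k - 3) := by
  have hk16 : 16 ≤ k := by unfold Admissible at hadm; omega
  have ht4 : 4 * t ≤ k := by unfold Admissible at hadm; omega
  have ht14 : 14 * t + 2 * k ≤ X.card := by unfold Admissible at hadm; omega
  have hm : 13 ≤ k - t - 1 := by unfold Admissible at hadm; omega
  have hk0 : (0 : ℝ) < k := by exact_mod_cast (by omega : 0 < k)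
  have hn0 : (0 : ℝ) < X.card := by exact_mod_cast (by omega : 0 < X.card)
  have hn4' : 4 * (k : ℝ) ≤ X.card := by exact_mod_cast hn4
  have ht4' : 4 * (t : ℝ) ≤ k := by exact_mod_cast ht4
  have ht14' : 14 * (t : ℝ) + 2 * k ≤ X.card := by exact_mod_cast ht14
  obtain ⟨p, hp⟩ : ∃ p : ℝ, p * X.card = k := ⟨k / X.card, div_mul_cancel₀ _ hn0.ne'⟩
  have hp0 : 0 < p := by
    by_contra! hneg
    have := mul_nonpos_of_nonpos_of_nonneg hneg hn0.le
    linarith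
  have hp4 : p ≤ 1 / 4 := by
    refine le_of_mul_le_mul_right ?_ hn0
    linarith
  have hτ : ((X.card - t - k - 1).choose (k - t - 1) : ℝ) ≤
      (1 - p) ^ (k - t - 1) * (X.card - t - 1).choose (k - t - 1) := by
    refine choose_le_pow_mul_choose (by omega) (by omega) ?_ _
    rw [show X.card - t - k - 1 = X.card - t - 1 - k by omega, Nat.cast_sub (by omega),
      Nat.cast_sub (by omega), Nat.cast_sub (by omega)]
    push_cast
    have : 0 ≤ p * (t + 1) := by positivity
    linarith
  have hsize := mul_le_card_mul_of_lt_tDeg hF (by omega) (by omega) hτ h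
  set τ : ℝ := (1 - p) ^ (k - t - 1) with hτdef
  have hτ13 : τ ≤ (1 - p) ^ 13 := pow_le_pow_of_le_one (by linarith) (by linarith) hm
  have hnum : (4 * p - 4 * p ^ 2 + 4 / 3 * p ^ 3) * k < (k - t) * (1 - τ) := by
    rcases le_total p (1 / 6) with h6 | h6
    · refine gap_numerics_of_ge hk0 hp0 h6 ht4' ?_
      have h1 := one_sub_pow_mul_le_one hp0.le (by linarith) 13
      norm_num at h1
      exact (mul_le_mul_of_nonneg_right hτ13 (by positivity)).trans h1
    · refine gap_numerics_of_le hk0 hp hp4 h6 (by linarith) ?_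
      refine hτ13.trans ((pow_le_pow_left₀ (by linarith) (by linarith : 1 - p ≤ 5 / 6) 13).trans ?_)
      norm_num
  refine exists_card_filter_notMem_lt_of_gap hF hint (by omega) (by omega) ?_
  intro G hG hGint hGc x hx hlo
  by_contra! hhi
  have hup := hGint.card_le_of_mem_gap hG (by omega) hn4 hp hx hlo hhi
  rw [hGc] at hup
  have hM := choose_sub_one_mul (n := X.card) (k := k) (by omega) (by omega)
  have hM0 : (0 : ℝ) < (X.card - 1).choose (k - 1) := by
    exact_mod_cast Nat.choose_pos (by omega : k - 1 ≤ X.card - 1)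
  set M : ℝ := ((X.card - 1).choose (k - 1) : ℝ)
  have h1 : (F.card : ℝ) * (X.card - t) ≤ F.card * X.card := by
    have : 0 ≤ (F.card : ℝ) * t := by positivity
    linarith
  have h2 : M * ((k - t) * (1 - τ)) * X.card ≤ F.card * k * X.card := by
    have h3 := mul_le_mul_of_nonneg_right (hsize.trans h1) hk0.le
    calc M * ((k - t) * (1 - τ)) * X.card = X.card.choose k * ((k - t) * (1 - τ)) * k := by
          linear_combination ((k : ℝ) - t) * (1 - τ) * hM
      _ ≤ _ := h3
      _ = _ := by ring
  have h4 := le_of_mul_le_mul_right h2 hn0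
  have h5 := mul_le_mul_of_nonneg_right hup hk0.le
  have h6 := mul_lt_mul_of_pos_left hnum hM0
  linarith

lemma choose_le_choose_of_add_le {N a b : ℕ} (hab : a ≤ b) (h : a + b ≤ N) :
    N.choose a ≤ N.choose b := by
  have key : ∀ c, a ≤ c → 2 * c ≤ N → N.choose a ≤ N.choose c := by
    intro c hc
    induction c, hc using Nat.le_induction with
    | base => exact fun _ => le_rfl
    | succ c hc ih =>
      intro h2
      exact (ih (by omega)).trans (Nat.choose_le_succ_of_lt_half_left (by omega))
  rcases le_total (2 * b) N with hb | hb
  · exact key b hab hb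
  · rw [← Nat.choose_symm (by omega : b ≤ N)]
    exact key (N - b) (by omega) (by omega)

lemma choose_add_mul_pow_le {a d c m : ℕ} (h : c + m ≤ a + 1) :
    (a + d).choose m * c ^ m ≤ a.choose m * (c + d) ^ m := by
  induction m with
  | zero => simp
  | succ m ih =>
    have ih := ih (by omega)
    have h2 := Nat.choose_succ_right_eq (a + d) m
    have h3 := Nat.choose_succ_right_eq a m
    have h1 : (a + d - m) * c ≤ (a - m) * (c + d) := by
      obtain ⟨e, rfl⟩ := Nat.exists_eq_add_of_le (by omega : c + m ≤ a)
      rw [show c + m + e + d - m = c + e + d by omega, show c + m + e - m = c + e by omega]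
      nlinarith [Nat.zero_le (e * d)]
    refine Nat.le_of_mul_le_mul_right (?_ : _ * (m + 1) ≤ _ * (m + 1)) (Nat.succ_pos m)
    calc (a + d).choose (m + 1) * c ^ (m + 1) * (m + 1)
        = ((a + d).choose m * c ^ m) * ((a + d - m) * c) := by
          rw [pow_succ]; linear_combination c ^ m * c * h2
      _ ≤ (a.choose m * (c + d) ^ m) * ((a - m) * (c + d)) := Nat.mul_le_mul ih h1
      _ = (a.choose m * (a - m)) * ((c + d) ^ m * (c + d)) := by ring
      _ = _ := by rw [← h3, pow_succ]; ring

lemma choose_mul_pow_le_choose_add {N m s : ℕ} {q : ℝ} (hq0 : 0 ≤ q) (hs : m + s ≤ N)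
    (hq : q * (m + s) ≤ N - m - s + 1) :
    (N.choose m : ℝ) * q ^ s ≤ N.choose (m + s) := by
  induction s with
  | zero => simp
  | succ s ih =>
    push_cast at hq
    have ih := ih (by omega) (by linarith)
    have h2 := Nat.choose_succ_right_eq N (m + s)
    have h3 : (N.choose (m + s + 1) : ℝ) * (m + s + 1) = N.choose (m + s) * (N - (m + s)) := by
      rw [← Nat.cast_add, ← Nat.cast_sub (by omega)]
      exact_mod_cast h2
    have hpos : (0 : ℝ) < m + s + 1 := by positivity
    refine le_of_mul_le_mul_right ?_ hpos
    rw [← add_assoc, h3, pow_succ]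
    have h4 := mul_le_mul_of_nonneg_right ih (mul_nonneg hq0 hpos.le)
    have h5 := mul_le_mul_of_nonneg_left (by linarith : q * (m + s + 1) ≤ N - (m + s))
      (Nat.cast_nonneg (N.choose (m + s)) : (0 : ℝ) ≤ _)
    linarith

lemma Admissible.choose_le_choose {n k t : ℕ} (hadm : Admissible n k t) :
    (n - k + 2 * t + 1).choose (2 * t + 2) ≤ (n - t - k - 2).choose (k - t - 2) := by
  have key : ∀ (c : ℕ) (q : ℝ), 0 < c → c + (2 * t + 2) ≤ n - t - k - 2 + 1 → 0 ≤ q →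
      q * ((2 * t + 2 : ℕ) + t) ≤ (n - t - k - 2 : ℕ) - (2 * t + 2 : ℕ) - t + 1 →
      ((c + (3 * t + 3) : ℕ) : ℝ) ^ (2 * t + 2) ≤ q ^ t * (c : ℝ) ^ (2 * t + 2) →
      (n - k + 2 * t + 1).choose (2 * t + 2) ≤ (n - t - k - 2).choose (k - t - 2) := by
    intro c q hc hcN hq0 hq hpow
    have h1 := choose_add_mul_pow_le (d := 3 * t + 3) hcN
    have h2 := choose_mul_pow_le_choose_add (N := n - t - k - 2) (m := 2 * t + 2) (s := t) hq0
      (by unfold Admissible at hadm; omega) hq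
    rw [show n - t - k - 2 + (3 * t + 3) = n - k + 2 * t + 1 by
      unfold Admissible at hadm; omega] at h1
    refine le_trans ?_ (choose_le_choose_of_add_le
      (by unfold Admissible at hadm; omega : 2 * t + 2 + t ≤ k - t - 2)
      (by unfold Admissible at hadm; omega))
    have h1' : ((n - k + 2 * t + 1).choose (2 * t + 2) : ℝ) * (c : ℝ) ^ (2 * t + 2) ≤
        (n - t - k - 2).choose (2 * t + 2) * ((c + (3 * t + 3) : ℕ) : ℝ) ^ (2 * t + 2) := by
      exact_mod_cast h1
    have h3 : ((n - k + 2 * t + 1).choose (2 * t + 2) : ℝ) * (c : ℝ) ^ (2 * t + 2) ≤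
        (n - t - k - 2).choose (2 * t + 2 + t) * (c : ℝ) ^ (2 * t + 2) := by
      refine h1'.trans ?_
      have h4 := mul_le_mul_of_nonneg_left hpow
        (Nat.cast_nonneg ((n - t - k - 2).choose (2 * t + 2)) : (0 : ℝ) ≤ _)
      have h5 := mul_le_mul_of_nonneg_right h2 (by positivity : 0 ≤ (c : ℝ) ^ (2 * t + 2))
      linarith
    have hc' : (0 : ℝ) < (c : ℝ) ^ (2 * t + 2) := by positivity
    exact_mod_cast le_of_mul_le_mul_right h3 hc'
  rcases hadm with ⟨rfl, hn, hk⟩ | ⟨ht, hk, hn⟩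
  · refine key 34 (33 / 5) (by norm_num) (by omega) (by norm_num) ?_ (by norm_num)
    have : (37 : ℝ) ≤ (n - 1 - k - 2 : ℕ) := by exact_mod_cast (by omega : 37 ≤ n - 1 - k - 2)
    push_cast; linarith
  · refine key (15 * t + 5) (33 / 8) (by omega) (by omega) (by norm_num) ?_ ?_
    · have : (17 * t + 6 : ℝ) ≤ (n - t - k - 2 : ℕ) := by
        exact_mod_cast (by omega : 17 * t + 6 ≤ n - t - k - 2)
      have : (2 : ℝ) ≤ t := by exact_mod_cast ht
      push_cast; linarith
    · have ht' : (2 : ℝ) ≤ t := by exact_mod_cast ht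
      have h1 : (((15 * t + 5) + (3 * t + 3) : ℕ) : ℝ) ≤ 44 / 35 * ((15 * t + 5 : ℕ) : ℝ) := by
        push_cast; linarith
      have h2 : (44 / 35 : ℝ) ^ (2 * t + 2) ≤ (33 / 8) ^ t := by
        have h3 : (44 / 35 : ℝ) ^ (2 * t + 2) = ((44 / 35) ^ 2) ^ t * (44 / 35) ^ 2 := by
          rw [pow_add, pow_mul]
        have h4 : ((33 / 8 : ℝ)) ^ t = ((44 / 35) ^ 2) ^ t * (33 / 8 / (44 / 35) ^ 2) ^ t := by
          rw [← mul_pow]; norm_num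
        rw [h3, h4]
        refine mul_le_mul_of_nonneg_left ?_ (by positivity)
        calc (44 / 35 : ℝ) ^ 2 ≤ (33 / 8 / (44 / 35) ^ 2) ^ 1 := by norm_num
          _ ≤ _ := pow_le_pow_right₀ (by norm_num) (by omega)
      calc _ ≤ (44 / 35 * ((15 * t + 5 : ℕ) : ℝ)) ^ (2 * t + 2) :=
            pow_le_pow_left₀ (by positivity) h1 _
        _ = (44 / 35 : ℝ) ^ (2 * t + 2) * ((15 * t + 5 : ℕ) : ℝ) ^ (2 * t + 2) := mul_pow _ _ _
        _ ≤ _ := by gcongr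

lemma card_filter_subset_disjoint {X P Q : Finset ℕ} {k : ℕ} (hP : P ⊆ X) (hQ : Q ⊆ X)
    (hPQ : Disjoint P Q) (hk : P.card ≤ k) :
    ((X.powersetCard k).filter (fun A => P ⊆ A ∧ Disjoint A Q)).card =
      (X.card - P.card - Q.card).choose (k - P.card) := by
  have hcard : (X \ (P ∪ Q)).card = X.card - P.card - Q.card := by
    rw [card_sdiff_of_subset (union_subset hP hQ), card_union_of_disjoint hPQ]; omega
  rw [← hcard, ← card_powersetCard]
  refine card_bij (fun A _ => A \ P) ?_ ?_ ?_
  · intro A hA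
    rw [mem_filter, mem_powersetCard] at hA
    obtain ⟨⟨hAX, hAk⟩, hPA, hAQ⟩ := hA
    rw [mem_powersetCard, card_sdiff_of_subset hPA, hAk]
    refine ⟨fun y hy => ?_, rfl⟩
    rw [mem_sdiff] at hy
    rw [mem_sdiff, mem_union]
    exact ⟨hAX hy.1, fun h => h.elim hy.2 (disjoint_left.mp hAQ hy.1)⟩
  · intro A hA B hB hAB
    rw [mem_filter] at hA hB
    rw [← sdiff_union_of_subset hA.2.1, ← sdiff_union_of_subset hB.2.1, hAB]
  · intro B hB
    rw [mem_powersetCard] at hB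
    have hBP : Disjoint B P := disjoint_left.mpr fun y hy hyP =>
      (mem_sdiff.mp (hB.1 hy)).2 (mem_union_left _ hyP)
    have hBQ : Disjoint B Q := disjoint_left.mpr fun y hy hyQ =>
      (mem_sdiff.mp (hB.1 hy)).2 (mem_union_right _ hyQ)
    refine ⟨B ∪ P, ?_, ?_⟩
    · rw [mem_filter, mem_powersetCard, card_union_of_disjoint hBP, hB.2]
      refine ⟨⟨union_subset (hB.1.trans sdiff_subset) hP, by omega⟩, subset_union_right, ?_⟩
      exact disjoint_union_left.mpr ⟨hBQ, hPQ⟩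
    · rw [union_sdiff_right, hBP.sdiff_eq_left]

theorem exists_tDeg_le_of_card_filter_notMem_le {X : Finset ℕ} {F : Finset (Finset ℕ)} {k t x : ℕ}
    (hF : F ⊆ X.powersetCard k) (hint : IntersectingFam F) (ht : 1 ≤ t) (htk : t + 2 ≤ k)
    (hX : 2 * k + t ≤ X.card) (hx : x ∈ X) (hne : ∃ A ∈ F, x ∉ A)
    (hγ : (F.filter (fun A => x ∉ A)).card ≤ (X.card - t - k - 2).choose (k - t - 2)) :
    ∃ S ∈ X.powersetCard t, tDeg F S ≤ (X.card - t - 1).choose (k - t - 1) -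
      (X.card - t - k - 1).choose (k - t - 1) := by
  obtain ⟨A₀, hA₀, hxA₀⟩ := hne
  have hA₀' := mem_powersetCard.mp (hF hA₀)
  have hsplit : ∀ S : Finset ℕ, tDeg F S =
      (F.filter (fun A => insert x S ⊆ A)).card +
        (F.filter (fun A => x ∉ A ∧ S ⊆ A)).card := by
    intro S
    have h := card_filter_mem_add_card_filter_notMem (F.filter (fun A => S ⊆ A)) x
    rw [filter_filter, filter_filter] at h
    rw [tDeg, ← h]
    congr 2
    · ext A; simp only [mem_filter, insert_subset_iff]; tauto
    · ext A; simp only [mem_filter]; tauto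
  by_cases hone : ∀ A ∈ F, x ∉ A → A = A₀
  · have hcard : t ≤ (X \ (insert x A₀)).card := by
      have := le_card_sdiff (insert x A₀) X
      have := card_insert_le x A₀
      omega
    obtain ⟨S, hS, hSt⟩ := exists_subset_card_eq hcard
    have hSx : x ∉ S := fun h => (mem_sdiff.mp (hS h)).2 (mem_insert_self _ _)
    have hSA : Disjoint S A₀ := disjoint_left.mpr fun y hy hyA =>
      (mem_sdiff.mp (hS hy)).2 (mem_insert_of_mem hyA)
    refine ⟨S, mem_powersetCard.mpr ⟨hS.trans sdiff_subset, hSt⟩, ?_⟩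
    have hPX : insert x S ⊆ X := insert_subset hx (hS.trans sdiff_subset)
    have hPc : (insert x S).card = t + 1 := by rw [card_insert_of_notMem hSx, hSt]
    have hP0 : Disjoint (insert x S) A₀ := disjoint_insert_left.mpr ⟨hxA₀, hSA⟩
    have c1 := card_filter_subset_disjoint (k := k) hPX (empty_subset X)
      (disjoint_empty_right _) (by omega)
    have c2 := card_filter_subset_disjoint (k := k) hPX hA₀'.1 hP0 (by omega)
    have hzero : (F.filter (fun A => x ∉ A ∧ S ⊆ A)).card = 0 := by
      rw [card_eq_zero, filter_eq_empty_iff]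
      rintro A hA ⟨hxA, hSA'⟩
      rw [hone A hA hxA] at hSA'
      obtain ⟨y, hy⟩ : S.Nonempty := card_pos.mp (by omega)
      exact disjoint_left.mp hSA hy (hSA' hy)
    rw [hsplit, hzero]
    have hdisj : Disjoint (F.filter (fun A => insert x S ⊆ A))
        ((X.powersetCard k).filter (fun A => insert x S ⊆ A ∧ Disjoint A A₀)) := by
      rw [disjoint_left]
      intro A hA hA'
      rw [mem_filter] at hA hA'
      exact (hint A hA.1 A₀ hA₀).ne_empty (disjoint_iff_inter_eq_empty.mp hA'.2.2)
    have hsub : (F.filter (fun A => insert x S ⊆ A)) ∪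
        ((X.powersetCard k).filter (fun A => insert x S ⊆ A ∧ Disjoint A A₀)) ⊆
        (X.powersetCard k).filter (fun A => insert x S ⊆ A ∧ Disjoint A ∅) := by
      intro A hA
      rw [mem_union, mem_filter, mem_filter] at hA
      rw [mem_filter]
      rcases hA with h | h
      · exact ⟨hF h.1, h.2, disjoint_empty_right _⟩
      · exact ⟨h.1, h.2.1, disjoint_empty_right _⟩
    have h1 := card_le_card hsub
    rw [card_union_of_disjoint hdisj, c1, c2, hPc, hA₀'.2, card_empty, Nat.sub_zero,
      ← Nat.sub_sub, ← Nat.sub_sub, show X.card - t - 1 - k = X.card - t - k - 1 by omega] at h1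
    omega
  · push Not at hone
    obtain ⟨A₁, hA₁, hxA₁, hA₁ne⟩ := hone
    have hA₁' := mem_powersetCard.mp (hF hA₁)
    obtain ⟨y, hyA₀, hyA₁⟩ : ∃ y ∈ A₀, y ∉ A₁ := by
      by_contra! hcon
      exact hA₁ne (eq_of_subset_of_card_le hcon (by omega)).symm
    have hcard : t ≤ (X \ (insert x (A₀ ∪ A₁))).card := by
      have h1 := le_card_sdiff (insert x (A₀ ∪ A₁)) X
      have h2 := card_insert_le x (A₀ ∪ A₁)
      have h3 := card_union_add_card_inter A₀ A₁
      have h4 := card_pos.mpr (hint A₀ hA₀ A₁ hA₁)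
      omega
    obtain ⟨S, hS, hSt⟩ := exists_subset_card_eq hcard
    have hSx : x ∉ S := fun h => (mem_sdiff.mp (hS h)).2 (mem_insert_self _ _)
    have hSA₀ : Disjoint S A₀ := disjoint_left.mpr fun y hy hyA =>
      (mem_sdiff.mp (hS hy)).2 (mem_insert_of_mem (mem_union_left _ hyA))
    have hSA₁ : Disjoint S A₁ := disjoint_left.mpr fun y hy hyA =>
      (mem_sdiff.mp (hS hy)).2 (mem_insert_of_mem (mem_union_right _ hyA))
    refine ⟨S, mem_powersetCard.mpr ⟨hS.trans sdiff_subset, hSt⟩, ?_⟩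
    have hPX : insert x S ⊆ X := insert_subset hx (hS.trans sdiff_subset)
    have hPc : (insert x S).card = t + 1 := by rw [card_insert_of_notMem hSx, hSt]
    have hP0 : Disjoint (insert x S) A₀ := disjoint_insert_left.mpr ⟨hxA₀, hSA₀⟩
    have hP1 : Disjoint (insert x S) A₁ := disjoint_insert_left.mpr ⟨hxA₁, hSA₁⟩
    have hyP : y ∉ insert x S := fun h => disjoint_left.mp hP0 h hyA₀
    have hPyc : (insert y (insert x S)).card = t + 2 := by
      rw [card_insert_of_notMem hyP, hPc]
    have c1 := card_filter_subset_disjoint (k := k) hPX (empty_subset X)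
      (disjoint_empty_right _) (by omega)
    have c2 := card_filter_subset_disjoint (k := k) hPX hA₀'.1 hP0 (by omega)
    have c3 := card_filter_subset_disjoint (k := k) (insert_subset (hA₀'.1 hyA₀) hPX) hA₁'.1
      (disjoint_insert_left.mpr ⟨hyA₁, hP1⟩) (by omega)
    rw [hsplit]
    have hsmall : (F.filter (fun A => x ∉ A ∧ S ⊆ A)).card ≤
        (F.filter (fun A => x ∉ A)).card :=
      card_le_card fun A hA => by rw [mem_filter] at hA ⊢; exact ⟨hA.1, hA.2.1⟩
    have hdisj : Disjoint (F.filter (fun A => insert x S ⊆ A))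
        ((X.powersetCard k).filter (fun A => insert x S ⊆ A ∧ Disjoint A A₀)) := by
      rw [disjoint_left]
      intro A hA hA'
      rw [mem_filter] at hA hA'
      exact (hint A hA.1 A₀ hA₀).ne_empty (disjoint_iff_inter_eq_empty.mp hA'.2.2)
    have hdisj' : Disjoint ((F.filter (fun A => insert x S ⊆ A)) ∪
        ((X.powersetCard k).filter (fun A => insert x S ⊆ A ∧ Disjoint A A₀)))
        ((X.powersetCard k).filter (fun A => insert y (insert x S) ⊆ A ∧ Disjoint A A₁)) := by
      rw [disjoint_left]
      intro A hA hA'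
      rw [mem_union, mem_filter, mem_filter] at hA
      rw [mem_filter] at hA'
      rcases hA with h | h
      · exact (hint A h.1 A₁ hA₁).ne_empty (disjoint_iff_inter_eq_empty.mp hA'.2.2)
      · exact disjoint_left.mp h.2.2 (hA'.2.1 (mem_insert_self _ _)) hyA₀
    have hsub : (F.filter (fun A => insert x S ⊆ A)) ∪
        ((X.powersetCard k).filter (fun A => insert x S ⊆ A ∧ Disjoint A A₀)) ∪
        ((X.powersetCard k).filter (fun A => insert y (insert x S) ⊆ A ∧ Disjoint A A₁)) ⊆
        (X.powersetCard k).filter (fun A => insert x S ⊆ A ∧ Disjoint A ∅) := by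
      intro A hA
      rw [mem_union, mem_union, mem_filter, mem_filter, mem_filter] at hA
      rw [mem_filter]
      rcases hA with (h | h) | h
      · exact ⟨hF h.1, h.2, disjoint_empty_right _⟩
      · exact ⟨h.1, h.2.1, disjoint_empty_right _⟩
      · exact ⟨h.1, (subset_insert _ _).trans h.2.1, disjoint_empty_right _⟩
    have h1 := card_le_card hsub
    rw [card_union_of_disjoint hdisj', card_union_of_disjoint hdisj, c1, c2, c3, hPc, hPyc,
      hA₀'.2, hA₁'.2, card_empty, Nat.sub_zero, ← Nat.sub_sub, ← Nat.sub_sub, ← Nat.sub_sub,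
      ← Nat.sub_sub, show X.card - t - 1 - k = X.card - t - k - 1 by omega,
      show X.card - t - 2 - k = X.card - t - k - 2 by omega] at h1
    omega

lemma rchoose_add (y : ℝ) (m c : ℕ) :
    rchoose y (m + c) = rchoose y m * ∏ j ∈ range c, ((y - m - j) / (m + 1 + j)) := by
  induction c with
  | zero => simp
  | succ c ih =>
    rw [← add_assoc, rchoose_succ, ih, prod_range_succ]
    push_cast
    rw [mul_div_assoc, mul_assoc, show y - (m + c : ℝ) = y - m - c by ring,
      show (m : ℝ) + c + 1 = m + 1 + c by ring]

lemma rchoose_add_eq_mul_prod (k c : ℕ) (hk : 1 ≤ k) (v : ℝ) :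
    rchoose ((2 * k + c : ℝ) - 2 - v) (k - 1 + c) =
      rchoose ((2 * k + c : ℝ) - 2 - v) (k - 1) * ∏ j ∈ range c, (1 - v / ((k : ℝ) + j)) := by
  have hk0 : (0 : ℝ) < k := by exact_mod_cast hk
  rw [rchoose_add]
  congr 1
  push_cast [Nat.cast_sub hk]
  rw [prod_div_distrib, ← prod_range_reflect, ← prod_div_distrib]
  refine prod_congr rfl fun j hj => ?_
  have hj' := mem_range.mp hj
  have e : ((c - 1 - j : ℕ) : ℝ) = c - 1 - j := by
    rw [Nat.cast_sub (by omega), Nat.cast_sub (by omega)]; push_cast; ring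
  have : (0 : ℝ) < k + j := by positivity
  rw [e, sub_add_cancel, one_sub_div this.ne']
  congr 1
  ring

lemma rchoose_mul_rchoose_mul_pow_le {N a s t K : ℝ} (ht : 0 ≤ t) (hs : t ≤ s) (hK : t ≤ K)
    (ha : a = N + K) (r : ℕ) (hr : (r : ℝ) ≤ N) :
    rchoose N r * rchoose a r * ((N + s) / (N + t)) ^ r ≤
      rchoose (N + s) r * rchoose (a - t) r := by
  induction r with
  | zero => simp [rchoose_zero]
  | succ r ih =>
    push_cast at hr
    have hr' : (r : ℝ) ≤ N := by linarith
    have hr0 : (0 : ℝ) ≤ r := r.cast_nonneg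
    have h := ih hr'
    set m : ℝ := N - r with hm
    have hm1 : 1 ≤ m := by linarith
    have hNt : 0 < N + t := by linarith
    have hstep : m * (m + K) * ((N + s) / (N + t)) ≤ (m + s) * (m + K - t) := by
      have h1 : (N + s) / (N + t) ≤ (m + s) / (m + t) := by
        rw [div_le_div_iff₀ hNt (by linarith)]
        have : 0 ≤ (N - m) * (s - t) := mul_nonneg (by linarith) (by linarith)
        linarith
      have h2 : m * (m + K) ≤ (m + K - t) * (m + t) := by
        have : 0 ≤ t * (K - t) := mul_nonneg ht (by linarith)
        linarith
      calc m * (m + K) * ((N + s) / (N + t))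
          ≤ m * (m + K) * ((m + s) / (m + t)) :=
            mul_le_mul_of_nonneg_left h1 (mul_nonneg (by linarith) (by linarith))
        _ ≤ (m + K - t) * (m + t) * ((m + s) / (m + t)) :=
            mul_le_mul_of_nonneg_right h2 (div_nonneg (by linarith) (by linarith))
        _ = (m + s) * (m + K - t) := by
            have : m + t ≠ 0 := by linarith
            field_simp
    have h0 : 0 ≤ rchoose (N + s) r * rchoose (a - t) r :=
      mul_nonneg (rchoose_nonneg (by linarith)) (rchoose_nonneg (by linarith))
    have h3 : 0 ≤ m * (m + K) * ((N + s) / (N + t)) :=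
      mul_nonneg (mul_nonneg (by linarith) (by linarith)) (div_nonneg (by linarith) hNt.le)
    have h4 := mul_le_mul h hstep h3 h0
    simp only [rchoose_succ]
    have hp : (0 : ℝ) < (r : ℝ) + 1 := by linarith
    calc _ = rchoose N r * rchoose a r * ((N + s) / (N + t)) ^ r *
          (m * (m + K) * ((N + s) / (N + t))) / (((r : ℝ) + 1) * (r + 1)) := by
          rw [pow_succ, hm, ha]; field_simp; ring
      _ ≤ rchoose (N + s) r * rchoose (a - t) r * ((m + s) * (m + K - t)) /
          (((r : ℝ) + 1) * (r + 1)) := by gcongr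
      _ = _ := by rw [hm, ha]; field_simp; ring

/-- The amount by which a non-trivial family must fall short of a star in the averaging bound. -/
noncomputable def deficit (n k t : ℕ) : ℝ :=
  (n - k - 1).choose (k - 1) * (n - 1).choose t / (n - k - 1).choose t

lemma deficit_nonneg (n k t : ℕ) : 0 ≤ deficit n k t := by unfold deficit; positivity

lemma deficit_mul_choose {n k t : ℕ} (htk : t + 1 ≤ k) (hn : 2 * k ≤ n) :
    deficit n k t * (k - 1).choose t =
      ((n - 1).choose t : ℝ) * (n - t - k - 1).choose (k - t - 1) := by
  have h := Nat.choose_mul (n := n - k - 1) (k := k - 1) (s := t) (by omega)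
  rw [show n - k - 1 - t = n - t - k - 1 by omega, show k - 1 - t = k - t - 1 by omega] at h
  have h' : ((n - k - 1).choose (k - 1) : ℝ) * (k - 1).choose t =
      (n - k - 1).choose t * (n - t - k - 1).choose (k - t - 1) := by exact_mod_cast h
  have hp : (0 : ℝ) < (n - k - 1).choose t := by
    exact_mod_cast Nat.choose_pos (by omega)
  unfold deficit
  rw [div_mul_eq_mul_div, div_eq_iff hp.ne']
  linear_combination ((n - 1).choose t : ℝ) * h'

lemma deficit_mul_le {n k t : ℕ} (htk : t + 1 ≤ k) (hn : 2 * k + 1 ≤ n) {s : ℝ} (hs : (t : ℝ) ≤ s) :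
    deficit n k t * ((n - 1 - t : ℝ) / (n - 1)) *
        (((n : ℝ) - k - 1 + s) / ((n : ℝ) - k - 1 + t)) ^ (k - 1) ≤
      rchoose ((n : ℝ) - k - 1 + s) (k - 1) := by
  have hk1 : 1 ≤ k := by omega
  have htk' : (t : ℝ) + 1 ≤ k := by exact_mod_cast htk
  have hn' : 2 * (k : ℝ) + 1 ≤ n := by exact_mod_cast hn
  have ht0 : (0 : ℝ) ≤ t := t.cast_nonneg
  have hpow := rchoose_mul_rchoose_mul_pow_le (N := (n : ℝ) - k - 1) (a := n - 2) (s := s) (t := t)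
    (K := k - 1) ht0 hs (by linarith) (by ring) (k - 1)
    (by rw [Nat.cast_sub hk1]; push_cast; linarith)
  have e1 : (n : ℝ) - k - 1 = ((n - k - 1 : ℕ) : ℝ) := by
    rw [Nat.cast_sub (by omega), Nat.cast_sub (by omega)]; push_cast; ring
  have e2 : (n : ℝ) - 2 = ((n - 2 : ℕ) : ℝ) := by
    rw [Nat.cast_sub (by omega)]; push_cast; ring
  have e3 : (n : ℝ) - 2 - t = ((n - 2 - t : ℕ) : ℝ) := by
    rw [Nat.cast_sub (by omega), e2]
  have c1 : rchoose ((n : ℝ) - k - 1) (k - 1) = (n - k - 1).choose (k - 1) := by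
    rw [e1, rchoose_natCast]
  have c2 : rchoose ((n : ℝ) - 2) (k - 1) = (n - 2).choose (k - 1) := by
    rw [e2, rchoose_natCast]
  have c3 : rchoose ((n : ℝ) - 2 - t) (k - 1) = (n - 2 - t).choose (k - 1) := by
    rw [e3, rchoose_natCast]
  rw [c1, c2, c3] at hpow
  have d1 : ((n - 2).choose (k - 1) : ℝ) * (n - 1) = (n - 1).choose k * k := by
    have := choose_sub_one_mul (k := k) (n := n - 1) hk1 (by omega)
    rw [show n - 1 - 1 = n - 2 by omega] at this
    rw [← this, Nat.cast_sub (show 1 ≤ n by omega)]; push_cast; ring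
  have d2 : ((n - 2 - t).choose (k - 1) : ℝ) * (n - 1 - t) = (n - 1 - t).choose k * k := by
    have := choose_sub_one_mul (k := k) (n := n - 1 - t) hk1 (by omega)
    rw [show n - 1 - t - 1 = n - 2 - t by omega] at this
    rw [← this, Nat.cast_sub (by omega), Nat.cast_sub (show 1 ≤ n by omega)]; push_cast; ring
  have d3 : ((n - 1).choose t : ℝ) * (n - 1 - t).choose k =
      (n - 1).choose k * (n - k - 1).choose t := by
    have h1 := Nat.choose_mul (n := n - 1) (k := t + k) (s := t) (by omega)
    have h2 := Nat.choose_mul (n := n - 1) (k := t + k) (s := k) (by omega)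
    rw [Nat.add_sub_cancel_left] at h1
    rw [Nat.add_sub_cancel, show n - 1 - k = n - k - 1 by omega] at h2
    have h3 : (t + k).choose t = (t + k).choose k := Nat.choose_symm_add
    rw [h3] at h1
    exact_mod_cast h1.symm.trans h2
  have p1 : (0 : ℝ) < (n - k - 1).choose t := by exact_mod_cast Nat.choose_pos (by omega)
  have p2 : (0 : ℝ) < (n - 2 - t).choose (k - 1) := by exact_mod_cast Nat.choose_pos (by omega)
  have p3 : (0 : ℝ) < k := by linarith
  have p4 : (0 : ℝ) < n - 1 := by linarith
  have key : ((n - 1).choose t : ℝ) * (n - 1 - t) * (n - 2 - t).choose (k - 1) =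
      (n - 2).choose (k - 1) * (n - 1) * (n - k - 1).choose t := by
    linear_combination ((n - 1).choose t : ℝ) * d2 + (k : ℝ) * d3 -
      ((n - k - 1).choose t : ℝ) * d1
  refine le_of_mul_le_mul_right ?_ p2
  refine le_trans (le_of_eq ?_) hpow
  unfold deficit
  have key' : ((n - 1).choose t : ℝ) / (n - k - 1).choose t * ((n - 1 - t) / (n - 1)) *
      (n - 2 - t).choose (k - 1) = (n - 2).choose (k - 1) := by
    rw [div_mul_div_comm, div_mul_eq_mul_div, div_eq_iff (by positivity), key]; ring
  rw [← key']
  ring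

theorem IntersectingFam.rchoose_lt_of_lt_tDeg {X : Finset ℕ} {k t x : ℕ} {F : Finset (Finset ℕ)}
    {y : ℝ} (hF : F ⊆ X.powersetCard k) (hint : IntersectingFam F) (hx : x ∈ X)
    (htk : t + 1 ≤ k) (hX : 2 * k ≤ X.card)
    (hy : (X.card : ℝ) - 1 - k ≤ y)
    (hcard : rchoose y (X.card - 1 - k) = (F.filter (fun A => x ∉ A)).card)
    (h : ∀ S ∈ X.powersetCard t, (X.card - t - 1).choose (k - t - 1) -
      (X.card - t - k - 1).choose (k - t - 1) < tDeg F S) :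
    rchoose y (k - 1) <
      (k : ℝ) / (k - t) * rchoose y (X.card - 1 - k) + deficit X.card k t := by
  have h1 := hint.card_filter_mem_add_rchoose_le hF hx (by omega) hX hy hcard.le
  have h2 := choose_mul_le_of_lt_tDeg_erase hF hx h
  rw [hcard]
  set n := X.card with hn
  set γ := (F.filter (fun A => x ∉ A)).card
  set f := (F.filter (fun A => x ∈ A)).card
  set A := (n - t - 1).choose (k - t - 1)
  set B := (n - t - k - 1).choose (k - t - 1)
  have hAB : (A : ℝ) - B ≤ ((A - B : ℕ) : ℝ) := by
    have : A ≤ (A - B) + B := by omega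
    have : (A : ℝ) ≤ ((A - B : ℕ) : ℝ) + B := by exact_mod_cast this
    linarith
  have h2' : ((n - 1).choose t : ℝ) * (((A - B : ℕ) : ℝ) + 1) ≤
      f * (k - 1).choose t + γ * k.choose t := by exact_mod_cast h2
  have hp : (0 : ℝ) < (n - 1).choose t := by exact_mod_cast Nat.choose_pos (by omega)
  have hq : (0 : ℝ) < (k - 1).choose t := by exact_mod_cast Nat.choose_pos (by omega)
  have htk' : (t : ℝ) + 1 ≤ k := by exact_mod_cast htk
  have hM : ((n - 1).choose t : ℝ) * A = (n - 1).choose (k - 1) * (k - 1).choose t := by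
    have := Nat.choose_mul (n := n - 1) (k := k - 1) (s := t) (by omega)
    rw [show n - 1 - t = n - t - 1 by omega, show k - 1 - t = k - t - 1 by omega] at this
    exact_mod_cast this.symm
  have hE := deficit_mul_choose (n := n) htk hX
  have hκ : (k.choose t : ℝ) * (k - t) = k * (k - 1).choose t := by
    have h3 := Nat.add_one_mul_choose_eq (k - 1) (k - 1 - t)
    have h4 : (k - 1).choose (k - 1 - t) = (k - 1).choose t := Nat.choose_symm (by omega)
    have h5 : k.choose (k - t) = k.choose t := Nat.choose_symm (by omega)
    rw [show k - 1 + 1 = k by omega, show k - 1 - t + 1 = k - t by omega, h4, h5] at h3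
    have h6 : (k : ℝ) * (k - 1).choose t = k.choose t * ((k - t : ℕ) : ℝ) := by exact_mod_cast h3
    rw [h6, Nat.cast_sub (by omega)]
  have hκ' : (k.choose t : ℝ) = k / (k - t) * (k - 1).choose t := by
    rw [div_mul_eq_mul_div, eq_div_iff (by linarith), hκ]
  refine lt_of_mul_lt_mul_right ?_ hq.le
  have h7 : ((n - 1).choose t : ℝ) * (A - B) < f * (k - 1).choose t + γ * k.choose t := by
    refine lt_of_lt_of_le ?_ h2'
    exact mul_lt_mul_of_pos_left (by linarith) hp
  have h8 := mul_le_mul_of_nonneg_right h1 hq.le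
  rw [hκ'] at h7
  rw [add_mul, hE]
  linarith

lemma one_sub_div_add_nonneg {k v : ℝ} (hk : 0 < k) (hvk : v ≤ k) (j : ℕ) :
    0 ≤ 1 - v / (k + j) := by
  have : 0 < k + j := by positivity
  rw [sub_nonneg, div_le_one this]
  have : (0 : ℝ) ≤ j := j.cast_nonneg
  linarith

lemma prod_one_sub_div_add_nonneg {k v : ℝ} (hk : 0 < k) (hvk : v ≤ k) (c : ℕ) :
    0 ≤ ∏ j ∈ range c, (1 - v / (k + j)) :=
  prod_nonneg fun j _ => one_sub_div_add_nonneg hk hvk j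

lemma prod_one_sub_div_add_le_pow {k v : ℝ} (hk : 0 < k) (hv : 0 ≤ v) (hvk : v ≤ k) {m c : ℕ}
    (hmc : m ≤ c) : ∏ j ∈ range c, (1 - v / (k + j)) ≤ (1 - v / (k + m)) ^ m := by
  obtain ⟨d, rfl⟩ := Nat.exists_eq_add_of_le hmc
  rw [prod_range_add]
  have h1 : ∏ j ∈ range m, (1 - v / (k + j)) ≤ ∏ _j ∈ range m, (1 - v / (k + m)) := by
    refine prod_le_prod (fun j _ => one_sub_div_add_nonneg hk hvk j) fun j hj => ?_
    have : (j : ℝ) ≤ m := by exact_mod_cast (mem_range.mp hj).le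
    gcongr
  rw [prod_const, card_range] at h1
  have h2 : ∏ j ∈ range d, (1 - v / (k + ((m + j : ℕ) : ℝ))) ≤ 1 := by
    refine prod_le_one (fun j _ => one_sub_div_add_nonneg hk hvk _) fun j _ => ?_
    have : 0 ≤ v / (k + ((m + j : ℕ) : ℝ)) := by positivity
    linarith
  exact (mul_le_of_le_one_right (prod_one_sub_div_add_nonneg hk hvk m) h2).trans h1

lemma prod_one_sub_div_add_pow_three_le {k v : ℝ} (hk : 1 ≤ k) (hv : 1 / 3 ≤ v) (hvk : v ≤ k)
    (c : ℕ) : (∏ j ∈ range c, (1 - v / (k + j))) ^ 3 * (k + c) ≤ k := by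
  induction c with
  | zero => simp
  | succ c ih =>
    refine le_trans ?_ ih
    rw [prod_range_succ, mul_pow, mul_assoc]
    have hk0 : 0 < k := by linarith
    refine mul_le_mul_of_nonneg_left ?_ (pow_nonneg (prod_one_sub_div_add_nonneg hk0 hvk c) 3)
    have hc : (0 : ℝ) ≤ c := c.cast_nonneg
    have h0 := one_sub_div_add_nonneg hk0 hvk c
    push_cast
    rw [← add_assoc]
    set a : ℝ := k + c with ha
    have ha1 : 1 ≤ a := by linarith
    have ha0 : 0 < a := by linarith
    have h1 : 1 - v / a ≤ 1 - 1 / 3 / a := by gcongr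
    have h2 : (1 - 1 / 3 / a) ^ 3 * (a + 1) ≤ a := by
      have : (1 - 1 / 3 / a) ^ 3 * (a + 1) = (a - 1 / 3) ^ 3 * (a + 1) / a ^ 3 := by
        field_simp
      rw [this, div_le_iff₀ (by positivity)]
      nlinarith [sq_nonneg (a - 1)]
    exact (mul_le_mul_of_nonneg_right (pow_le_pow_left₀ h0 h1 3) (by linarith)).trans h2

lemma prod_one_sub_div_add_mul_sq_le {k v : ℝ} (hk : 0 < k) (hv : 2 ≤ v) (hvk : v ≤ k)
    (c : ℕ) : (∏ j ∈ range c, (1 - v / (k + j))) * (k + c) ^ 2 ≤ k ^ 2 := by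
  induction c with
  | zero => simp
  | succ c ih =>
    refine le_trans ?_ ih
    rw [prod_range_succ, mul_assoc]
    refine mul_le_mul_of_nonneg_left ?_ (prod_one_sub_div_add_nonneg hk hvk c)
    push_cast
    rw [← add_assoc]
    have ha0 : 0 < k + c := by positivity
    set a : ℝ := k + c with ha
    have h1 : 1 - v / a ≤ 1 - 2 / a := by gcongr
    have h2 : (1 - 2 / a) * (a + 1) ^ 2 ≤ a ^ 2 := by
      have : (1 - 2 / a) * (a + 1) ^ 2 = (a - 2) * (a + 1) ^ 2 / a := by field_simp
      rw [this, div_le_iff₀ ha0]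
      linarith
    exact (mul_le_mul_of_nonneg_right h1 (sq_nonneg _)).trans h2

lemma rchoose_add_deficit_le {n k t : ℕ} {u ub ρ w : ℝ} (htk : t + 1 ≤ k) (hn : 2 * k + 1 ≤ n)
    (hu : u ≤ ub) (hub : ub ≤ k - t)
    (hρ : ∏ j ∈ range (n - 2 * k), (1 - (u - 1) / ((k : ℝ) + j)) ≤ ρ) (hw0 : 0 ≤ w)
    (hw : w ≤ ((n : ℝ) - 1 - t) / (n - 1) *
      (((n : ℝ) - 1 - ub) / ((n : ℝ) - k - 1 + t)) ^ (k - 1))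
    (hκ : 1 ≤ w * (1 - (k : ℝ) / (k - t) * ρ)) :
    (k : ℝ) / (k - t) * rchoose ((n : ℝ) - 1 - u) (n - 1 - k) + deficit n k t ≤
      rchoose ((n : ℝ) - 1 - u) (k - 1) := by
  have hk1 : 1 ≤ k := by omega
  have htk' : (t : ℝ) + 1 ≤ k := by exact_mod_cast htk
  have hn' : 2 * (k : ℝ) + 1 ≤ n := by exact_mod_cast hn
  have ht0 : (0 : ℝ) ≤ t := t.cast_nonneg
  have hc : ((n - 2 * k : ℕ) : ℝ) = n - 2 * k := by
    rw [Nat.cast_sub (by omega)]; push_cast; ring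
  have hmul := rchoose_add_eq_mul_prod k (n - 2 * k) hk1 (u - 1)
  rw [hc, show 2 * (k : ℝ) + (n - 2 * k) - 2 - (u - 1) = n - 1 - u by ring,
    show k - 1 + (n - 2 * k) = n - 1 - k by omega] at hmul
  have hcast : ((k - 1 : ℕ) : ℝ) = k - 1 := by rw [Nat.cast_sub hk1]; simp
  have hD := deficit_mul_le (n := n) htk hn (s := k - ub) (by linarith)
  rw [show (n : ℝ) - k - 1 + (k - ub) = n - 1 - ub by ring] at hD
  have hmono : rchoose ((n : ℝ) - 1 - ub) (k - 1) ≤ rchoose ((n : ℝ) - 1 - u) (k - 1) :=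
    rchoose_mono (by rw [hcast]; linarith) (by linarith)
  have hDb : 0 ≤ rchoose ((n : ℝ) - 1 - ub) (k - 1) :=
    rchoose_nonneg (by rw [hcast]; linarith)
  have hE := deficit_nonneg n k t
  have hκ0 : 0 ≤ (k : ℝ) / (k - t) := div_nonneg (by linarith) (by linarith)
  have hpos : 0 < 1 - (k : ℝ) / (k - t) * ρ := by
    by_contra hcon
    have := mul_nonneg hw0 (sub_nonneg.mpr (not_lt.mp hcon))
    linarith
  rw [hmul]
  set D := rchoose ((n : ℝ) - 1 - u) (k - 1)
  have h1 : deficit n k t ≤ D * (1 - (k : ℝ) / (k - t) * ρ) :=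
    calc deficit n k t ≤ deficit n k t * (w * (1 - (k : ℝ) / (k - t) * ρ)) :=
          le_mul_of_one_le_right hE hκ
      _ = deficit n k t * w * (1 - (k : ℝ) / (k - t) * ρ) := by ring
      _ ≤ D * (1 - (k : ℝ) / (k - t) * ρ) := by
          refine mul_le_mul_of_nonneg_right (le_trans ?_ (hD.trans hmono)) hpos.le
          rw [mul_assoc]
          exact mul_le_mul_of_nonneg_left hw hE
  have h2 : D * ((k : ℝ) / (k - t)) * ∏ j ∈ range (n - 2 * k), (1 - (u - 1) / ((k : ℝ) + j)) ≤
      D * ((k : ℝ) / (k - t)) * ρ :=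
    mul_le_mul_of_nonneg_left hρ (mul_nonneg (hDb.trans hmono) hκ0)
  linarith

/-- Bernoulli's inequality for the weight obtained at `u = k - (2 * t + 2)`. -/
lemma one_add_le_weight {n k t : ℕ} (hk : 2 * t + 2 ≤ k) (hn : 2 * k + 1 ≤ n) :
    1 + ((k : ℝ) - 2) * (t + 2) / (n - 1 - t) ≤ ((n : ℝ) - 1 - t) / (n - 1) *
      (((n : ℝ) - 1 - (k - (2 * t + 2))) / ((n : ℝ) - k - 1 + t)) ^ (k - 1) := by
  have hk' : 2 * (t : ℝ) + 2 ≤ k := by exact_mod_cast hk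
  have hn' : 2 * (k : ℝ) + 1 ≤ n := by exact_mod_cast hn
  have ht0 : (0 : ℝ) ≤ t := t.cast_nonneg
  have p1 : 0 < (n : ℝ) - 1 - t := by linarith
  have p2 : 0 < (n : ℝ) - k - 1 + t := by linarith
  have hb : 1 + ((t : ℝ) + 2) / (n - 1 - t) ≤
      ((n : ℝ) - 1 - (k - (2 * t + 2))) / ((n : ℝ) - k - 1 + t) := by
    have e : ((n : ℝ) - 1 - (k - (2 * t + 2))) / ((n : ℝ) - k - 1 + t) =
        1 + ((t : ℝ) + 2) / ((n : ℝ) - k - 1 + t) := by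
      field_simp; ring
    rw [e]
    gcongr
    linarith
  set b : ℝ := 1 + ((t : ℝ) + 2) / (n - 1 - t) with hbdef
  have hb1 : ((n : ℝ) - 1) / (n - 1 - t) ≤ b := by
    rw [hbdef, div_le_iff₀ p1, add_mul, div_mul_cancel₀ _ p1.ne']
    linarith
  have hb0 : 0 ≤ b := by positivity
  have hbern := one_add_mul_le_pow (R := ℝ) (a := ((t : ℝ) + 2) / (n - 1 - t)) (by
    have : 0 ≤ ((t : ℝ) + 2) / (n - 1 - t) := by positivity
    linarith) (k - 2)
  rw [Nat.cast_sub (by omega), ← hbdef] at hbern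
  push_cast at hbern
  calc 1 + ((k : ℝ) - 2) * (t + 2) / (n - 1 - t) ≤ b ^ (k - 2) := by
        rw [mul_div_assoc]; exact hbern
    _ = ((n : ℝ) - 1 - t) / (n - 1) * (((n : ℝ) - 1) / (n - 1 - t) * b ^ (k - 2)) := by
        have : (n : ℝ) - 1 ≠ 0 := by linarith
        field_simp
    _ ≤ ((n : ℝ) - 1 - t) / (n - 1) * (b * b ^ (k - 2)) := by
        refine mul_le_mul_of_nonneg_left ?_ (div_nonneg p1.le (by linarith))
        exact mul_le_mul_of_nonneg_right hb1 (pow_nonneg hb0 _)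
    _ = ((n : ℝ) - 1 - t) / (n - 1) * b ^ (k - 1) := by
        rw [← pow_succ', show k - 2 + 1 = k - 1 by omega]
    _ ≤ _ := by
        refine mul_le_mul_of_nonneg_left ?_ (div_nonneg p1.le (by linarith))
        exact pow_le_pow_left₀ hb0 hb _

lemma Admissible.two_mul_add_two_le {n k t : ℕ} (h : Admissible n k t) :
    1 ≤ t ∧ 4 * t ≤ k ∧ 2 * t + 2 ≤ k ∧ t + 1 ≤ k ∧ 2 * k + 1 ≤ n ∧ 2 * k + t ≤ n ∧ t + 2 ≤ k := by
  rcases h with ⟨_, _, _⟩ | ⟨_, _, _⟩ <;> omega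

lemma one_add_mul_pow_three_ge_of_le {z : ℝ} (h0 : 0 ≤ z) (h1 : z ≤ 1 / 7) :
    1 ≤ (1 + 14 * z) * ((1 - z) * (1 - 13 / 10 * z)) ^ 3 := by
  have h2 : (0 : ℝ) ≤ 1 / 7 - z := by linarith
  have : (0 : ℝ) ≤ 1 - 23 / 10 * z := by linarith
  have e1 : 1 - 23 / 10 * z + 13 / 10 * z ^ 2 = (1 - z) * (1 - 13 / 10 * z) := by ring
  rw [← e1]
  nlinarith [mul_nonneg h0 h2, mul_nonneg (mul_nonneg h0 h0) h2,
    mul_nonneg (pow_nonneg h0 3) h2, mul_nonneg (pow_nonneg h0 4) h2,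
    mul_nonneg (pow_nonneg h0 5) h2, mul_nonneg (pow_nonneg h0 6) h2,
    pow_nonneg h0 3, pow_nonneg h0 4, pow_nonneg h0 5, pow_nonneg h0 6, pow_nonneg h0 7,
    mul_nonneg h0 (sq_nonneg (1 / 7 - z)), mul_nonneg (pow_nonneg h0 2) (sq_nonneg (1 / 7 - z)),
    mul_nonneg (pow_nonneg h0 3) (sq_nonneg (1 / 7 - z))]

lemma one_add_mul_pow_three_ge_of_le' {z : ℝ} (h0 : 0 ≤ z) (h1 : z ≤ 1 / 35) :
    1 ≤ (1 + 5 * z) * ((1 - z) * (1 - 2 / 5 * z)) ^ 3 := by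
  have h2 : (0 : ℝ) ≤ 1 / 35 - z := by linarith
  have h3 : 1 - 21 / 5 * z ≤ (1 - 7 / 5 * z) ^ 3 := by nlinarith [sq_nonneg z]
  have h4 : (1 - 7 / 5 * z) ^ 3 ≤ ((1 - z) * (1 - 2 / 5 * z)) ^ 3 :=
    pow_le_pow_left₀ (by linarith) (by nlinarith [sq_nonneg z]) 3
  nlinarith [mul_nonneg h0 h2, mul_le_mul_of_nonneg_left (h3.trans h4)
    (show (0 : ℝ) ≤ 1 + 5 * z by linarith)]

lemma le_of_pow_three_mul_le {ρ k m c b : ℝ} (hk : 0 < k) (hb : 0 ≤ b)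
    (hρ : ρ ^ 3 * m ≤ k) (hm : k * c ≤ m) (hρ0 : 0 ≤ ρ) (hc : 0 < c) (h : 1 ≤ c * b ^ 3) :
    ρ ≤ b := by
  refine le_of_pow_le_pow_left₀ three_ne_zero hb ?_
  have h1 : ρ ^ 3 * c ≤ 1 := by
    have := (mul_le_mul_of_nonneg_left hm (pow_nonneg hρ0 3)).trans hρ
    refine le_of_mul_le_mul_left ?_ hk
    linarith
  refine le_of_mul_le_mul_right ?_ hc
  linarith

lemma le_pow_sub_two {k : ℕ} (hk : 16 ≤ k) : 5 / 13 * (k : ℝ) ≤ (119 / 100) ^ (k - 2) := by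
  obtain ⟨d, rfl⟩ := Nat.exists_eq_add_of_le hk
  have h := one_add_mul_le_pow (R := ℝ) (a := 19 / 100) (by norm_num) d
  rw [show 16 + d - 2 = 14 + d by omega, pow_add]
  have h1 : (11 : ℝ) ≤ (119 / 100) ^ 14 := by norm_num
  have h2 := mul_le_mul h1 h (by positivity) (by positivity)
  norm_num at h2 ⊢
  have : (0 : ℝ) ≤ d := d.cast_nonneg
  linarith

lemma le_pow_sub_two' {k : ℕ} (hk : 35 ≤ k) : 5 / 2 * (k : ℝ) ≤ (119 / 100) ^ (k - 2) := by
  obtain ⟨d, rfl⟩ := Nat.exists_eq_add_of_le hk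
  have h := one_add_mul_le_pow (R := ℝ) (a := 19 / 100) (by norm_num) d
  rw [show 35 + d - 2 = 33 + d by omega, pow_add]
  have h1 : (300 : ℝ) ≤ (119 / 100) ^ 33 := by norm_num
  have h2 := mul_le_mul h1 h (by positivity) (by positivity)
  norm_num at h2 ⊢
  have : (0 : ℝ) ≤ d := d.cast_nonneg
  linarith

lemma Admissible.rchoose_add_deficit_le_of_four_mul_le {n k t : ℕ} {u : ℝ} (h : Admissible n k t)
    (hn4 : 4 * k ≤ n) (hu : 3 ≤ u) (hu' : u ≤ k - (2 * t + 2)) :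
    (k : ℝ) / (k - t) * rchoose ((n : ℝ) - 1 - u) (n - 1 - k) + deficit n k t ≤
      rchoose ((n : ℝ) - 1 - u) (k - 1) := by
  obtain ⟨ht1, h4t, h2t, htk, hn, -, -⟩ := h.two_mul_add_two_le
  have ht1' : (1 : ℝ) ≤ t := by exact_mod_cast ht1
  have h4t' : 4 * (t : ℝ) ≤ k := by exact_mod_cast h4t
  have hn4' : 4 * (k : ℝ) ≤ n := by exact_mod_cast hn4
  have hk0 : (0 : ℝ) < k := by linarith
  have hnk : (0 : ℝ) < n - k := by linarith
  have hx0 : (13 / 5 : ℝ) * k ≤ (k - 2) * (t + 2) := by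
    rcases h with ⟨rfl, _, h35⟩ | ⟨h2, h16, _⟩
    · have : (35 : ℝ) ≤ k := by exact_mod_cast h35
      push_cast
      linarith
    · have h2' : (2 : ℝ) ≤ t := by exact_mod_cast h2
      have h16' : 4 * (t : ℝ) + 8 ≤ k := by exact_mod_cast h16
      have := mul_le_mul_of_nonneg_left (show (4 : ℝ) ≤ t + 2 by linarith)
        (show (0 : ℝ) ≤ k - 2 by linarith)
      linarith
  have hc : ((n - 2 * k : ℕ) : ℝ) = n - 2 * k := by
    rw [Nat.cast_sub (by omega)]; push_cast; ring
  have hρ := prod_one_sub_div_add_mul_sq_le hk0 (v := u - 1) (by linarith) (by linarith)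
    (n - 2 * k)
  rw [hc, show (k : ℝ) + (n - 2 * k) = n - k by ring] at hρ
  have hρ' : ∏ j ∈ range (n - 2 * k), (1 - (u - 1) / ((k : ℝ) + j)) ≤ ((k : ℝ) / (n - k)) ^ 2 := by
    rw [div_pow, le_div_iff₀ (by positivity)]
    exact hρ
  have hxa : 39 / 20 * ((k : ℝ) / (n - k)) ≤ ((k : ℝ) - 2) * (t + 2) / (n - 1 - t) := by
    rw [← mul_div_assoc, div_le_div_iff₀ hnk (by linarith)]
    calc 39 / 20 * (k : ℝ) * (n - 1 - t) ≤ 39 / 20 * (k : ℝ) * n :=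
          mul_le_mul_of_nonneg_left (by linarith) (by linarith)
      _ ≤ 13 / 5 * k * (n - k) := by
          have := mul_le_mul_of_nonneg_left hn4' hk0.le
          linarith
      _ ≤ _ := mul_le_mul_of_nonneg_right hx0 hnk.le
  refine rchoose_add_deficit_le htk hn hu' (by linarith) hρ' ?_ (one_add_le_weight h2t hn) ?_
  · exact add_nonneg zero_le_one
      (div_nonneg (mul_nonneg (by linarith) (by linarith)) (by linarith))
  · have hκ : (k : ℝ) / (k - t) ≤ 4 / 3 := by
      rw [div_le_div_iff₀ (by linarith) (by norm_num)]; linarith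
    set a : ℝ := (k : ℝ) / (n - k) with ha
    have ha0 : 0 ≤ a := div_nonneg hk0.le hnk.le
    have ha1 : a ≤ 1 / 3 := by
      rw [ha, div_le_div_iff₀ hnk (by norm_num)]; linarith
    have hb : (k : ℝ) / (k - t) * a ^ 2 ≤ 4 / 9 * a := by
      have h1 := mul_le_mul_of_nonneg_right hκ (sq_nonneg a)
      have h2 := mul_le_mul_of_nonneg_left ha1 ha0
      linarith
    have h3 := mul_le_mul (add_le_add_right hxa 1)
      (show 1 - 4 / 9 * a ≤ 1 - (k : ℝ) / (k - t) * a ^ 2 by linarith) (by linarith)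
      (by linarith)
    have h4 := mul_le_mul_of_nonneg_left ha1 ha0
    linarith

lemma Admissible.rchoose_add_deficit_le_of_le_div_four {n k t : ℕ} {u : ℝ} (h : Admissible n k t)
    (hn4 : n < 4 * k) (hu : 4 / 3 ≤ u) (hu' : u ≤ k / 4) :
    (k : ℝ) / (k - t) * rchoose ((n : ℝ) - 1 - u) (n - 1 - k) + deficit n k t ≤
      rchoose ((n : ℝ) - 1 - u) (k - 1) := by
  obtain ⟨ht1, h4t, h2t, htk, hn, -, -⟩ := h.two_mul_add_two_le
  have ht1' : (1 : ℝ) ≤ t := by exact_mod_cast ht1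
  have h4t' : 4 * (t : ℝ) ≤ k := by exact_mod_cast h4t
  have hn4' : (n : ℝ) < 4 * k := by exact_mod_cast hn4
  have hn' : 2 * (k : ℝ) + 1 ≤ n := by exact_mod_cast hn
  have hk0 : (0 : ℝ) < k := by linarith
  have h7t : 7 * (t : ℝ) ≤ k := by
    have : 7 * t ≤ k := by rcases h with ⟨_, _, _⟩ | ⟨_, _, _⟩ <;> omega
    exact_mod_cast this
  have hc : ((n - 2 * k : ℕ) : ℝ) = n - 2 * k := by
    rw [Nat.cast_sub (by omega)]; push_cast; ring
  have hρ := prod_one_sub_div_add_pow_three_le (show (1 : ℝ) ≤ k by linarith) (v := u - 1)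
    (by linarith) (by linarith) (n - 2 * k)
  have hρ0 := prod_one_sub_div_add_nonneg hk0 (v := u - 1) (by linarith) (n - 2 * k)
  rw [hc, show (k : ℝ) + (n - 2 * k) = n - k by ring] at hρ
  set ρ := ∏ j ∈ range (n - 2 * k), (1 - (u - 1) / ((k : ℝ) + j)) with hρdef
  have hw : (119 / 100 : ℝ) ^ (k - 2) ≤ ((n : ℝ) - 1 - t) / (n - 1) *
      (((n : ℝ) - 1 - k / 4) / ((n : ℝ) - k - 1 + t)) ^ (k - 1) := by
    have p1 : 0 < (n : ℝ) - 1 - t := by linarith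
    have p2 : 0 < (n : ℝ) - k - 1 + t := by linarith
    have hq : 119 / 100 ≤ ((n : ℝ) - 1 - k / 4) / ((n : ℝ) - k - 1 + t) := by
      rw [le_div_iff₀ p2]; linarith
    have hq' : ((n : ℝ) - 1) / (n - 1 - t) ≤
        ((n : ℝ) - 1 - k / 4) / ((n : ℝ) - k - 1 + t) := by
      have e1 : ((n : ℝ) - 1) / (n - 1 - t) = 1 + t / (n - 1 - t) := by field_simp; ring
      have e2 : ((n : ℝ) - 1 - k / 4) / ((n : ℝ) - k - 1 + t) =
          1 + (3 / 4 * k - t) / ((n : ℝ) - k - 1 + t) := by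
        field_simp; ring
      rw [e1, e2]
      have : (t : ℝ) / (n - 1 - t) ≤ (3 / 4 * k - t) / ((n : ℝ) - k - 1 + t) :=
        div_le_div₀ (by linarith) (by linarith) p2 (by linarith)
      linarith
    set q := ((n : ℝ) - 1 - k / 4) / ((n : ℝ) - k - 1 + t)
    have hq0 : 0 ≤ q := by linarith
    calc (119 / 100 : ℝ) ^ (k - 2) ≤ q ^ (k - 2) := pow_le_pow_left₀ (by norm_num) hq _
      _ = ((n : ℝ) - 1 - t) / (n - 1) * (((n : ℝ) - 1) / (n - 1 - t) * q ^ (k - 2)) := by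
          have : (n : ℝ) - 1 ≠ 0 := by linarith
          field_simp
      _ ≤ ((n : ℝ) - 1 - t) / (n - 1) * (q * q ^ (k - 2)) := by
          refine mul_le_mul_of_nonneg_left ?_ (div_nonneg p1.le (by linarith))
          exact mul_le_mul_of_nonneg_right hq' (pow_nonneg hq0 _)
      _ = _ := by rw [← pow_succ', show k - 2 + 1 = k - 1 by omega]
  refine rchoose_add_deficit_le htk hn hu' (by linarith) le_rfl (by positivity) hw ?_
  rw [← hρdef]
  have hkt : (0 : ℝ) < k - t := by linarith
  rcases h with ⟨rfl, h5, h35⟩ | ⟨h2, h16, h14⟩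
  · have h5' : 2 * (k : ℝ) + 5 ≤ n := by exact_mod_cast h5
    have h35' : (35 : ℝ) ≤ k := by exact_mod_cast h35
    have hz : 1 / (k : ℝ) ≤ 1 / 35 := one_div_le_one_div_of_le (by norm_num) h35'
    have hz0 : 0 ≤ 1 / (k : ℝ) := by positivity
    have hle := le_of_pow_three_mul_le (c := 1 + 5 * (1 / (k : ℝ)))
      (b := (1 - 1 / (k : ℝ)) * (1 - 2 / 5 * (1 / k))) hk0
      (mul_nonneg (by linarith) (by linarith)) hρ (by field_simp; linarith) hρ0 (by positivity)
      (one_add_mul_pow_three_ge_of_le' hz0 hz)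
    have h6 : (k : ℝ) / (k - (1 : ℕ)) * ρ ≤ 1 - 2 / 5 * (1 / k) := by
      rw [div_mul_eq_mul_div, div_le_iff₀ hkt]
      refine (mul_le_mul_of_nonneg_left hle hk0.le).trans (le_of_eq ?_)
      push_cast
      field_simp
    have h7 := mul_le_mul (le_pow_sub_two' h35)
      (show 2 / 5 * (1 / (k : ℝ)) ≤ 1 - (k : ℝ) / (k - (1 : ℕ)) * ρ by linarith)
      (by positivity) (by positivity)
    refine le_trans (le_of_eq ?_) h7
    field_simp
  · have h14' : 2 * (k : ℝ) + 14 * t ≤ n := by exact_mod_cast h14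
    have h2' : (2 : ℝ) ≤ t := by exact_mod_cast h2
    have hz : (t : ℝ) / k ≤ 1 / 7 := by
      rw [div_le_div_iff₀ hk0 (by norm_num)]; linarith
    have hz0 : 0 ≤ (t : ℝ) / k := by positivity
    have hle := le_of_pow_three_mul_le (c := 1 + 14 * ((t : ℝ) / k))
      (b := (1 - (t : ℝ) / k) * (1 - 13 / 10 * (t / k))) hk0
      (mul_nonneg (by linarith) (by linarith)) hρ (by field_simp; linarith) hρ0 (by positivity)
      (one_add_mul_pow_three_ge_of_le hz0 hz)
    have h6 : (k : ℝ) / (k - t) * ρ ≤ 1 - 13 / 10 * (t / k) := by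
      rw [div_mul_eq_mul_div, div_le_iff₀ hkt]
      refine (mul_le_mul_of_nonneg_left hle hk0.le).trans (le_of_eq ?_)
      field_simp
    have h8 : 13 / 5 * (1 / (k : ℝ)) ≤ 13 / 10 * (t / k) := by
      have := div_le_div_of_nonneg_right h2' hk0.le
      rw [show (2 : ℝ) / k = 2 * (1 / k) by ring] at this
      linarith
    have h7 := mul_le_mul (le_pow_sub_two (k := k) (by omega))
      (show 13 / 5 * (1 / (k : ℝ)) ≤ 1 - (k : ℝ) / (k - t) * ρ by linarith)
      (by positivity) (by positivity)
    refine le_trans (le_of_eq ?_) h7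
    field_simp

lemma Admissible.rchoose_add_deficit_le_of_div_four_le {n k t : ℕ} {u : ℝ} (h : Admissible n k t)
    (hn4 : n < 4 * k) (hu : k / 4 ≤ u) (hu' : u ≤ k - (2 * t + 2)) :
    (k : ℝ) / (k - t) * rchoose ((n : ℝ) - 1 - u) (n - 1 - k) + deficit n k t ≤
      rchoose ((n : ℝ) - 1 - u) (k - 1) := by
  obtain ⟨ht1, h4t, h2t, htk, hn, -, -⟩ := h.two_mul_add_two_le
  have ht1' : (1 : ℝ) ≤ t := by exact_mod_cast ht1
  have h4t' : 4 * (t : ℝ) ≤ k := by exact_mod_cast h4t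
  have hn4' : (n : ℝ) < 4 * k := by exact_mod_cast hn4
  have hn' : 2 * (k : ℝ) + 1 ≤ n := by exact_mod_cast hn
  have hk0 : (0 : ℝ) < k := by linarith
  have hw0 : 0 ≤ 1 + ((k : ℝ) - 2) * (t + 2) / (n - 1 - t) :=
    add_nonneg zero_le_one (div_nonneg (mul_nonneg (by linarith) (by linarith)) (by linarith))
  have hweight := one_add_le_weight h2t hn
  rcases h with ⟨rfl, h5, h35⟩ | ⟨h2, h16, h14⟩
  · have h35' : (35 : ℝ) ≤ k := by exact_mod_cast h35
    have hρ := prod_one_sub_div_add_le_pow hk0 (v := u - 1) (by linarith) (by linarith)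
      (show 5 ≤ n - 2 * k by omega)
    push_cast at hρ
    have hv : 31 / 160 ≤ (u - 1) / ((k : ℝ) + 5) := by
      rw [le_div_iff₀ (by linarith)]; linarith
    have hv1 : (u - 1) / ((k : ℝ) + 5) ≤ 1 := by
      rw [div_le_one (by linarith)]; push_cast at hu'; linarith
    have hρ' := hρ.trans (pow_le_pow_left₀ (by linarith)
      (show 1 - (u - 1) / ((k : ℝ) + 5) ≤ 129 / 160 by linarith) 5)
    refine rchoose_add_deficit_le htk hn hu' (by push_cast; linarith) hρ' hw0 hweight ?_
    have hκ : (k : ℝ) / (k - (1 : ℕ)) ≤ 35 / 34 := by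
      rw [div_le_div_iff₀ (by push_cast; linarith) (by norm_num)]; push_cast; linarith
    have hx : 7 / 10 ≤ ((k : ℝ) - 2) * ((1 : ℕ) + 2) / (n - 1 - (1 : ℕ)) := by
      push_cast
      rw [le_div_iff₀ (by linarith)]; linarith
    have h3 := mul_le_mul (add_le_add_right hx 1)
      (show 3 / 5 ≤ 1 - (k : ℝ) / (k - (1 : ℕ)) * (129 / 160) ^ 5 by
        have := mul_le_mul_of_nonneg_right hκ (show (0 : ℝ) ≤ (129 / 160) ^ 5 by positivity)
        norm_num at this ⊢
        linarith) (by norm_num) hw0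
    linarith
  · have h2' : (2 : ℝ) ≤ t := by exact_mod_cast h2
    have h16' : 4 * (t : ℝ) + 8 ≤ k := by exact_mod_cast h16
    have hρ := prod_one_sub_div_add_le_pow hk0 (v := u - 1) (by linarith) (by linarith)
      (show 28 ≤ n - 2 * k by omega)
    push_cast at hρ
    have hv : 3 / 44 ≤ (u - 1) / ((k : ℝ) + 28) := by
      rw [le_div_iff₀ (by linarith)]; linarith
    have hv1 : (u - 1) / ((k : ℝ) + 28) ≤ 1 := by
      rw [div_le_one (by linarith)]; linarith
    have hρ' := hρ.trans (pow_le_pow_left₀ (by linarith)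
      (show 1 - (u - 1) / ((k : ℝ) + 28) ≤ 41 / 44 by linarith) 28)
    have hρ'' := hρ'.trans (show (41 / 44 : ℝ) ^ 28 ≤ 3 / 20 by norm_num)
    refine rchoose_add_deficit_le htk hn hu' (by linarith) hρ'' hw0 hweight ?_
    have hκ : (k : ℝ) / (k - t) ≤ 4 / 3 := by
      rw [div_le_div_iff₀ (by linarith) (by norm_num)]; linarith
    have hx : 4 / 5 ≤ ((k : ℝ) - 2) * (t + 2) / (n - 1 - t) := by
      rw [le_div_iff₀ (by linarith)]
      have := mul_le_mul_of_nonneg_left (show (4 : ℝ) ≤ t + 2 by linarith)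
        (show (0 : ℝ) ≤ k - 2 by linarith)
      linarith
    have h3 := mul_le_mul (add_le_add_right hx 1)
      (show 4 / 5 ≤ 1 - (k : ℝ) / (k - t) * (3 / 20) by linarith) (by norm_num) hw0
    linarith

theorem IntersectingFam.exists_tDeg_le_of_card_filter_notMem_lt {X : Finset ℕ} {k t x : ℕ}
    {F : Finset (Finset ℕ)} {u₀ : ℝ} (hadm : Admissible X.card k t)
    (hF : F ⊆ X.powersetCard k) (hint : IntersectingFam F) (hx : x ∈ X)
    (hne : ∃ A ∈ F, x ∉ A) (hu₀ : u₀ ≤ k)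
    (hγ : ((F.filter (fun A => x ∉ A)).card : ℝ) <
      rchoose ((X.card : ℝ) - 1 - u₀) (X.card - 1 - k))
    (hzone : ∀ u : ℝ, u₀ ≤ u → u ≤ k - (2 * t + 2) →
      (k : ℝ) / (k - t) * rchoose ((X.card : ℝ) - 1 - u) (X.card - 1 - k) + deficit X.card k t ≤
        rchoose ((X.card : ℝ) - 1 - u) (k - 1)) :
    ∃ S ∈ X.powersetCard t, tDeg F S ≤ (X.card - t - 1).choose (k - t - 1) -
      (X.card - t - k - 1).choose (k - t - 1) := by
  obtain ⟨ht1, -, h2t, htk, hn, hnt, htk2⟩ := hadm.two_mul_add_two_le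
  rcases le_or_gt (F.filter (fun A => x ∉ A)).card ((X.card - k + 2 * t + 1).choose (2 * t + 2))
    with hsmall | hbig
  · exact exists_tDeg_le_of_card_filter_notMem_le hF hint ht1 htk2 hnt hx hne
      (hsmall.trans hadm.choose_le_choose)
  by_contra! hcon
  set n := X.card
  set N := n - 1 - k with hN
  have hNr : (N : ℝ) = n - 1 - k := by
    rw [hN, Nat.cast_sub (by omega), Nat.cast_sub (by omega)]; simp
  obtain ⟨A, hA, hxA⟩ := hne
  have hone : (1 : ℝ) ≤ (F.filter (fun A => x ∉ A)).card := by
    exact_mod_cast card_pos.mpr ⟨A, mem_filter.mpr ⟨hA, hxA⟩⟩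
  obtain ⟨y, hy1, hy2, hy3⟩ := exists_rchoose_eq (x := (n : ℝ) - 1 - u₀) (by rw [hNr]; linarith)
    hone hγ.le
  have hylow : (n : ℝ) - k + 2 * t + 1 ≤ y := by
    by_contra! hlt
    have h1 := rchoose_mono (r := N) (by linarith) hlt.le
    have e : (n : ℝ) - k + 2 * t + 1 = ((N + (2 * t + 2) : ℕ) : ℝ) := by
      push_cast; rw [hNr]; ring
    rw [hy3, e, rchoose_natCast, Nat.choose_symm_add,
      show N + (2 * t + 2) = n - k + 2 * t + 1 by omega] at h1
    exact absurd (by exact_mod_cast h1) hbig.not_ge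
  have hz := hzone (n - 1 - y) (by linarith) (by linarith)
  rw [sub_sub_cancel] at hz
  exact absurd (hint.rchoose_lt_of_lt_tDeg hF hx htk (by omega) (by rw [← hNr]; exact hy1) hy3 hcon)
    hz.not_gt

/-- The bound over an arbitrary finite ground set of naturals. -/
theorem IntersectingFam.exists_tDeg_le {X : Finset ℕ} {k t : ℕ} {F : Finset (Finset ℕ)}
    (hadm : Admissible X.card k t) (hF : F ⊆ X.powersetCard k) (hint : IntersectingFam F)
    (hne : ∀ x ∈ X, ∃ A ∈ F, x ∉ A) :
    ∃ S ∈ X.powersetCard t, tDeg F S ≤ (X.card - t - 1).choose (k - t - 1) -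
      (X.card - t - k - 1).choose (k - t - 1) := by
  obtain ⟨ht1, -, h2t, htk, hn, hnt, htk2⟩ := hadm.two_mul_add_two_le
  have h4k : 4 ≤ k := by omega
  have h4k' : (4 : ℝ) ≤ k := by exact_mod_cast h4k
  by_contra! hcon
  rcases lt_or_ge X.card (4 * k) with hn4 | hn4
  · obtain ⟨x, hx, hγ⟩ := exists_card_filter_notMem_lt_of_lt_four_mul hadm hn4 hF hint hcon
    obtain ⟨S, hS, hle⟩ := hint.exists_tDeg_le_of_card_filter_notMem_lt (u₀ := 4 / 3) hadm hF hx
      (hne x hx) (by linarith)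
      (by rwa [show (X.card : ℝ) - 1 - 4 / 3 = X.card - 7 / 3 by ring])
      fun u hu hu' => by
        rcases le_total u (k / 4) with h | h
        · exact hadm.rchoose_add_deficit_le_of_le_div_four hn4 hu h
        · exact hadm.rchoose_add_deficit_le_of_div_four_le hn4 h hu'
    exact absurd hle (hcon S hS).not_ge
  · obtain ⟨x, hx, hγ⟩ := exists_card_filter_notMem_lt_of_four_mul_le hadm hn4 hF hint hcon
    have e : rchoose ((X.card : ℝ) - 1 - 3) (X.card - 1 - k) = (X.card - 4).choose (k - 3) := by
      have : (X.card : ℝ) - 1 - 3 = ((X.card - 4 : ℕ) : ℝ) := by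
        rw [Nat.cast_sub (by omega)]; push_cast; ring
      rw [this, rchoose_natCast, ← Nat.choose_symm (by omega),
        show X.card - 4 - (X.card - 1 - k) = k - 3 by omega]
    obtain ⟨S, hS, hle⟩ := hint.exists_tDeg_le_of_card_filter_notMem_lt (u₀ := 3) hadm hF hx
      (hne x hx) (by linarith) (by rw [e]; exact_mod_cast hγ)
      fun u hu hu' => hadm.rchoose_add_deficit_le_of_four_mul_le hn4 hu hu'
    exact absurd hle (hcon S hS).not_ge

/-- the `t`-degree version of the Hilton–Milner theorem. -/
theorem statement16 (n k t : ℕ)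
    (hcond : (t = 1 ∧ 2 * k + 5 ≤ n ∧ 35 ≤ k) ∨
      (2 ≤ t ∧ (t : ℚ) ≤ (k : ℚ) / 4 - 2 ∧ 2 * k + 14 * t ≤ n))
    (F : Finset (Finset ℕ)) (hF : F ⊆ (Finset.Icc 1 n).powersetCard k)
    (hint : IntersectingFam F)
    (hnontriv : ∀ i ∈ Finset.Icc 1 n, ∃ A ∈ F, i ∉ A) :
    ∃ S ∈ (Finset.Icc 1 n).powersetCard t,
      tDeg F S ≤ Nat.choose (n - t - 1) (k - t - 1) -
        Nat.choose (n - t - k - 1) (k - t - 1) := by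

  have hadm : Admissible (Icc 1 n).card k t := by
    rw [Nat.card_Icc, Nat.add_sub_cancel]
    refine hcond.imp id fun ⟨h2, hk, h14⟩ => ⟨h2, ?_, h14⟩
    have : (4 * t + 8 : ℚ) ≤ k := by linarith
    exact_mod_cast this
  have h := hint.exists_tDeg_le hadm hF hnontriv
  rwa [Nat.card_Icc, Nat.add_sub_cancel] at h
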